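/- (Alt–Caffarelli–Friedman type monotonicity formula.) Let n ≥ 2 and let (u,v) be a solution of Δu = u v², Δv = v u², u > 0, v > 0 on ℝⁿ satisfying the linear growth condition u(x) + v(x) ≤ C₀(1 + |x|) for some constant C₀ > 0. Then there exists a positive constant C such that the function r ↦ e^{−C r^{−1/2}} J(r; 0) is nondecreasing on (1, ∞). -/

import Mathlib

open MeasureTheory Metric
open scoped RealInnerProductSpace

noncomputable section

/-- The Laplacian of a function on Euclidean space, as the trace of the second derivative. -/
def lap {n : ℕ} (u : EuclideanSpace ℝ (Fin n) → ℝ) (x : EuclideanSpace ℝ (Fin n)) : ℝ :=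
  ∑ i : Fin n, iteratedFDeriv ℝ 2 u x (fun _ => EuclideanSpace.single i 1)

/-- A (positive classical) solution of the system Δu = u v², Δv = v u², u,v > 0 on ℝⁿ. -/
def IsSolution {n : ℕ} (u v : EuclideanSpace ℝ (Fin n) → ℝ) : Prop :=
  ContDiff ℝ (⊤ : ℕ∞) u ∧ ContDiff ℝ (⊤ : ℕ∞) v ∧ (∀ x, 0 < u x) ∧ (∀ x, 0 < v x) ∧
    (∀ x, lap u x = u x * v x ^ 2) ∧ (∀ x, lap v x = v x * u x ^ 2)

/-- The Alt–Caffarelli–Friedman quantity J(r; x). -/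
def Jfun {n : ℕ} (u v : EuclideanSpace ℝ (Fin n) → ℝ) (x : EuclideanSpace ℝ (Fin n)) (r : ℝ) :
    ℝ :=
  r ^ (-4 : ℝ) *
    ((∫ y in ball x r,
        (‖gradient u y‖ ^ 2 + (u y) ^ 2 * (v y) ^ 2) * ‖x - y‖ ^ ((2 : ℝ) - n)) *
     (∫ y in ball x r,
        (‖gradient v y‖ ^ 2 + (u y) ^ 2 * (v y) ^ 2) * ‖x - y‖ ^ ((2 : ℝ) - n)))

/-- The standard Gaussian density on the line. -/
def gpdf (x : ℝ) : ℝ := (√(2 * Real.pi))⁻¹ * Real.exp (-(x ^ 2) / 2)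

lemma gpdf_pos (x : ℝ) : 0 < gpdf x := by unfold gpdf; positivity

lemma gpdf_neg (x : ℝ) : gpdf (-x) = gpdf x := by simp [gpdf]

lemma gpdf_hasDerivAt (x : ℝ) : HasDerivAt gpdf (-x * gpdf x) x := by
  unfold gpdf
  have h : HasDerivAt (fun x : ℝ => -(x ^ 2) / 2) (-x) x := by
    have := ((hasDerivAt_pow 2 x).neg).div_const 2
    exact this.congr_deriv (by norm_num; ring)
  exact (h.exp.const_mul ((√(2 * Real.pi))⁻¹)).congr_deriv (by ring)

lemma gpdf_continuous : Continuous gpdf := by unfold gpdf; fun_prop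

lemma gpdf_integrable : Integrable gpdf := by
  unfold gpdf
  have := (integrable_exp_neg_mul_sq (b := 1/2) (by norm_num)).const_mul ((√(2 * Real.pi))⁻¹)
  convert this using 4
  ring

lemma gpdf_integral : ∫ x, gpdf x = 1 := by
  unfold gpdf
  have := integral_gaussian (1/2)
  rw [integral_const_mul]
  have h2 : ∀ x : ℝ, -(x^2)/2 = -(1/2) * x^2 := fun x => by ring
  simp_rw [h2]
  rw [this, show Real.pi / (1/2) = 2 * Real.pi by ring]
  have : 0 < √(2 * Real.pi) := by positivity
  field_simp

lemma gpdf_le_of_abs_le {x y : ℝ} (h : |x| ≤ |y|) : gpdf y ≤ gpdf x := by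
  unfold gpdf
  have := sq_le_sq.mpr h
  gcongr

/-- The standard Gaussian cumulative distribution function. -/
def gcdf (x : ℝ) : ℝ := ∫ t in Set.Iic x, gpdf t

lemma gcdf_hasDerivAt (x : ℝ) : HasDerivAt gcdf (gpdf x) x := by
  have h1 : gcdf = fun y => (∫ t in Set.Iic x, gpdf t) + ∫ t in x..y, gpdf t := by
    funext y
    have := intervalIntegral.integral_Iic_sub_Iic (μ := volume) (f := gpdf) (a := x) (b := y)
      gpdf_integrable.integrableOn gpdf_integrable.integrableOn
    unfold gcdf
    linarith
  rw [h1]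
  exact (intervalIntegral.integral_hasDerivAt_right
    (gpdf_continuous.intervalIntegrable _ _)
    (gpdf_continuous.stronglyMeasurableAtFilter _ _) gpdf_continuous.continuousAt).const_add _

lemma gcdf_continuous : Continuous gcdf :=
  continuous_iff_continuousAt.2 fun x => (gcdf_hasDerivAt x).continuousAt

lemma gcdf_strictMono : StrictMono gcdf := by
  apply strictMono_of_deriv_pos
  intro x
  rw [(gcdf_hasDerivAt x).deriv]
  exact gpdf_pos x

lemma gcdf_add_Ioi (x : ℝ) : gcdf x + ∫ t in Set.Ioi x, gpdf t = 1 := by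
  rw [← gpdf_integral]
  exact intervalIntegral.integral_Iic_add_Ioi gpdf_integrable.integrableOn
    gpdf_integrable.integrableOn

lemma gcdf_neg (x : ℝ) : gcdf (-x) = 1 - gcdf x := by
  have h1 : gcdf (-x) = ∫ t in Set.Ioi x, gpdf t := by
    unfold gcdf
    rw [← integral_comp_neg_Ioi]
    simp [gpdf_neg]
  linarith [gcdf_add_Ioi x]

lemma gcdf_zero : gcdf 0 = 1 / 2 := by
  have := gcdf_neg 0
  simp at this
  linarith

lemma gcdf_tendsto_atTop : Filter.Tendsto gcdf Filter.atTop (nhds 1) := by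
  rw [← gpdf_integral]
  exact MeasureTheory.AECover.integral_tendsto_of_countably_generated
    (MeasureTheory.aecover_Iic Filter.tendsto_id) gpdf_integrable

lemma gcdf_tendsto_atBot : Filter.Tendsto gcdf Filter.atBot (nhds 0) := by
  have h : gcdf = fun x => 1 - gcdf (-x) := by
    funext x; rw [gcdf_neg]; ring
  rw [h]
  have := (gcdf_tendsto_atTop.comp Filter.tendsto_neg_atBot_atTop).const_sub 1
  simpa using this

lemma gcdf_lt_one (x : ℝ) : gcdf x < 1 :=
  lt_of_lt_of_le (gcdf_strictMono (lt_add_one x))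
    (gcdf_strictMono.monotone.ge_of_tendsto gcdf_tendsto_atTop _)

lemma gcdf_pos (x : ℝ) : 0 < gcdf x := by
  have := gcdf_lt_one (-x)
  rw [gcdf_neg] at this
  linarith

lemma gcdf_surj {m : ℝ} (hm : m ∈ Set.Ioo (0:ℝ) 1) : ∃ x, gcdf x = m := by
  obtain ⟨a, ha⟩ := ((gcdf_tendsto_atBot.eventually_lt_const hm.1)).exists
  obtain ⟨b, hb⟩ := ((gcdf_tendsto_atTop.eventually_const_lt hm.2)).exists
  exact mem_range_of_exists_le_of_exists_ge gcdf_continuous ⟨a, ha.le⟩ ⟨b, hb.le⟩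

/-- The standard Gaussian quantile function (junk outside `(0, 1)`). -/
def gquant : ℝ → ℝ := Function.invFun gcdf

lemma gquant_gcdf (x : ℝ) : gquant (gcdf x) = x :=
  Function.leftInverse_invFun gcdf_strictMono.injective x

lemma gcdf_gquant {m : ℝ} (hm : m ∈ Set.Ioo (0:ℝ) 1) : gcdf (gquant m) = m :=
  Function.invFun_eq (gcdf_surj hm)

lemma gquant_lt_iff {m x : ℝ} (hm : m ∈ Set.Ioo (0:ℝ) 1) : gquant m < x ↔ m < gcdf x := by
  rw [← gcdf_strictMono.lt_iff_lt, gcdf_gquant hm]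

lemma gquant_hasDerivAt {m : ℝ} (hm : m ∈ Set.Ioo (0:ℝ) 1) :
    HasDerivAt gquant (gpdf (gquant m))⁻¹ m := by
  have hmono : MonotoneOn gquant (Set.Ioo 0 1) := by
    intro a ha b hb hab
    rw [← gcdf_strictMono.le_iff_le, gcdf_gquant ha, gcdf_gquant hb]; exact hab
  have hc : ContinuousAt gquant m := by
    apply continuousAt_of_monotoneOn_of_image_mem_nhds hmono (Ioo_mem_nhds hm.1 hm.2)
    convert Filter.univ_mem
    ext x
    simp only [Set.mem_image, Set.mem_univ, iff_true]
    exact ⟨gcdf x, ⟨gcdf_pos x, gcdf_lt_one x⟩, gquant_gcdf x⟩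
  refine HasDerivAt.of_local_left_inverse hc (gcdf_hasDerivAt _) (gpdf_pos _).ne' ?_
  filter_upwards [Ioo_mem_nhds hm.1 hm.2] with y hy using gcdf_gquant hy

lemma gquant_one_sub {m : ℝ} (hm : m ∈ Set.Ioo (0:ℝ) 1) : gquant (1 - m) = -gquant m := by
  have := gcdf_neg (gquant m)
  rw [gcdf_gquant hm] at this
  rw [← this, gquant_gcdf]

open Classical in
/-- The Gaussian isoperimetric profile. -/
def gprof (m : ℝ) : ℝ := if m ∈ Set.Ioo (0:ℝ) 1 then gpdf (gquant m) else 0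

lemma gprof_of_mem {m : ℝ} (hm : m ∈ Set.Ioo (0:ℝ) 1) : gprof m = gpdf (gquant m) := by
  simp only [gprof, if_pos hm]

lemma gprof_of_not_mem {m : ℝ} (hm : m ∉ Set.Ioo (0:ℝ) 1) : gprof m = 0 := by
  simp only [gprof, if_neg hm]

lemma gprof_zero : gprof 0 = 0 := gprof_of_not_mem (by simp)
lemma gprof_one : gprof 1 = 0 := gprof_of_not_mem (by simp)

lemma gprof_nonneg (m : ℝ) : 0 ≤ gprof m := by
  by_cases h : m ∈ Set.Ioo (0:ℝ) 1
  · rw [gprof_of_mem h]; exact (gpdf_pos _).le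
  · rw [gprof_of_not_mem h]

lemma gprof_le_one (m : ℝ) : gprof m ≤ 1 := by
  by_cases h : m ∈ Set.Ioo (0:ℝ) 1
  · rw [gprof_of_mem h]
    refine (gpdf_le_of_abs_le (x := 0) (by simp)).trans ?_
    unfold gpdf
    simp only [ne_eq, OfNat.ofNat_ne_zero, not_false_eq_true, zero_pow, neg_zero, zero_div,
      Real.exp_zero, mul_one]
    apply inv_le_one_of_one_le₀
    rw [Real.one_le_sqrt]
    linarith [Real.pi_gt_three]
  · rw [gprof_of_not_mem h]; norm_num

lemma gprof_one_sub (m : ℝ) : gprof (1 - m) = gprof m := by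
  by_cases h : m ∈ Set.Ioo (0:ℝ) 1
  · have h' : 1 - m ∈ Set.Ioo (0:ℝ) 1 := ⟨by linarith [h.2], by linarith [h.1]⟩
    rw [gprof_of_mem h, gprof_of_mem h', gquant_one_sub h, gpdf_neg]
  · have h' : 1 - m ∉ Set.Ioo (0:ℝ) 1 := fun h' => h ⟨by linarith [h'.2], by linarith [h'.1]⟩
    rw [gprof_of_not_mem h, gprof_of_not_mem h']

lemma gprof_hasDerivAt {m : ℝ} (hm : m ∈ Set.Ioo (0:ℝ) 1) :
    HasDerivAt gprof (-gquant m) m := by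
  have h1 := (gpdf_hasDerivAt (gquant m)).comp m (gquant_hasDerivAt hm)
  have h2 : -gquant m * gpdf (gquant m) * (gpdf (gquant m))⁻¹ = -gquant m := by
    have := (gpdf_pos (gquant m)).ne'
    field_simp
  rw [h2] at h1
  refine h1.congr_of_eventuallyEq ?_
  filter_upwards [Ioo_mem_nhds hm.1 hm.2] with y hy using gprof_of_mem hy

lemma gpdf_tendsto_atBot : Filter.Tendsto gpdf Filter.atBot (nhds 0) := by
  unfold gpdf
  rw [show (0:ℝ) = (√(2 * Real.pi))⁻¹ * 0 by simp]
  refine Filter.Tendsto.const_mul _ (Real.tendsto_exp_atBot.comp ?_)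
  have : Filter.Tendsto (fun x : ℝ => x ^ 2) Filter.atBot Filter.atTop :=
    ((Filter.tendsto_pow_atTop two_ne_zero).comp Filter.tendsto_neg_atBot_atTop).congr
      fun x => by simp
  have h2 := (this.atTop_div_const (show (0:ℝ) < 2 by norm_num))
  refine (Filter.tendsto_neg_atTop_atBot.comp h2).congr fun x => ?_
  simp; ring

lemma gprof_continuousAt_zero : ContinuousAt gprof 0 := by
  rw [Metric.continuousAt_iff]
  intro ε hε
  obtain ⟨x, hx⟩ := Filter.eventually_atBot.1
    (gpdf_tendsto_atBot.eventually_lt_const hε)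
  refine ⟨gcdf x, gcdf_pos x, fun {m} hm => ?_⟩
  rw [gprof_zero, Real.dist_eq, sub_zero, abs_of_nonneg (gprof_nonneg m)]
  rw [Real.dist_eq, sub_zero] at hm
  by_cases h : m ∈ Set.Ioo (0:ℝ) 1
  · rw [gprof_of_mem h]
    apply hx
    rw [abs_of_pos h.1] at hm
    exact ((gquant_lt_iff h).2 hm).le
  · rw [gprof_of_not_mem h]; exact hε

lemma gprof_continuous : Continuous gprof := by
  rw [continuous_iff_continuousAt]
  intro m
  rcases lt_trichotomy m 0 with h | h | h
  · refine (continuousAt_const (y := (0:ℝ))).congr ?_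
    filter_upwards [Iio_mem_nhds h] with y hy
    exact (gprof_of_not_mem fun h' => absurd h'.1 (not_lt.2 (le_of_lt hy))).symm
  · rw [h]; exact gprof_continuousAt_zero
  · rcases lt_trichotomy m 1 with h' | h' | h'
    · exact (gprof_hasDerivAt ⟨h, h'⟩).continuousAt
    · have : gprof = fun m => gprof (1 - m) := by funext m; rw [gprof_one_sub]
      rw [this, h']
      have h0 : ContinuousAt gprof (1 - 1) := by simpa using gprof_continuousAt_zero
      exact ContinuousAt.comp (f := fun m : ℝ => 1 - m) (g := gprof) h0 (by fun_prop)
    · refine (continuousAt_const (y := (0:ℝ))).congr ?_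
      filter_upwards [Ioi_mem_nhds h'] with y hy
      exact (gprof_of_not_mem fun h' => absurd h'.2 (not_lt.2 (le_of_lt hy))).symm

lemma le_of_hasDerivAt_nonneg {f f' : ℝ → ℝ} {a x : ℝ} (hax : a ≤ x)
    (hf : ∀ y ∈ Set.Icc a x, HasDerivAt f (f' y) y) (hf' : ∀ y ∈ Set.Icc a x, 0 ≤ f' y) :
    f a ≤ f x := by
  have hm : MonotoneOn f (Set.Icc a x) := by
    apply monotoneOn_of_deriv_nonneg (convex_Icc a x)
    · exact fun y hy => (hf y hy).continuousAt.continuousWithinAt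
    · intro y hy
      rw [interior_Icc] at hy
      exact (hf y (Set.Ioo_subset_Icc_self hy)).differentiableAt.differentiableWithinAt
    · intro y hy
      rw [interior_Icc] at hy
      rw [(hf y (Set.Ioo_subset_Icc_self hy)).deriv]
      exact hf' y (Set.Ioo_subset_Icc_self hy)
  exact hm (Set.left_mem_Icc.2 hax) (Set.right_mem_Icc.2 hax) hax

lemma gquant_mono {a b : ℝ} (ha : a ∈ Set.Ioo (0:ℝ) 1) (hb : b ∈ Set.Ioo (0:ℝ) 1) (hab : a ≤ b) :
    gquant a ≤ gquant b := by
  rw [← gcdf_strictMono.le_iff_le, gcdf_gquant ha, gcdf_gquant hb]; exact hab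

lemma gprof_mul_gquant_hasDerivAt {m : ℝ} (hm : m ∈ Set.Ioo (0:ℝ) 1) :
    HasDerivAt (fun m => gprof m * -gquant m) (gquant m ^ 2 - 1) m := by
  have h := (gprof_hasDerivAt hm).mul (gquant_hasDerivAt hm).neg
  refine h.congr_deriv ?_
  rw [gprof_of_mem hm]
  have := (gpdf_pos (gquant m)).ne'
  field_simp
  simp
  ring

lemma gprof_sq_hasDerivAt {m : ℝ} (hm : m ∈ Set.Ioo (0:ℝ) 1) :
    HasDerivAt (fun m => gprof m ^ 2) (2 * (gprof m * -gquant m)) m := by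
  have h := (gprof_hasDerivAt hm).pow 2
  refine h.congr_deriv ?_
  norm_num
  ring

lemma gquant_sq_hasDerivAt {m : ℝ} (hm : m ∈ Set.Ioo (0:ℝ) 1) :
    HasDerivAt (fun m => gquant m ^ 2) (2 * (gquant m * (gpdf (gquant m))⁻¹)) m := by
  have h := (gquant_hasDerivAt hm).pow 2
  refine h.congr_deriv ?_
  norm_num
  ring

lemma mul_inv_gpdf_mono : Monotone fun x : ℝ => x * (gpdf x)⁻¹ := by
  apply monotone_of_deriv_nonneg
  · intro x
    exact (differentiableAt_id.mul ((gpdf_hasDerivAt x).differentiableAt.inv (gpdf_pos x).ne'))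
  · intro x
    have h := (hasDerivAt_id x).mul ((gpdf_hasDerivAt x).inv (gpdf_pos x).ne')
    have h' : HasDerivAt (fun x : ℝ => x * (gpdf x)⁻¹) _ x := h
    rw [h'.deriv]
    have := gpdf_pos x
    have : 1 * (gpdf x)⁻¹ + id x * (-(-x * gpdf x) / gpdf x ^ 2) =
      (gpdf x)⁻¹ * (1 + x ^ 2) := by
      simp only [id]
      field_simp
    simp only [Pi.inv_apply]
    rw [this]
    positivity

lemma hasDerivAt_comp_add {f : ℝ → ℝ} {f' c y : ℝ} (h : HasDerivAt f f' (c + y)) :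
    HasDerivAt (fun y => f (c + y)) f' y := by
  simpa using h.comp_const_add c y

lemma hasDerivAt_comp_sub {f : ℝ → ℝ} {f' c y : ℝ} (h : HasDerivAt f f' (c - y)) :
    HasDerivAt (fun y => f (c - y)) (-f') y := by
  simpa using h.comp_const_sub c y

lemma gquant_sq_convex {c x : ℝ} (hx : 0 ≤ x) (h1 : 0 < c - x) (h2 : c + x < 1) :
    2 * gquant c ^ 2 ≤ gquant (c + x) ^ 2 + gquant (c - x) ^ 2 := by
  have hp : ∀ y ∈ Set.Icc 0 x, c + y ∈ Set.Ioo (0:ℝ) 1 := fun y hy =>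
    ⟨by linarith [hy.1, hy.2], by linarith [hy.1, hy.2]⟩
  have hm : ∀ y ∈ Set.Icc 0 x, c - y ∈ Set.Ioo (0:ℝ) 1 := fun y hy =>
    ⟨by linarith [hy.1, hy.2], by linarith [hy.1, hy.2]⟩
  have := le_of_hasDerivAt_nonneg hx
    (fun y hy => (hasDerivAt_comp_add (gquant_sq_hasDerivAt (hp y hy))).add
      (hasDerivAt_comp_sub (gquant_sq_hasDerivAt (hm y hy)))) (by
      intro y hy
      have := mul_inv_gpdf_mono (gquant_mono (hm y hy) (hp y hy) (by linarith [hy.1]))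
      simp only at this
      linarith)
  simp only [Pi.add_apply, add_zero, sub_zero] at this
  linarith

lemma gprof_second_difference {c x : ℝ} (hx : 0 ≤ x) (h1 : 0 < c - x) (h2 : c + x < 1) :
    2 * x ^ 2 * gquant c ^ 2 ≤
      gprof (c + x) ^ 2 + gprof (c - x) ^ 2 - 2 * gprof c ^ 2 + 2 * x ^ 2 := by
  have hp : ∀ y ∈ Set.Icc 0 x, c + y ∈ Set.Ioo (0:ℝ) 1 := fun y hy =>
    ⟨by linarith [hy.1, hy.2], by linarith [hy.1, hy.2]⟩
  have hm : ∀ y ∈ Set.Icc 0 x, c - y ∈ Set.Ioo (0:ℝ) 1 := fun y hy =>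
    ⟨by linarith [hy.1, hy.2], by linarith [hy.1, hy.2]⟩
  set A := gquant c ^ 2 with hA
  have key : ∀ y ∈ Set.Icc 0 x, 0 ≤ (gprof (c + y) * -gquant (c + y)) -
      (gprof (c - y) * -gquant (c - y)) + (2 - 2 * A) * y := by
    intro y hy
    have := le_of_hasDerivAt_nonneg hy.1
      (fun z hz => ((hasDerivAt_comp_add (gprof_mul_gquant_hasDerivAt
        (hp z ⟨hz.1, hz.2.trans hy.2⟩))).sub
        (hasDerivAt_comp_sub (gprof_mul_gquant_hasDerivAt
        (hm z ⟨hz.1, hz.2.trans hy.2⟩)))).add ((hasDerivAt_id z).const_mul (2 - 2 * A))) (by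
        intro z hz
        have := gquant_sq_convex hz.1 (hm z ⟨hz.1, hz.2.trans hy.2⟩).1
          (hp z ⟨hz.1, hz.2.trans hy.2⟩).2
        linarith)
    simp at this
    linarith
  have := le_of_hasDerivAt_nonneg hx
    (fun y hy => ((hasDerivAt_comp_add (gprof_sq_hasDerivAt (hp y hy))).add
      (hasDerivAt_comp_sub (gprof_sq_hasDerivAt (hm y hy)))).add
      (((hasDerivAt_pow 2 y)).const_mul (2 - 2 * A))) (by
      intro y hy
      have := key y hy
      norm_num
      linarith)
  simp at this
  linarith

lemma gprof_mono_left {c x : ℝ} (hc : c ≤ 1 / 2) (hx : 0 ≤ x) (h1 : 0 < c - x) (h2 : c + x < 1) :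
    |gquant (c + x)| ≤ |gquant (c - x)| := by
  have hp : c + x ∈ Set.Ioo (0:ℝ) 1 := ⟨by linarith, h2⟩
  have hm : c - x ∈ Set.Ioo (0:ℝ) 1 := ⟨h1, by linarith⟩
  have h0 : gquant (c - x) ≤ 0 := by
    rw [← gcdf_strictMono.le_iff_le, gcdf_gquant hm, gcdf_zero]; linarith
  rw [abs_of_nonpos h0, abs_le]
  refine ⟨by simpa using gquant_mono hm hp (by linarith), ?_⟩
  rw [← gquant_one_sub hm]
  exact gquant_mono hp ⟨by linarith [hm.2], by linarith [hm.1]⟩ (by linarith)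

lemma gprof_first_difference {c x : ℝ} (hc : c ≤ 1 / 2) (hx : 0 ≤ x) (h1 : 0 < c - x)
    (h2 : c + x < 1) :
    0 ≤ gprof (c + x) ^ 2 - gprof (c - x) ^ 2 ∧
      gprof (c + x) ^ 2 - gprof (c - x) ^ 2 ≤ 4 * x * (gprof c * -gquant c) := by
  have hp : ∀ y ∈ Set.Icc 0 x, c + y ∈ Set.Ioo (0:ℝ) 1 := fun y hy =>
    ⟨by linarith [hy.1, hy.2], by linarith [hy.1, hy.2]⟩
  have hm : ∀ y ∈ Set.Icc 0 x, c - y ∈ Set.Ioo (0:ℝ) 1 := fun y hy =>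
    ⟨by linarith [hy.1, hy.2], by linarith [hy.1, hy.2]⟩
  have hxx : x ∈ Set.Icc 0 x := ⟨hx, le_rfl⟩
  constructor
  · rw [gprof_of_mem (hp x hxx), gprof_of_mem (hm x hxx)]
    have := gpdf_le_of_abs_le (gprof_mono_left hc hx h1 h2)
    have h3 := gpdf_pos (gquant (c - x))
    nlinarith
  have key : ∀ y ∈ Set.Icc 0 x, (gprof (c + y) * -gquant (c + y)) +
      (gprof (c - y) * -gquant (c - y)) ≤ 2 * (gprof c * -gquant c) := by
    intro y hy
    have := le_of_hasDerivAt_nonneg hy.1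
      (fun z hz => ((hasDerivAt_comp_add (gprof_mul_gquant_hasDerivAt
        (hp z ⟨hz.1, hz.2.trans hy.2⟩))).add
        (hasDerivAt_comp_sub (gprof_mul_gquant_hasDerivAt
        (hm z ⟨hz.1, hz.2.trans hy.2⟩)))).neg) (by
        intro z hz
        have := gprof_mono_left hc hz.1 (hm z ⟨hz.1, hz.2.trans hy.2⟩).1
          (hp z ⟨hz.1, hz.2.trans hy.2⟩).2
        have := sq_le_sq.mpr this
        linarith)
    simp at this
    linarith
  have := le_of_hasDerivAt_nonneg hx
    (fun y hy => ((((hasDerivAt_id y).const_mul (4 * (gprof c * -gquant c))).sub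
      (hasDerivAt_comp_add (gprof_sq_hasDerivAt (hp y hy))))).add
      (hasDerivAt_comp_sub (gprof_sq_hasDerivAt (hm y hy)))) (by
      intro y hy
      have := key y hy
      linarith)
  simp at this
  linarith

lemma two_mul_le_sqrt_add_sqrt {p A B : ℝ} (hA : 0 ≤ A) (hB : 0 ≤ B)
    (h : (A - B) ^ 2 ≤ 8 * p ^ 2 * (A + B - 2 * p ^ 2)) : 2 * p ≤ √A + √B := by
  set a := √A with ha
  set b := √B with hb
  have hA' : A = a ^ 2 := (Real.sq_sqrt hA).symm
  have hB' : B = b ^ 2 := (Real.sq_sqrt hB).symm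
  have ha0 : 0 ≤ a := Real.sqrt_nonneg _
  have hb0 : 0 ≤ b := Real.sqrt_nonneg _
  rw [hA', hB'] at h
  by_contra hcon
  push Not at hcon
  have h1 : 0 ≤ (a - b) ^ 2 := sq_nonneg _
  have h2 : 0 < 4 * p ^ 2 - (a + b) ^ 2 := by nlinarith
  have h3 : 0 ≤ ((4 * p ^ 2 - (a + b) ^ 2) * (4 * p ^ 2 - (a - b) ^ 2)) := by
    apply mul_nonneg h2.le
    nlinarith [mul_nonneg ha0 hb0]
  have h4 : 0 < 4 * p ^ 2 - (a - b) ^ 2 := by nlinarith [mul_nonneg ha0 hb0]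
  nlinarith [mul_pos h2 h4]

lemma gprof_two_point_aux {c x : ℝ} (hc : c ≤ 1 / 2) (hx : 0 ≤ x) (h1 : 0 < c - x)
    (h2 : c + x < 1) :
    2 * gprof c ≤ √(gprof (c + x) ^ 2 + x ^ 2) + √(gprof (c - x) ^ 2 + x ^ 2) := by
  apply two_mul_le_sqrt_add_sqrt (by positivity) (by positivity)
  have hS := gprof_second_difference hx h1 h2
  obtain ⟨hD0, hD⟩ := gprof_first_difference hc hx h1 h2
  have hsq := pow_le_pow_left₀ hD0 hD 2
  have : 8 * gprof c ^ 2 * (2 * x ^ 2 * gquant c ^ 2) ≤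
    8 * gprof c ^ 2 * (gprof (c + x) ^ 2 + gprof (c - x) ^ 2 - 2 * gprof c ^ 2 + 2 * x ^ 2) :=
    mul_le_mul_of_nonneg_left hS (by positivity)
  nlinarith

/-- Bobkov's two-point inequality. -/
lemma gprof_two_point {a b : ℝ} (ha : a ∈ Set.Icc (0:ℝ) 1) (hb : b ∈ Set.Icc (0:ℝ) 1) :
    gprof ((a + b) / 2) ≤ (√(gprof a ^ 2 + ((a - b) / 2) ^ 2) +
      √(gprof b ^ 2 + ((b - a) / 2) ^ 2)) / 2 := by
  have main : ∀ c x : ℝ, 0 ≤ x → 0 < c - x → c + x < 1 →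
      2 * gprof c ≤ √(gprof (c + x) ^ 2 + x ^ 2) + √(gprof (c - x) ^ 2 + x ^ 2) := by
    intro c x hx h1 h2
    rcases le_total c (1/2) with hc | hc
    · exact gprof_two_point_aux hc hx h1 h2
    · have := gprof_two_point_aux (c := 1 - c) (by linarith) hx (by linarith) (by linarith)
      rw [gprof_one_sub, show 1 - c + x = 1 - (c - x) by ring,
        show 1 - c - x = 1 - (c + x) by ring, gprof_one_sub, gprof_one_sub] at this
      linarith
  have main2 : ∀ a ∈ Set.Ioo (0:ℝ) 1, ∀ b ∈ Set.Ioo (0:ℝ) 1,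
      gprof ((a + b) / 2) ≤ (√(gprof a ^ 2 + ((a - b) / 2) ^ 2) +
      √(gprof b ^ 2 + ((b - a) / 2) ^ 2)) / 2 := by
    intro a ha b hb
    rcases le_total b a with hab | hab
    · have := main ((a + b) / 2) ((a - b) / 2) (by linarith) (by linarith [hb.1]) (by linarith [ha.2])
      rw [show (a + b) / 2 + (a - b) / 2 = a by ring, show (a + b) / 2 - (a - b) / 2 = b by ring]
        at this
      rw [show ((b - a) / 2) ^ 2 = ((a - b) / 2) ^ 2 by ring]
      linarith
    · have := main ((a + b) / 2) ((b - a) / 2) (by linarith) (by linarith [ha.1]) (by linarith [hb.2])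
      rw [show (a + b) / 2 + (b - a) / 2 = b by ring, show (a + b) / 2 - (b - a) / 2 = a by ring]
        at this
      rw [show ((a - b) / 2) ^ 2 = ((b - a) / 2) ^ 2 by ring]
      linarith
  have hcl : (a, b) ∈ closure (Set.Ioo (0:ℝ) 1 ×ˢ Set.Ioo (0:ℝ) 1) := by
    rw [closure_prod_eq, closure_Ioo (by norm_num)]
    exact ⟨ha, hb⟩
  have hclosed : IsClosed {p : ℝ × ℝ | gprof ((p.1 + p.2) / 2) ≤
      (√(gprof p.1 ^ 2 + ((p.1 - p.2) / 2) ^ 2) +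
      √(gprof p.2 ^ 2 + ((p.2 - p.1) / 2) ^ 2)) / 2} := by
    have := gprof_continuous
    apply isClosed_le <;> fun_prop
  exact closure_minimal (s := Set.Ioo (0:ℝ) 1 ×ˢ Set.Ioo (0:ℝ) 1)
    (fun p hp => main2 p.1 hp.1 p.2 hp.2) hclosed hcl

/-- The average of a function over the discrete cube. -/
def cubeAvg (N : ℕ) (f : (Fin N → Bool) → ℝ) : ℝ := (2 ^ N)⁻¹ * ∑ s, f s

lemma cubeAvg_succ (N : ℕ) (f : (Fin (N + 1) → Bool) → ℝ) :
    cubeAvg (N + 1) f = (cubeAvg N (fun s => f (Fin.cons true s)) +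
      cubeAvg N (fun s => f (Fin.cons false s))) / 2 := by
  unfold cubeAvg
  have : ∑ s, f s = ∑ s, f (Fin.cons true s) + ∑ s, f (Fin.cons false s) := by
    rw [← (Fin.consEquiv (fun _ => Bool)).sum_comp f, Fintype.sum_prod_type]
    simp [Fin.consEquiv]
  rw [this]
  have : (2:ℝ) ^ N ≠ 0 := by positivity
  field_simp
  ring

lemma cubeAvg_mono {N : ℕ} {f g : (Fin N → Bool) → ℝ} (h : ∀ s, f s ≤ g s) :
    cubeAvg N f ≤ cubeAvg N g := by
  unfold cubeAvg
  gcongr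
  exact h _

lemma cubeAvg_const (N : ℕ) (c : ℝ) : cubeAvg N (fun _ => c) = c := by
  simp [cubeAvg]

lemma cubeAvg_sub {N : ℕ} (f g : (Fin N → Bool) → ℝ) :
    cubeAvg N (fun s => f s - g s) = cubeAvg N f - cubeAvg N g := by
  simp [cubeAvg, mul_sub]

lemma cubeAvg_div {N : ℕ} (f : (Fin N → Bool) → ℝ) (c : ℝ) :
    cubeAvg N (fun s => f s / c) = cubeAvg N f / c := by
  simp [cubeAvg, ← Finset.sum_div, mul_div_assoc]

lemma cubeAvg_minkowski {N : ℕ} (X Y : (Fin N → Bool) → ℝ) :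
    √(cubeAvg N X ^ 2 + cubeAvg N Y ^ 2) ≤ cubeAvg N (fun s => √(X s ^ 2 + Y s ^ 2)) := by
  simp_rw [← Complex.norm_add_mul_I]
  unfold cubeAvg
  have h := norm_sum_le Finset.univ (fun s => ((X s : ℂ) + Y s * Complex.I))
  have h2 : (((2 ^ N)⁻¹ * ∑ s, X s : ℝ) : ℂ) + (((2 ^ N)⁻¹ * ∑ s, Y s : ℝ) : ℂ) * Complex.I =
      (((2:ℝ) ^ N)⁻¹ : ℝ) * ∑ s, ((X s : ℂ) + Y s * Complex.I) := by
    rw [Finset.sum_add_distrib, ← Finset.sum_mul]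
    push_cast
    ring
  rw [h2, norm_mul, Complex.norm_real, Real.norm_of_nonneg (by positivity)]
  gcongr

/-- Bobkov's inequality on the discrete cube. -/
lemma cube_bobkov (N : ℕ) (f : (Fin N → Bool) → ℝ) (hf : ∀ s, f s ∈ Set.Icc (0:ℝ) 1) :
    gprof (cubeAvg N f) ≤ cubeAvg N (fun s => √(gprof (f s) ^ 2 +
      ∑ i, ((f s - f (Function.update s i (!s i))) / 2) ^ 2)) := by
  induction N with
  | zero => simp [cubeAvg, Real.sqrt_sq (gprof_nonneg _)]
  | succ N ih =>
    have havg : ∀ g : (Fin N → Bool) → ℝ, (∀ s, g s ∈ Set.Icc (0:ℝ) 1) →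
        cubeAvg N g ∈ Set.Icc (0:ℝ) 1 := by
      intro g hg
      constructor
      · rw [← cubeAvg_const N 0]; exact cubeAvg_mono fun s => (hg s).1
      · rw [← cubeAvg_const N 1]; exact cubeAvg_mono fun s => (hg s).2
    have key : ∀ b : Bool, √(gprof (cubeAvg N (fun s => f (Fin.cons b s))) ^ 2 +
        ((cubeAvg N (fun s => f (Fin.cons b s)) - cubeAvg N (fun s => f (Fin.cons (!b) s))) / 2) ^ 2)
        ≤ cubeAvg N (fun s => √(gprof (f (Fin.cons b s)) ^ 2 +
      ∑ i, ((f (Fin.cons b s) - f (Function.update (Fin.cons b s : Fin (N + 1) → Bool) i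
        (!(Fin.cons b s : Fin (N + 1) → Bool) i))) / 2) ^ 2)) := by
      intro b
      have h1 := ih (fun s => f (Fin.cons b s)) (fun s => hf _)
      rw [← cubeAvg_sub, ← cubeAvg_div]
      refine le_trans (Real.sqrt_le_sqrt (add_le_add_left
        (pow_le_pow_left₀ (gprof_nonneg _) h1 2) _)) ?_
      refine (cubeAvg_minkowski _ _).trans (cubeAvg_mono fun s => ?_)
      apply Real.sqrt_le_sqrt
      rw [Real.sq_sqrt (by positivity), Fin.sum_univ_succ]
      simp only [Fin.cons_zero, Fin.update_cons_zero, Fin.cons_succ, ← Fin.cons_update]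
      linarith
    rw [cubeAvg_succ, cubeAvg_succ]
    refine (gprof_two_point (havg _ fun s => hf _) (havg _ fun s => hf _)).trans ?_
    have h1 := key true
    have h2 := key false
    simp only [Bool.not_true, Bool.not_false] at h1 h2
    linarith

/-- The sign of a boolean. -/
def bsgn (b : Bool) : ℝ := if b then 1 else -1

lemma bsgn_sq (b : Bool) : bsgn b ^ 2 = 1 := by cases b <;> simp [bsgn]
lemma bsgn_not (b : Bool) : bsgn (!b) = -bsgn b := by cases b <;> simp [bsgn]

/-- The Rademacher sum with coefficient vectors `w`. -/
def radSum {E : Type*} [NormedAddCommGroup E] [NormedSpace ℝ E] {M : ℕ} (w : Fin M → E)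
    (s : Fin M → Bool) : E := ∑ k, bsgn (s k) • w k

lemma radSum_update {E : Type*} [NormedAddCommGroup E] [NormedSpace ℝ E] {M : ℕ} (w : Fin M → E)
    (s : Fin M → Bool) (k : Fin M) :
    radSum w (Function.update s k (!s k)) = radSum w s - (2 * bsgn (s k)) • w k := by
  unfold radSum
  rw [← Finset.add_sum_erase _ _ (Finset.mem_univ k), ← Finset.add_sum_erase _ (fun j => bsgn (s j) • w j) (Finset.mem_univ k)]
  have : ∑ x ∈ Finset.univ.erase k, bsgn (Function.update s k (!s k) x) • w x =
      ∑ x ∈ Finset.univ.erase k, bsgn (s x) • w x := by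
    refine Finset.sum_congr rfl fun j hj => ?_
    rw [Function.update_of_ne (Finset.ne_of_mem_erase hj)]
  rw [this]
  simp only [Function.update_self, bsgn_not]
  module

lemma sqrt_add_sum_le {ι : Type*} [Fintype ι] (g : ℝ) (a b : ι → ℝ) :
    √(g ^ 2 + ∑ i, (a i) ^ 2) ≤ √(g ^ 2 + ∑ i, (b i) ^ 2) + √(∑ i, (a i - b i) ^ 2) := by
  let x : EuclideanSpace ℝ (Option ι) := WithLp.toLp 2 (fun o => o.elim g a)
  let y : EuclideanSpace ℝ (Option ι) := WithLp.toLp 2 (fun o => o.elim g b)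
  have h := norm_add_le y (x - y)
  rw [add_sub_cancel] at h
  simpa [EuclideanSpace.norm_eq, x, y] using h

lemma radSum_bobkov {E : Type*} [NormedAddCommGroup E] [InnerProductSpace ℝ E] [CompleteSpace E]
    {M : ℕ} (w : Fin M → E) {f : E → ℝ} (hf : ∀ x, f x ∈ Set.Icc (0:ℝ) 1) {δ η : ℝ}
    (hη : ∀ x y, ‖y‖ ≤ δ → |f x - f (x - y) - ⟪gradient f x, y⟫| ≤ η * ‖y‖)
    (hw : ∀ k, 2 * ‖w k‖ ≤ δ) :
    gprof (cubeAvg M (fun s => f (radSum w s))) ≤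
      cubeAvg M (fun s => √(gprof (f (radSum w s)) ^ 2 +
        ∑ k, ⟪gradient f (radSum w s), w k⟫ ^ 2) + √(∑ k, (η * ‖w k‖) ^ 2)) := by
  refine (cube_bobkov M _ (fun s => hf _)).trans (cubeAvg_mono fun s => ?_)
  set x := radSum w s
  simp_rw [radSum_update]
  refine (sqrt_add_sum_le _ _ (fun k => bsgn (s k) * ⟪gradient f x, w k⟫)).trans ?_
  simp_rw [mul_pow, bsgn_sq, one_mul]
  gcongr with k
  rw [← mul_pow, ← sq_abs]
  gcongr
  have hn : ‖(2 * bsgn (s k)) • w k‖ = 2 * ‖w k‖ := by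
    rw [norm_smul]; cases s k <;> simp [bsgn]
  have := hη x ((2 * bsgn (s k)) • w k) (by rw [hn]; exact hw k)
  rw [hn, real_inner_smul_right] at this
  rw [abs_le] at this ⊢
  constructor <;> linarith [this.1, this.2]

/-- The law of a Rademacher sum. -/
def radLaw {n M : ℕ} (w : Fin M → EuclideanSpace ℝ (Fin n)) :
    ProbabilityMeasure (EuclideanSpace ℝ (Fin n)) :=
  ⟨(PMF.uniformOfFintype (Fin M → Bool)).toMeasure.map (radSum w),
    Measure.isProbabilityMeasure_map (measurable_of_finite _).aemeasurable⟩

lemma integral_radLaw {n M : ℕ} (w : Fin M → EuclideanSpace ℝ (Fin n)) {F : Type*}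
    [NormedAddCommGroup F] [NormedSpace ℝ F] [CompleteSpace F]
    {g : EuclideanSpace ℝ (Fin n) → F} (hg : Continuous g) :
    ∫ x, g x ∂(radLaw w : Measure (EuclideanSpace ℝ (Fin n))) =
      ((2:ℝ) ^ M)⁻¹ • ∑ s, g (radSum w s) := by
  unfold radLaw
  simp only [ProbabilityMeasure.coe_mk]
  rw [integral_map (measurable_of_finite _).aemeasurable hg.aestronglyMeasurable,
    PMF.integral_eq_sum, Finset.smul_sum]
  simp

lemma charFun_radLaw {n M : ℕ} (w : Fin M → EuclideanSpace ℝ (Fin n))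
    (ξ : EuclideanSpace ℝ (Fin n)) :
    charFun (radLaw w : Measure (EuclideanSpace ℝ (Fin n))) ξ =
      ((∏ k, Real.cos ⟪w k, ξ⟫ : ℝ) : ℂ) := by
  rw [charFun_apply, integral_radLaw w (by fun_prop)]
  have h1 : ∀ s : Fin M → Bool, Complex.exp (⟪radSum w s, ξ⟫ * Complex.I) =
      ∏ k, Complex.exp ((bsgn (s k) * ⟪w k, ξ⟫ : ℝ) * Complex.I) := by
    intro s
    rw [← Complex.exp_sum, radSum, sum_inner, ← Finset.sum_mul]
    congr 2
    push_cast
    refine Finset.sum_congr rfl fun k _ => ?_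
    rw [real_inner_smul_left]; push_cast; rfl
  simp_rw [h1]
  rw [← Fintype.piFinset_univ, ← Finset.prod_univ_sum (fun _ => (Finset.univ : Finset Bool))
    (fun k b => Complex.exp ((bsgn b * ⟪w k, ξ⟫ : ℝ) * Complex.I))]
  have h2 : ∀ k : Fin M, ∑ b : Bool, Complex.exp ((bsgn b * ⟪w k, ξ⟫ : ℝ) * Complex.I) =
      2 * (Real.cos ⟪w k, ξ⟫ : ℂ) := by
    intro k
    simp [bsgn, Complex.cos]
    ring
  simp_rw [h2]
  rw [Finset.prod_mul_distrib]
  simp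

/-- The standard Gaussian measure on Euclidean space. -/
def gmeas (n : ℕ) : Measure (EuclideanSpace ℝ (Fin n)) :=
  volume.withDensity fun x =>
    ENNReal.ofReal ((2 * Real.pi) ^ (-(n:ℝ) / 2) * Real.exp (-(1 / 2) * ‖x‖ ^ 2))

lemma integral_gmeas {n : ℕ} {F : Type*} [NormedAddCommGroup F] [NormedSpace ℝ F]
    (g : EuclideanSpace ℝ (Fin n) → F) :
    ∫ x, g x ∂(gmeas n) = (2 * Real.pi) ^ (-(n:ℝ) / 2) •
      ∫ x, Real.exp (-(1 / 2) * ‖x‖ ^ 2) • g x := by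
  unfold gmeas
  rw [integral_withDensity_eq_integral_toReal_smul (by fun_prop) (by simp), ← integral_smul]
  refine integral_congr_ae (ae_of_all _ fun x => ?_)
  simp only
  rw [ENNReal.toReal_ofReal (by positivity), mul_smul]

lemma charFun_gmeas {n : ℕ} (ξ : EuclideanSpace ℝ (Fin n)) :
    charFun (gmeas n) ξ = (Real.exp (-(1/2) * ‖ξ‖ ^ 2) : ℂ) := by
  rw [charFun_apply, integral_gmeas]
  have := GaussianFourier.integral_cexp_neg_mul_sq_norm_add (V := EuclideanSpace ℝ (Fin n))
    (b := 1 / 2) (by norm_num) Complex.I ξ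
  have h1 : ∀ x : EuclideanSpace ℝ (Fin n), Real.exp (-(1 / 2) * ‖x‖ ^ 2) •
      Complex.exp (⟪x, ξ⟫ * Complex.I) =
      Complex.exp (-(1/2) * ‖x‖ ^ 2 + Complex.I * ⟪ξ, x⟫) := by
    intro x
    rw [Complex.exp_add, Complex.real_smul, real_inner_comm, mul_comm (Complex.I)]
    push_cast
    rfl
  simp_rw [h1, this]
  have h2 : ((Real.pi : ℂ) / (1 / 2)) ^ ((Module.finrank ℝ (EuclideanSpace ℝ (Fin n)) : ℂ) / 2) =
      (((2 * Real.pi) ^ ((n:ℝ) / 2) : ℝ) : ℂ) := by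
    rw [Complex.ofReal_cpow (by positivity)]
    simp
    ring_nf
  rw [h2, Complex.real_smul, ← mul_assoc, ← Complex.ofReal_mul, ← Real.rpow_add (by positivity)]
  have : -(n:ℝ) / 2 + n / 2 = 0 := by ring
  rw [this]
  simp
  ring_nf

instance gmeas_isProb (n : ℕ) : IsProbabilityMeasure (gmeas n) := by
  have h0 : charFun (gmeas n) 0 = 1 := by rw [charFun_gmeas]; simp
  rw [charFun_zero] at h0
  have h1 : (gmeas n).real Set.univ = 1 := by exact_mod_cast h0
  refine ⟨?_⟩
  rw [Measure.real, ENNReal.toReal_eq_one_iff] at h1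
  exact h1

lemma tendsto_cos_div_sqrt_pow (x : ℝ) :
    Filter.Tendsto (fun N : ℕ => Real.cos ((√(N:ℝ))⁻¹ * x) ^ N) Filter.atTop
      (nhds (Real.exp (-(1 / 2) * x ^ 2))) := by
  have h := Real.tendsto_one_add_pow_exp_of_tendsto
    (g := fun N : ℕ => Real.cos ((√(N:ℝ))⁻¹ * x) - 1) (t := -(1 / 2) * x ^ 2) ?_
  · simpa using h
  rw [tendsto_iff_norm_sub_tendsto_zero]
  have hlim : Filter.Tendsto (fun N : ℕ => x ^ 4 * (5 / 96) * (N:ℝ)⁻¹) Filter.atTop (nhds 0) := by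
    simpa only [mul_zero] using (tendsto_inv_atTop_nhds_zero_nat (𝕜 := ℝ)).const_mul (x ^ 4 * (5 / 96))
  refine squeeze_zero' (Filter.Eventually.of_forall fun _ => norm_nonneg _) ?_ hlim
  filter_upwards [Filter.eventually_gt_atTop 0,
    tendsto_natCast_atTop_atTop.eventually_ge_atTop (x ^ 2)] with N hN hx
  have hNpos : (0:ℝ) < N := by exact_mod_cast hN
  have hs : (√(N:ℝ))⁻¹ ^ 2 = (N:ℝ)⁻¹ := by rw [inv_pow, Real.sq_sqrt hNpos.le]
  set y := (√(N:ℝ))⁻¹ * x with hy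
  have hy2 : y ^ 2 = x ^ 2 / N := by rw [hy, mul_pow, hs]; ring
  have hy1 : |y| ≤ 1 := by
    rw [← sq_le_one_iff_abs_le_one, hy2, div_le_one hNpos]; exact hx
  have hb := Real.cos_bound hy1
  have e : (N:ℝ) * (Real.cos y - 1) - -(1 / 2) * x ^ 2 = N * (Real.cos y - (1 - y ^ 2 / 2)) := by
    rw [hy2]; field_simp; ring
  rw [e, norm_mul, Real.norm_of_nonneg hNpos.le, Real.norm_eq_abs]
  calc N * |Real.cos y - (1 - y ^ 2 / 2)| ≤ N * (|y| ^ 4 * (5 / 96)) := by gcongr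
    _ = x ^ 4 * (5 / 96) * (N:ℝ)⁻¹ := by
      have : |y| ^ 4 = (y ^ 2) ^ 2 := by rw [← pow_mul]; exact (show Even 4 by decide).pow_abs y
      rw [this, hy2]; field_simp

/-- Scaled coordinate vectors, each repeated `N` times. -/
def clt_vec (n N : ℕ) (k : Fin (N * n)) : EuclideanSpace ℝ (Fin n) :=
  (√(N:ℝ))⁻¹ • EuclideanSpace.single (finProdFinEquiv.symm k).2 1

lemma norm_clt_vec (n N : ℕ) (k : Fin (N * n)) : ‖clt_vec n N k‖ = (√(N:ℝ))⁻¹ := by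
  simp [clt_vec, norm_smul]

lemma inner_clt_vec {n N : ℕ} (k : Fin (N * n)) (ξ : EuclideanSpace ℝ (Fin n)) :
    ⟪clt_vec n N k, ξ⟫ = (√(N:ℝ))⁻¹ * ξ (finProdFinEquiv.symm k).2 := by
  rw [clt_vec, real_inner_smul_left, EuclideanSpace.inner_single_left]; simp

/-- The standard Gaussian measure as a bundled probability measure. -/
def gprob (n : ℕ) : ProbabilityMeasure (EuclideanSpace ℝ (Fin n)) := ⟨gmeas n, gmeas_isProb n⟩

lemma coe_gprob (n : ℕ) : (gprob n : Measure (EuclideanSpace ℝ (Fin n))) = gmeas n := rfl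

lemma tendsto_radLaw (n : ℕ) :
    Filter.Tendsto (fun N => radLaw (clt_vec n N)) Filter.atTop
      (nhds (gprob n)) := by
  rw [ProbabilityMeasure.tendsto_iff_tendsto_charFun]
  intro ξ
  rw [coe_gprob, charFun_gmeas]
  simp_rw [charFun_radLaw, inner_clt_vec]
  refine (Complex.continuous_ofReal.tendsto _).comp ?_
  have h1 : ∀ N : ℕ, ∏ k : Fin (N * n), Real.cos ((√(N:ℝ))⁻¹ * ξ (finProdFinEquiv.symm k).2) =
      ∏ i, Real.cos ((√(N:ℝ))⁻¹ * ξ i) ^ N := by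
    intro N
    rw [finProdFinEquiv.symm.prod_comp (fun p : Fin N × Fin n => Real.cos ((√(N:ℝ))⁻¹ * ξ p.2)),
      Fintype.prod_prod_type_right]
    simp
  simp_rw [h1]
  rw [EuclideanSpace.real_norm_sq_eq, Finset.mul_sum, Real.exp_sum]
  exact tendsto_finsetProd _ fun i _ => tendsto_cos_div_sqrt_pow _

lemma continuous_gradient {E : Type*} [NormedAddCommGroup E] [InnerProductSpace ℝ E]
    [CompleteSpace E] {f : E → ℝ} (hf : ContDiff ℝ 1 f) : Continuous (gradient f) := by
  unfold gradient
  exact (LinearIsometryEquiv.continuous _).comp (hf.continuous_fderiv one_ne_zero)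

lemma norm_gradient {E : Type*} [NormedAddCommGroup E] [InnerProductSpace ℝ E]
    [CompleteSpace E] (f : E → ℝ) (x : E) : ‖gradient f x‖ = ‖fderiv ℝ f x‖ := by
  unfold gradient
  simp

lemma hasCompactSupport_gradient {E : Type*} [NormedAddCommGroup E] [InnerProductSpace ℝ E]
    [CompleteSpace E] {f : E → ℝ} (hf : HasCompactSupport f) : HasCompactSupport (gradient f) := by
  have := hf.fderiv (𝕜 := ℝ)
  unfold gradient
  exact this.comp_left (g := (InnerProductSpace.toDual ℝ E).symm) (by simp)

lemma exists_uniform_gradient {E : Type*} [NormedAddCommGroup E] [InnerProductSpace ℝ E]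
    [CompleteSpace E] {f : E → ℝ} (hf : ContDiff ℝ 1 f) (hc : HasCompactSupport f) {η : ℝ}
    (hη : 0 < η) :
    ∃ δ > 0, ∀ x y, ‖y‖ ≤ δ → |f x - f (x - y) - ⟪gradient f x, y⟫| ≤ η * ‖y‖ := by
  have huc : UniformContinuous (fderiv ℝ f) :=
    (hc.fderiv (𝕜 := ℝ)).uniformContinuous_of_continuous (hf.continuous_fderiv one_ne_zero)
  obtain ⟨δ, hδ, h⟩ := Metric.uniformContinuous_iff.1 huc η hη
  refine ⟨δ / 2, by positivity, fun x y hy => ?_⟩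
  have := (convex_closedBall x (δ / 2)).norm_image_sub_le_of_norm_fderiv_le' (f := f)
    (φ := fderiv ℝ f x) (C := η) (x := x) (y := x - y)
    (fun z _ => (hf.differentiable one_ne_zero) z)
    (fun z hz => by
      rw [← dist_eq_norm]
      exact (h (lt_of_le_of_lt hz (by linarith))).le)
    (by simp; positivity) (by simpa using hy)
  rw [inner_gradient_left, ← abs_neg, ← Real.norm_eq_abs]
  simpa [neg_sub, sub_eq_add_neg, add_comm, add_left_comm] using this

/-- The Gaussian functional isoperimetric inequality of Bobkov. -/
theorem gaussian_bobkov {n : ℕ} {f : EuclideanSpace ℝ (Fin n) → ℝ} (hf : ContDiff ℝ 1 f)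
    (hc : HasCompactSupport f) (hf01 : ∀ x, f x ∈ Set.Icc (0:ℝ) 1) :
    gprof (∫ x, f x ∂(gmeas n)) ≤
      ∫ x, √(gprof (f x) ^ 2 + ‖gradient f x‖ ^ 2) ∂(gmeas n) := by
  set g : EuclideanSpace ℝ (Fin n) → ℝ := fun x => √(gprof (f x) ^ 2 + ‖gradient f x‖ ^ 2) with hg
  have hgc : Continuous g := by
    have := continuous_gradient hf
    have := gprof_continuous.comp hf.continuous
    simp only [Function.comp_def] at this
    fun_prop
  have hgcs : HasCompactSupport g := by
    refine (hc.union (hasCompactSupport_gradient hc)).of_isClosed_subset (isClosed_tsupport _) ?_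
    refine closure_minimal (fun x hx => ?_) ((isClosed_tsupport _).union (isClosed_tsupport _))
    by_contra hcon
    simp only [Set.mem_union, not_or] at hcon
    apply hx
    simp [hg, image_eq_zero_of_notMem_tsupport hcon.1, image_eq_zero_of_notMem_tsupport hcon.2,
      gprof_zero]
  have hlim := (ProbabilityMeasure.tendsto_iff_forall_integral_tendsto.1 (tendsto_radLaw n))
  obtain ⟨Cg, hCg⟩ := hgcs.exists_bound_of_continuous hgc
  have hl1 := hlim (BoundedContinuousFunction.ofNormedAddCommGroup f hf.continuous 1
    (fun x => by rw [Real.norm_of_nonneg (hf01 x).1]; exact (hf01 x).2))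
  have hl2 := hlim (BoundedContinuousFunction.ofNormedAddCommGroup g hgc Cg hCg)
  simp only [BoundedContinuousFunction.coe_ofNormedAddCommGroup, coe_gprob] at hl1 hl2
  refine le_of_forall_pos_le_add fun η' hη' => ?_
  obtain ⟨η, hη, hηn⟩ : ∃ η > 0, η * √(n:ℝ) ≤ η' := by
    refine ⟨η' / (√(n:ℝ) + 1), by positivity, ?_⟩
    rw [div_mul_eq_mul_div, div_le_iff₀ (by positivity)]
    nlinarith
  obtain ⟨δ, hδ, hfδ⟩ := exists_uniform_gradient hf hc hη
  refine le_of_tendsto_of_tendsto ((gprof_continuous.tendsto _).comp hl1)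
    (hl2.add_const η') ?_
  have hs : Filter.Tendsto (fun N : ℕ => 2 * (√(N:ℝ))⁻¹) Filter.atTop (nhds 0) := by
    simpa using (Real.tendsto_sqrt_atTop.comp
      tendsto_natCast_atTop_atTop).inv_tendsto_atTop.const_mul (2:ℝ)
  filter_upwards [hs.eventually_le_const hδ, Filter.eventually_gt_atTop 0] with N hN hN0
  have hNpos : (0:ℝ) < N := by exact_mod_cast hN0
  have h := radSum_bobkov (clt_vec n N) hf01 hfδ (fun k => by rw [norm_clt_vec]; exact hN)
  simp only [Function.comp_apply]
  rw [integral_radLaw _ hf.continuous, integral_radLaw _ hgc]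
  have hn : √(∑ k, (η * ‖clt_vec n N k‖) ^ 2) ≤ η' := by
    refine le_trans (le_of_eq ?_) hηn
    simp_rw [norm_clt_vec]
    rw [Finset.sum_const, Finset.card_univ, Fintype.card_fin, nsmul_eq_mul, mul_pow, inv_pow,
      Real.sq_sqrt hNpos.le, Nat.cast_mul]
    have : (N:ℝ) * n * (η ^ 2 * (N:ℝ)⁻¹) = η ^ 2 * n := by field_simp
    rw [this, Real.sqrt_mul (by positivity), Real.sqrt_sq hη.le]
  have hgrad : ∀ x, ∑ k, ⟪gradient f x, clt_vec n N k⟫ ^ 2 = ‖gradient f x‖ ^ 2 := by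
    intro x
    simp_rw [real_inner_comm, inner_clt_vec, mul_pow, inv_pow, Real.sq_sqrt hNpos.le]
    rw [finProdFinEquiv.symm.sum_comp (fun p : Fin N × Fin n => (N:ℝ)⁻¹ * (gradient f x) p.2 ^ 2),
      Fintype.sum_prod_type_right, EuclideanSpace.real_norm_sq_eq]
    refine Finset.sum_congr rfl fun i _ => ?_
    simp
    field_simp
  simp_rw [hgrad] at h
  refine h.trans ?_
  have h2 : cubeAvg (N * n) (fun s => √(gprof (f (radSum (clt_vec n N) s)) ^ 2 +
      ‖gradient f (radSum (clt_vec n N) s)‖ ^ 2) + √(∑ k, (η * ‖clt_vec n N k‖) ^ 2)) =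
      cubeAvg (N * n) (fun s => g (radSum (clt_vec n N) s)) + √(∑ k, (η * ‖clt_vec n N k‖) ^ 2) := by
    rw [← cubeAvg_const (N * n) (√(∑ k, (η * ‖clt_vec n N k‖) ^ 2))]
    simp [cubeAvg, Finset.sum_add_distrib, mul_add, hg]
  rw [h2]
  simp only [smul_eq_mul]
  gcongr
  rfl

lemma hasFDerivAt_gradient_comp {E : Type*} [NormedAddCommGroup E] [InnerProductSpace ℝ E]
    [CompleteSpace E] {F : E → ℝ} {h : ℝ → ℝ} {x : E} (hF : DifferentiableAt ℝ F x)
    (hh : DifferentiableAt ℝ h (F x)) :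
    gradient (fun y => h (F y)) x = deriv h (F x) • gradient F x := by
  refine HasGradientAt.gradient ?_
  rw [hasGradientAt_iff_hasFDerivAt]
  convert! hh.hasDerivAt.comp_hasFDerivAt x hF.hasFDerivAt using 1
  rw [map_smul, toDual_gradient]

/-- A smooth decreasing cutoff from `1` on `(-∞, 0]` to `0` on `[ε, ∞)`. -/
def stepDown (ε r : ℝ) : ℝ := Real.smoothTransition (1 - r / ε)

lemma stepDown_contDiff (ε : ℝ) : ContDiff ℝ 1 (stepDown ε) := by
  unfold stepDown
  exact (Real.smoothTransition.contDiff (n := 1)).comp (by fun_prop)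

lemma stepDown_mem (ε r : ℝ) : stepDown ε r ∈ Set.Icc (0:ℝ) 1 :=
  ⟨Real.smoothTransition.nonneg _, Real.smoothTransition.le_one _⟩

lemma stepDown_of_nonpos {ε r : ℝ} (hε : 0 < ε) (hr : r ≤ 0) : stepDown ε r = 1 := by
  refine Real.smoothTransition.one_of_one_le ?_
  have := div_nonpos_of_nonpos_of_nonneg hr hε.le
  linarith

lemma stepDown_of_ge {ε r : ℝ} (hε : 0 < ε) (hr : ε ≤ r) : stepDown ε r = 0 := by
  refine Real.smoothTransition.zero_of_nonpos ?_
  have := (one_le_div hε).2 hr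
  linarith

lemma stepDown_antitone {ε : ℝ} (hε : 0 < ε) : Antitone (stepDown ε) := by
  intro a b hab
  refine Real.smoothTransition.monotone ?_
  gcongr

lemma deriv_stepDown_of_not_mem {ε r : ℝ} (hε : 0 < ε) (hr : r ∉ Set.Icc 0 ε) :
    deriv (stepDown ε) r = 0 := by
  have : r < 0 ∨ ε < r := by
    by_contra! h
    exact hr h
  rcases this with h | h
  · have : stepDown ε =ᶠ[nhds r] fun _ => 1 := by
      filter_upwards [Iio_mem_nhds h] with t ht using stepDown_of_nonpos hε (le_of_lt ht)
    rw [this.deriv_eq]; simp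
  · have : stepDown ε =ᶠ[nhds r] fun _ => 0 := by
      filter_upwards [Ioi_mem_nhds h] with t ht using stepDown_of_ge hε (le_of_lt ht)
    rw [this.deriv_eq]; simp

lemma continuous_deriv_stepDown (ε : ℝ) : Continuous (deriv (stepDown ε)) :=
  (stepDown_contDiff ε).continuous_deriv le_rfl

lemma lintegral_deriv_stepDown {ε : ℝ} (hε : 0 < ε) :
    ∫⁻ r, ENNReal.ofReal (|deriv (stepDown ε) r|) = 1 := by
  have hi : Integrable (deriv (stepDown ε)) := by
    refine (continuous_deriv_stepDown ε).integrable_of_hasCompactSupport ?_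
    exact HasCompactSupport.intro (isCompact_Icc (a := 0) (b := ε))
      fun r hr => deriv_stepDown_of_not_mem hε hr
  rw [← ofReal_integral_eq_lintegral_ofReal hi.abs (ae_of_all _ fun _ => abs_nonneg _)]
  have hneg : ∀ r, |deriv (stepDown ε) r| = -deriv (stepDown ε) r := fun r =>
    abs_of_nonpos (stepDown_antitone hε).deriv_nonpos
  simp_rw [hneg]
  rw [integral_neg, integral_of_hasDerivAt_of_tendsto
    (fun x => ((stepDown_contDiff ε).differentiable one_ne_zero x).hasDerivAt) hi (m := 1) (n := 0)]
  · simp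
  · refine tendsto_const_nhds.congr' ?_
    filter_upwards [Filter.eventually_le_atBot 0] with r hr using (stepDown_of_nonpos hε hr).symm
  · refine tendsto_const_nhds.congr' ?_
    filter_upwards [Filter.eventually_ge_atTop ε] with r hr using (stepDown_of_ge hε hr).symm

lemma gradient_stepDown {n : ℕ} {F : EuclideanSpace ℝ (Fin n) → ℝ} (hF : ContDiff ℝ 1 F)
    (ε t : ℝ) (x : EuclideanSpace ℝ (Fin n)) :
    ‖gradient (fun y => stepDown ε (t - F y)) x‖ =
      |deriv (stepDown ε) (t - F x)| * ‖gradient F x‖ := by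
  have hd := (hF.differentiable one_ne_zero x)
  rw [hasFDerivAt_gradient_comp (F := fun y => t - F y) (hd.const_sub t)
    ((stepDown_contDiff ε).differentiable one_ne_zero _), norm_smul, Real.norm_eq_abs,
    norm_gradient, norm_gradient, fderiv_const_sub, norm_neg]

lemma bobkov_stepDown {n : ℕ} {F : EuclideanSpace ℝ (Fin n) → ℝ} (hF : ContDiff ℝ 1 F)
    (hc : HasCompactSupport F) {ε t : ℝ} (hε : 0 < ε) (ht : ε ≤ t) :
    ENNReal.ofReal (gprof (∫ x, stepDown ε (t - F x) ∂(gmeas n))) ≤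
      ∫⁻ x, ((Set.Icc 0 ε).indicator 1 (t - F x) +
        ENNReal.ofReal (|deriv (stepDown ε) (t - F x)|) *
          ENNReal.ofReal ‖gradient F x‖) ∂(gmeas n) := by
  set f : EuclideanSpace ℝ (Fin n) → ℝ := fun x => stepDown ε (t - F x) with hf
  have hfd : ContDiff ℝ 1 f := (stepDown_contDiff ε).comp (contDiff_const.sub hF)
  have hfc : HasCompactSupport f := by
    refine hc.comp_left (g := fun y => stepDown ε (t - y)) ?_
    simpa using stepDown_of_ge hε ht
  have hb := gaussian_bobkov hfd hfc (fun x => stepDown_mem _ _)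
  refine (ENNReal.ofReal_le_ofReal hb).trans ?_
  have hcont : Continuous fun x => √(gprof (f x) ^ 2 + ‖gradient f x‖ ^ 2) := by
    have := continuous_gradient hfd
    have := gprof_continuous.comp hfd.continuous
    simp only [Function.comp_def] at this
    fun_prop
  rw [integral_eq_lintegral_of_nonneg_ae (ae_of_all _ fun _ => Real.sqrt_nonneg _)
    hcont.aestronglyMeasurable]
  refine ENNReal.ofReal_toReal_le.trans (lintegral_mono fun x => ?_)
  have h1 : √(gprof (f x) ^ 2 + ‖gradient f x‖ ^ 2) ≤ gprof (f x) + ‖gradient f x‖ := by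
    have := gprof_nonneg (f x)
    refine Real.sqrt_le_iff.2 ⟨by positivity, ?_⟩
    nlinarith [norm_nonneg (gradient f x)]
  refine (ENNReal.ofReal_le_ofReal h1).trans ?_
  rw [ENNReal.ofReal_add (gprof_nonneg _) (norm_nonneg _), gradient_stepDown hF,
    ENNReal.ofReal_mul (abs_nonneg _)]
  refine add_le_add ?_ le_rfl
  by_cases hm : t - F x ∈ Set.Icc 0 ε
  · rw [Set.indicator_of_mem hm]
    simpa using gprof_le_one (f x)
  · have : t - F x ≤ 0 ∨ ε ≤ t - F x := by
      by_contra! h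
      exact hm ⟨h.1.le, h.2.le⟩
    rcases this with h | h
    · simp [hf, stepDown_of_nonpos hε h, gprof_one]
    · simp [hf, stepDown_of_ge hε h, gprof_zero]

/-- `L¹` form of the Gaussian isoperimetric inequality, integrated against a weight of the
level. -/
theorem gaussian_isoperimetric_levels {n : ℕ} {F : EuclideanSpace ℝ (Fin n) → ℝ}
    (hF : ContDiff ℝ 1 F) (hc : HasCompactSupport F) {S : ℝ → ENNReal}
    (hS : Measurable S) {B : ENNReal} (hB : B ≠ ⊤) (hSB : ∀ t, S t ≤ B) {t₀ : ℝ} (ht₀ : 0 < t₀)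
    (hS0 : ∀ t < t₀, S t = 0) (hSr : ∀ t, ContinuousWithinAt S (Set.Ici t) t) :
    ∫⁻ t, S t * ENNReal.ofReal (gprof ((gmeas n).real {x | t < F x})) ≤
      ∫⁻ x, S (F x) * ENNReal.ofReal ‖gradient F x‖ ∂(gmeas n) := by
  set G : EuclideanSpace ℝ (Fin n) → ENNReal := fun x => ENNReal.ofReal ‖gradient F x‖ with hG
  have hFm : Measurable F := hF.continuous.measurable
  have hGm : Measurable G := (continuous_gradient hF).norm.measurable.ennreal_ofReal
  obtain ⟨CG, hCG⟩ := (hasCompactSupport_gradient hc).exists_bound_of_continuous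
    (continuous_gradient hF)
  set Φ : ℝ → ENNReal := fun r => ∫⁻ x, S (F x + r) * G x ∂(gmeas n) with hΦ
  have hΦlim : Filter.Tendsto Φ (nhdsWithin 0 (Set.Ici 0)) (nhds (Φ 0)) := by
    refine tendsto_lintegral_filter_of_dominated_convergence (fun _ => B * ENNReal.ofReal CG)
      (Filter.Eventually.of_forall fun r => ?_) (Filter.Eventually.of_forall fun r =>
        ae_of_all _ fun x => ?_) ?_ (ae_of_all _ fun x => ?_)
    · exact (hS.comp (hFm.add_const r)).mul hGm
    · exact mul_le_mul' (hSB _) (ENNReal.ofReal_le_ofReal (hCG x))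
    · rw [lintegral_const]
      exact ENNReal.mul_ne_top (ENNReal.mul_ne_top hB (by simp)) (by simp)
    · refine ENNReal.Tendsto.mul_const ?_ (Or.inr (by simp [hG]))
      have h1 : Filter.Tendsto (fun r => F x + r) (nhdsWithin 0 (Set.Ici 0))
          (nhdsWithin (F x) (Set.Ici (F x))) := by
        refine tendsto_nhdsWithin_iff.2 ⟨?_, ?_⟩
        · have : Filter.Tendsto (fun r => F x + r) (nhds 0) (nhds (F x + 0)) := by
            exact (continuous_const.add continuous_id).tendsto 0
          rw [add_zero] at this
          exact this.mono_left nhdsWithin_le_nhds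
        · filter_upwards [self_mem_nhdsWithin] with r hr
          simpa using hr
      have := (hSr (F x)).tendsto.comp h1
      rw [add_zero]
      exact this
  have hstep : ∀ ε, 0 < ε → ε ≤ t₀ → ∫⁻ t, S t * ENNReal.ofReal
      (gprof (∫ x, stepDown ε (t - F x) ∂(gmeas n))) ≤
      B * ENNReal.ofReal ε + ⨆ r ∈ Set.Icc 0 ε, Φ r := by
    intro ε hε hεt
    set R : ℝ → ENNReal := fun r => ENNReal.ofReal (|deriv (stepDown ε) r|) with hR
    have hRm : Measurable R := (continuous_deriv_stepDown ε).abs.measurable.ennreal_ofReal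
    have hRi : ∫⁻ r, R r = 1 := lintegral_deriv_stepDown hε
    have hindm : Measurable ((Set.Icc 0 ε).indicator (1 : ℝ → ENNReal)) :=
      measurable_one.indicator measurableSet_Icc
    calc ∫⁻ t, S t * ENNReal.ofReal (gprof (∫ x, stepDown ε (t - F x) ∂(gmeas n)))
        ≤ ∫⁻ t, ∫⁻ x, S t * ((Set.Icc 0 ε).indicator 1 (t - F x) +
          R (t - F x) * G x) ∂(gmeas n) := by
          refine lintegral_mono fun t => ?_
          rw [lintegral_const_mul _ (by fun_prop)]
          by_cases ht : t < t₀
          · simp [hS0 t ht]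
          · exact mul_le_mul' le_rfl (bobkov_stepDown hF hc hε (hεt.trans (not_lt.1 ht)))
      _ = ∫⁻ x, (∫⁻ t, S t * ((Set.Icc 0 ε).indicator 1 (t - F x) +
          R (t - F x) * G x)) ∂(gmeas n) := by
          refine lintegral_lintegral_swap ?_
          refine Measurable.aemeasurable ?_
          unfold Function.uncurry
          fun_prop
      _ = ∫⁻ x, (∫⁻ r, S (F x + r) * ((Set.Icc 0 ε).indicator 1 r + R r * G x)) ∂(gmeas n) := by
          refine lintegral_congr fun x => ?_
          rw [← lintegral_add_left_eq_self _ (F x)]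
          simp
      _ = ∫⁻ r, ∫⁻ x, S (F x + r) * ((Set.Icc 0 ε).indicator 1 r + R r * G x) ∂(gmeas n) := by
          refine lintegral_lintegral_swap ?_
          refine Measurable.aemeasurable ?_
          unfold Function.uncurry
          fun_prop
      _ ≤ ∫⁻ r, (B * (Set.Icc 0 ε).indicator 1 r + R r * ⨆ r ∈ Set.Icc 0 ε, Φ r) := by
          refine lintegral_mono fun r => ?_
          simp_rw [mul_add]
          rw [lintegral_add_left (by fun_prop)]
          refine add_le_add ?_ ?_
          · calc _ ≤ ∫⁻ x, B * (Set.Icc 0 ε).indicator 1 r ∂(gmeas n) :=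
                lintegral_mono fun x => mul_le_mul' (hSB _) le_rfl
              _ = _ := by simp
          · have : ∀ x, S (F x + r) * (R r * G x) = R r * (S (F x + r) * G x) := fun x => by ring
            simp_rw [this]
            rw [lintegral_const_mul _ (by fun_prop)]
            by_cases hr : r ∈ Set.Icc 0 ε
            · exact mul_le_mul' le_rfl (le_iSup₂ (f := fun r _ => Φ r) r hr)
            · have : R r = 0 := by simp [hR, deriv_stepDown_of_not_mem hε hr]
              simp [this]
      _ = B * ENNReal.ofReal ε + ⨆ r ∈ Set.Icc 0 ε, Φ r := by
          rw [lintegral_add_left (by fun_prop), lintegral_const_mul _ hindm,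
            lintegral_mul_const _ hRm, hRi, lintegral_indicator_one measurableSet_Icc]
          simp
  set e : ℕ → ℝ := fun k => t₀ / (k + 1) with he
  have he0 : ∀ k, 0 < e k := fun k => by positivity
  have het : ∀ k, e k ≤ t₀ := fun k => div_le_self ht₀.le (by linarith [Nat.cast_nonneg (α := ℝ) k])
  have helim : Filter.Tendsto e Filter.atTop (nhds 0) := by
    simpa only [mul_zero, mul_one_div] using (tendsto_one_div_add_atTop_nhds_zero_nat (𝕜 := ℝ)).const_mul t₀
  have hlev : ∀ t, Filter.Tendsto (fun k => ∫ x, stepDown (e k) (t - F x) ∂(gmeas n)) Filter.atTop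
      (nhds ((gmeas n).real {x | t ≤ F x})) := by
    intro t
    rw [← integral_indicator_one (measurableSet_le measurable_const hFm)]
    refine tendsto_integral_of_dominated_convergence (fun _ => 1)
      (fun k => ((stepDown_contDiff _).continuous.comp
        (continuous_const.sub hF.continuous)).aestronglyMeasurable) (integrable_const _)
      (fun k => ae_of_all _ fun x => ?_) (ae_of_all _ fun x => ?_)
    · have := stepDown_mem (e k) (t - F x)
      rw [Real.norm_of_nonneg this.1]; exact this.2
    · refine tendsto_const_nhds.congr' ?_
      by_cases hx : t ≤ F x
      · refine Filter.Eventually.of_forall fun k => ?_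
        simp only
        rw [stepDown_of_nonpos (he0 k) (by linarith), Set.indicator_of_mem (by exact hx)]; simp
      · filter_upwards [helim.eventually_le_const (sub_pos.2 (not_le.1 hx))] with k hk
        rw [stepDown_of_ge (he0 k) hk, Set.indicator_of_notMem (by exact hx)]
  have hae : ∀ᵐ t, (gmeas n).real {x | t < F x} = (gmeas n).real {x | t ≤ F x} := by
    have hcount := Measure.countable_meas_level_set_pos (μ := gmeas n) hFm
    filter_upwards [hcount.ae_notMem volume] with t ht
    have h0 : gmeas n {x | F x = t} = 0 := by simpa using ht
    refine measureReal_congr ?_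
    have : ∀ᵐ x ∂(gmeas n), F x ≠ t := by rw [ae_iff]; simpa using h0
    filter_upwards [this] with x hx
    refine propext ⟨fun h => le_of_lt h, fun h => lt_of_le_of_ne h (Ne.symm hx)⟩
  have hmeas : ∀ k, Measurable fun t => S t * ENNReal.ofReal
      (gprof (∫ x, stepDown (e k) (t - F x) ∂(gmeas n))) := by
    intro k
    refine hS.mul (ENNReal.measurable_ofReal.comp (gprof_continuous.measurable.comp ?_))
    refine StronglyMeasurable.measurable (StronglyMeasurable.integral_prod_right ?_)
    refine Continuous.stronglyMeasurable ?_
    have := (stepDown_contDiff (e k)).continuous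
    have := hF.continuous
    unfold Function.uncurry
    fun_prop
  have hΦ0 : Φ 0 = ∫⁻ x, S (F x) * ENNReal.ofReal ‖gradient F x‖ ∂(gmeas n) := by simp [hΦ, hG]
  rw [← hΦ0]
  refine le_of_forall_gt_imp_ge_of_dense fun c hcc => ?_
  calc ∫⁻ t, S t * ENNReal.ofReal (gprof ((gmeas n).real {x | t < F x}))
      = ∫⁻ t, Filter.liminf (fun k => S t * ENNReal.ofReal
          (gprof (∫ x, stepDown (e k) (t - F x) ∂(gmeas n)))) Filter.atTop := by
        refine lintegral_congr_ae ?_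
        filter_upwards [hae] with t ht
        rw [ht]
        refine (Filter.Tendsto.liminf_eq ?_).symm
        refine ENNReal.Tendsto.const_mul ?_ (Or.inr (ne_top_of_le_ne_top hB (hSB t)))
        exact (ENNReal.continuous_ofReal.tendsto _).comp ((gprof_continuous.tendsto _).comp (hlev t))
    _ ≤ Filter.liminf (fun k => ∫⁻ t, S t * ENNReal.ofReal
          (gprof (∫ x, stepDown (e k) (t - F x) ∂(gmeas n)))) Filter.atTop :=
        lintegral_liminf_le hmeas
    _ ≤ Filter.liminf (fun k => B * ENNReal.ofReal (e k) + c) Filter.atTop := by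
        refine Filter.liminf_le_liminf ?_
        have hev := hΦlim.eventually_le_const hcc
        rw [eventually_nhdsWithin_iff, Metric.eventually_nhds_iff] at hev
        obtain ⟨δ, hδ, hev⟩ := hev
        filter_upwards [helim.eventually_lt_const hδ] with k hk
        refine (hstep _ (he0 k) (het k)).trans (add_le_add le_rfl ?_)
        refine iSup₂_le fun r hr => hev ?_ hr.1
        rw [Real.dist_eq, sub_zero, abs_of_nonneg hr.1]
        exact lt_of_le_of_lt hr.2 hk
    _ = c := by
        refine Filter.Tendsto.liminf_eq ?_
        have h1 : Filter.Tendsto (fun k => ENNReal.ofReal (e k)) Filter.atTop (nhds 0) := by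
          have := (ENNReal.continuous_ofReal.tendsto 0).comp helim
          simpa [Function.comp_def] using this
        have h2 := (ENNReal.Tendsto.const_mul h1 (Or.inr hB)).add_const c
        simpa using h2

lemma lintegral_Ioi_le_of_hasDerivAt {f H H' : ℝ → ℝ} {x : ℝ}
    (hH : ∀ t ∈ Set.Ici x, HasDerivAt H (H' t) t) (hf : ∀ t ∈ Set.Ici x, 0 ≤ f t)
    (hle : ∀ t ∈ Set.Ici x, H' t ≤ -f t) (hpos : ∀ t ∈ Set.Ici x, 0 ≤ H t) :
    ∫⁻ t in Set.Ioi x, ENNReal.ofReal (f t) ≤ ENNReal.ofReal (H x) := by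
  have hanti : AntitoneOn H (Set.Ici x) := by
    refine antitoneOn_of_deriv_nonpos (convex_Ici x)
      (fun t ht => (hH t ht).continuousAt.continuousWithinAt)
      (fun t ht => (hH t (interior_subset ht)).differentiableAt.differentiableWithinAt)
      (fun t ht => ?_)
    have ht' := interior_subset ht
    rw [(hH t ht').deriv]
    linarith [hf t ht', hle t ht']
  obtain ⟨l, hl⟩ : ∃ l, Filter.Tendsto H Filter.atTop (nhds l) := by
    have hanti' : Antitone fun t => H (max x t) := fun s t hst =>
      hanti (Set.mem_Ici.2 (le_max_left _ _)) (Set.mem_Ici.2 (le_max_left _ _))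
        (max_le_max le_rfl hst)
    have hb : BddBelow (Set.range fun t => H (max x t)) :=
      ⟨0, by rintro _ ⟨t, rfl⟩; exact hpos _ (Set.mem_Ici.2 (le_max_left _ _))⟩
    refine ⟨_, (tendsto_atTop_ciInf hanti' hb).congr' ?_⟩
    filter_upwards [Filter.eventually_ge_atTop x] with t ht
    rw [max_eq_right ht]
  have hl0 : 0 ≤ l := by
    refine ge_of_tendsto hl ?_
    filter_upwards [Filter.eventually_ge_atTop x] with t ht using hpos t ht
  have hnp : ∀ t ∈ Set.Ioi x, H' t ≤ 0 := fun t ht => by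
    have ht' : t ∈ Set.Ici x := Set.Ioi_subset_Ici_self ht
    linarith [hf t ht', hle t ht']
  have hcont : ContinuousWithinAt H (Set.Ici x) x :=
    (hH x Set.self_mem_Ici).continuousAt.continuousWithinAt
  have hderiv : ∀ t ∈ Set.Ioi x, HasDerivAt H (H' t) t := fun t ht => hH t (Set.Ioi_subset_Ici_self ht)
  have hint := integral_Ioi_of_hasDerivAt_of_nonpos hcont hderiv hnp hl
  have hintg := integrableOn_Ioi_deriv_of_nonpos hcont hderiv hnp hl
  calc ∫⁻ t in Set.Ioi x, ENNReal.ofReal (f t) ≤ ∫⁻ t in Set.Ioi x, ENNReal.ofReal (-H' t) := by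
        refine setLIntegral_mono' measurableSet_Ioi fun t ht => ENNReal.ofReal_le_ofReal ?_
        linarith [hle t (Set.Ioi_subset_Ici_self ht)]
    _ = ENNReal.ofReal (∫ t in Set.Ioi x, -H' t) := by
        rw [ofReal_integral_eq_lintegral_ofReal (f := fun t => -H' t) hintg.neg]
        rw [Filter.EventuallyLE, ae_restrict_iff' measurableSet_Ioi]
        exact ae_of_all _ fun t ht => by simpa using hnp t ht
    _ ≤ ENNReal.ofReal (H x) := by
        refine ENNReal.ofReal_le_ofReal ?_
        rw [integral_neg, hint]; linarith

/-- Mills' ratio of the Gaussian. -/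
def mills (y : ℝ) : ℝ := gcdf (-y) / gpdf y

/-- The constant `√(π/2)`. -/
def kap : ℝ := √(Real.pi / 2)

lemma one_le_kap : 1 ≤ kap := by
  unfold kap
  rw [Real.one_le_sqrt]
  linarith [Real.pi_gt_three]

lemma kap_le_two : kap ≤ 2 := by
  unfold kap
  rw [Real.sqrt_le_iff]
  exact ⟨by norm_num, by linarith [Real.pi_lt_four]⟩

lemma mills_hasDerivAt (y : ℝ) : HasDerivAt mills (y * mills y - 1) y := by
  have h1 : HasDerivAt (fun y => gcdf (-y)) (-gpdf y) y := by
    simpa [gpdf_neg, Function.comp_def] using (gcdf_hasDerivAt (-y)).comp y (hasDerivAt_neg y)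
  have hp := (gpdf_pos y).ne'
  convert! h1.div (gpdf_hasDerivAt y) hp using 1
  unfold mills
  field_simp
  ring

lemma mills_zero : mills 0 = kap := by
  unfold mills gpdf kap
  rw [neg_zero, gcdf_zero, Real.sqrt_div Real.pi_pos.le, Real.sqrt_mul (by norm_num)]
  simp
  have : √(2:ℝ) ^ 2 = 2 := Real.sq_sqrt (by norm_num)
  have hs : √(2:ℝ) ≠ 0 := by positivity
  field_simp
  linarith

lemma mills_pos (y : ℝ) : 0 < mills y := div_pos (gcdf_pos _) (gpdf_pos _)

lemma gcdf_neg_eq (y : ℝ) : gcdf (-y) = ∫ t in Set.Ioi y, gpdf t := by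
  have := gcdf_add_Ioi y
  rw [gcdf_neg]; linarith

lemma mul_mills_le_one {y : ℝ} (hy : 0 < y) : y * mills y ≤ 1 := by
  have h := lintegral_Ioi_le_of_hasDerivAt (f := gpdf) (H := fun t => gpdf t / t)
    (H' := fun t => ((-t * gpdf t) * t - gpdf t * 1) / t ^ 2) (x := y)
    (fun t ht => (gpdf_hasDerivAt t).div (hasDerivAt_id t) (ne_of_gt (lt_of_lt_of_le hy ht)))
    (fun t _ => (gpdf_pos t).le)
    (fun t ht => by
      have : 0 < t := lt_of_lt_of_le hy ht
      have := gpdf_pos t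
      rw [div_le_iff₀ (by positivity)]
      nlinarith)
    (fun t ht => div_nonneg (gpdf_pos t).le (hy.le.trans ht))
  rw [← ofReal_integral_eq_lintegral_ofReal gpdf_integrable.integrableOn
    (ae_of_all _ fun t => (gpdf_pos t).le), ← gcdf_neg_eq,
    ENNReal.ofReal_le_ofReal_iff (div_nonneg (gpdf_pos y).le hy.le)] at h
  unfold mills
  have := gpdf_pos y
  rw [le_div_iff₀ hy] at h
  rw [← mul_div_assoc, div_le_one this]
  linarith

lemma le_mills {y : ℝ} (hy : 0 < y) : y / (1 + y ^ 2) ≤ mills y := by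
  set K : ℝ → ℝ := fun t => t / (1 + t ^ 2) * gpdf t - gcdf (-t) with hK
  have hd : ∀ t, HasDerivAt K (2 / (1 + t ^ 2) ^ 2 * gpdf t) t := by
    intro t
    have h1 : HasDerivAt (fun y => gcdf (-y)) (-gpdf t) t := by
      simpa [gpdf_neg, Function.comp_def] using (gcdf_hasDerivAt (-t)).comp t (hasDerivAt_neg t)
    have h2 : HasDerivAt (fun t : ℝ => 1 + t ^ 2) (2 * t) t := by
      simpa using (hasDerivAt_pow 2 t).const_add 1
    have hp : 1 + t ^ 2 ≠ 0 := by positivity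
    convert! (((hasDerivAt_id t).div h2 hp).mul (gpdf_hasDerivAt t)).sub h1 using 1
    simp only [Pi.div_apply, id]
    field_simp
    ring
  have hmono : Monotone K := monotone_of_hasDerivAt_nonneg hd fun t =>
    mul_nonneg (by positivity) (gpdf_pos t).le
  have hlim : Filter.Tendsto gpdf Filter.atTop (nhds 0) := by
    have := gpdf_tendsto_atBot.comp Filter.tendsto_neg_atTop_atBot
    simpa [Function.comp_def, gpdf_neg] using this
  have hle : K y ≤ 0 := by
    refine ge_of_tendsto hlim ?_
    filter_upwards [Filter.eventually_ge_atTop y] with t ht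
    refine (hmono ht).trans ?_
    have h1 : t / (1 + t ^ 2) ≤ 1 := by
      rw [div_le_one (by positivity)]; nlinarith [sq_nonneg (t - 1), sq_nonneg (t + 1)]
    have := gpdf_pos t
    have := gcdf_pos (-t)
    simp only [hK]
    nlinarith
  unfold mills
  rw [le_div_iff₀ (gpdf_pos y)]
  simp only [hK] at hle
  linarith

lemma mills_le_kap {y : ℝ} (hy : 0 ≤ y) : mills y ≤ kap := by
  have := le_of_hasDerivAt_nonneg (f := fun y => -mills y) (f' := fun y => -(y * mills y - 1)) hy
    (fun t _ => (mills_hasDerivAt t).neg) (fun t ht => by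
      rcases ht.1.eq_or_lt with h | h
      · simp [← h]
      · have := mul_mills_le_one h; linarith)
  simp only [mills_zero] at this
  linarith

lemma add_mills_ge {y : ℝ} (hy : 0 ≤ y) : kap ≤ y + mills y := by
  have := le_of_hasDerivAt_nonneg (f := fun y => y + mills y)
    (f' := fun y => 1 + (y * mills y - 1)) hy
    (fun t _ => (hasDerivAt_id t).add (mills_hasDerivAt t)) (fun t ht => by
      have := mul_nonneg ht.1 (mills_pos t).le; linarith)
  simpa [mills_zero] using this

lemma add_mills_le {y : ℝ} (hy : 0 ≤ y) : y + mills y ≤ kap + kap * y ^ 2 / 2 := by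
  have := le_of_hasDerivAt_nonneg (f := fun y => kap * y ^ 2 / 2 - (y + mills y))
    (f' := fun y => kap * (2 * y) / 2 - (1 + (y * mills y - 1))) hy
    (fun t _ => by
      refine HasDerivAt.sub ?_ ((hasDerivAt_id t).add (mills_hasDerivAt t))
      simpa using ((hasDerivAt_pow 2 t).const_mul kap).div_const 2) (fun t ht => by
      have := mul_le_mul_of_nonneg_left (mills_le_kap ht.1) ht.1
      linarith)
  simp [mills_zero] at this
  linarith

/-- A supersolution of the Riccati equation associated with the half-line Dirichlet problem for
the Ornstein–Uhlenbeck operator. -/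
def psol (θ y : ℝ) : ℝ := 1 / y + θ * ((y + mills y - kap) / y ^ 2)

lemma psol_hasDerivAt (θ : ℝ) {y : ℝ} (hy : 0 < y) :
    HasDerivAt (psol θ) (-(1 / y ^ 2) + θ * (mills y / y - 2 * (y + mills y - kap) / y ^ 3)) y := by
  have h1 : HasDerivAt (fun y : ℝ => 1 / y) (-(1 / y ^ 2)) y := by
    simpa using hasDerivAt_inv hy.ne'
  have h2 := ((((hasDerivAt_id y).add (mills_hasDerivAt y)).sub_const kap).div (hasDerivAt_pow 2 y)
    (by positivity)).const_mul θ
  convert! h1.add h2 using 1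
  simp only [Pi.add_apply, id, Nat.add_one_sub_one, pow_one]
  push_cast
  field_simp
  ring

lemma psol_nonneg {θ y : ℝ} (hθ : θ ∈ Set.Icc (-1:ℝ) 1) (hy : 0 < y) : 0 ≤ psol θ y := by
  have h1 := mills_le_kap hy.le
  have h2 := add_mills_ge hy.le
  have e : psol θ y = (y + θ * (y + mills y - kap)) / y ^ 2 := by
    unfold psol; field_simp
  rw [e]
  refine div_nonneg ?_ (by positivity)
  nlinarith [hθ.1, hθ.2]

lemma psol_deriv_nonpos {θ y : ℝ} (hθ : θ ∈ Set.Icc (-1:ℝ) 1) (hy : 0 < y) :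
    -(1 / y ^ 2) + θ * (mills y / y - 2 * (y + mills y - kap) / y ^ 3) ≤ 0 := by
  have hk1 := one_le_kap
  have hk2 := kap_le_two
  set D := mills y * (y ^ 2 - 2) - 2 * y + 2 * kap with hD
  have e : -(1 / y ^ 2) + θ * (mills y / y - 2 * (y + mills y - kap) / y ^ 3) =
      (θ * D - y) / y ^ 3 := by
    rw [hD]; field_simp; ring
  have h1 := add_mills_ge hy.le
  have h2 := add_mills_le hy.le
  have hup : D ≤ y := by
    by_cases h : 2 ≤ y ^ 2
    · have h3 := mul_mills_le_one hy
      have : y * D ≤ y * y := by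
        rw [hD]
        nlinarith [mul_le_mul_of_nonneg_right h3 (sub_nonneg.2 h), sq_nonneg (y - 1)]
      exact le_of_mul_le_mul_left this hy
    · have h3 : (mills y - (kap - y)) * (2 - y ^ 2) ≥ 0 := mul_nonneg (by linarith) (by linarith)
      have h4 : 0 ≤ y * (y ^ 2 + 1 - kap * y) := mul_nonneg hy.le (by nlinarith [sq_nonneg (y - 1)])
      rw [hD]
      nlinarith
  have hlow : -y ≤ D := by
    by_cases h : 2 ≤ y ^ 2
    · have h3 := le_mills hy
      rw [div_le_iff₀ (by positivity)] at h3
      have : 0 ≤ (1 + y ^ 2) * (D + y) := by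
        rw [hD]
        nlinarith [mul_le_mul_of_nonneg_right h3 (sub_nonneg.2 h), sq_nonneg (y - 1)]
      have := nonneg_of_mul_nonneg_right this (by positivity : 0 < 1 + y ^ 2)
      linarith
    · have h3 : (kap + kap * y ^ 2 / 2 - y - mills y) * (2 - y ^ 2) ≥ 0 :=
        mul_nonneg (by linarith) (by linarith)
      have h4 : 0 ≤ 1 - y ^ 2 + kap * y ^ 3 / 2 := by
        have : y ^ 3 ≤ kap * y ^ 3 := le_mul_of_one_le_left (by positivity) hk1
        nlinarith [sq_nonneg (y - 4 / 3), mul_nonneg hy.le (sq_nonneg (y - 4 / 3))]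
      have h5 := mul_nonneg hy.le h4
      rw [hD]
      nlinarith
  rw [e]
  refine div_nonpos_of_nonpos_of_nonneg ?_ (by positivity)
  nlinarith [hθ.1, hθ.2]

lemma psol_riccati {θ y : ℝ} (hy : 0 < y) :
    -(1 / y ^ 2) + θ * (mills y / y - 2 * (y + mills y - kap) / y ^ 3) - (y + kap * θ) * psol θ y
      ≤ -(1 + θ + psol θ y ^ 2) := by
  set Q := (y + mills y - kap) / y ^ 2 with hQ
  have hm : mills y = Q * y ^ 2 - y + kap := by rw [hQ]; field_simp; ring
  have hQ0 : 0 ≤ Q := div_nonneg (by linarith [add_mills_ge hy.le]) (by positivity)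
  have hQk : Q ≤ kap := by
    rw [hQ, div_le_iff₀ (by positivity)]
    have := mul_nonneg (zero_le_one.trans one_le_kap) (sq_nonneg y)
    linarith [add_mills_le hy.le]
  have e : -(1 + θ + psol θ y ^ 2) - (-(1 / y ^ 2) + θ * (mills y / y -
      2 * (y + mills y - kap) / y ^ 3) - (y + kap * θ) * psol θ y) = θ ^ 2 * (Q * (kap - Q)) := by
    unfold psol
    rw [← hQ, hm]
    field_simp
    ring
  have : 0 ≤ θ ^ 2 * (Q * (kap - Q)) :=
    mul_nonneg (sq_nonneg _) (mul_nonneg hQ0 (sub_nonneg.2 hQk))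
  linarith

lemma psol_antitoneOn {θ : ℝ} (hθ : θ ∈ Set.Icc (-1:ℝ) 1) : AntitoneOn (psol θ) (Set.Ioi 0) := by
  refine antitoneOn_of_deriv_nonpos (convex_Ioi 0)
    (fun t ht => (psol_hasDerivAt θ ht).continuousAt.continuousWithinAt)
    (fun t ht => (psol_hasDerivAt θ (interior_subset ht)).differentiableAt.differentiableWithinAt)
    (fun t ht => ?_)
  rw [(psol_hasDerivAt θ (interior_subset ht)).deriv]
  exact psol_deriv_nonpos hθ (interior_subset ht)

lemma psol_tail {θ x : ℝ} (hθ : θ ∈ Set.Icc (-1:ℝ) 1) (hx : kap * θ < x) :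
    ∫⁻ t in Set.Ioi x, ENNReal.ofReal ((1 + θ + psol θ (t - kap * θ) ^ 2) * gpdf t) ≤
      ENNReal.ofReal (psol θ (x - kap * θ) * gpdf x) := by
  have hy : ∀ t ∈ Set.Ici x, 0 < t - kap * θ := fun t ht => sub_pos.2 (lt_of_lt_of_le hx ht)
  refine lintegral_Ioi_le_of_hasDerivAt (H := fun t => psol θ (t - kap * θ) * gpdf t)
    (fun t ht => ((psol_hasDerivAt θ (hy t ht)).comp_sub_const t (kap * θ)).mul
      (gpdf_hasDerivAt t)) (fun t ht => ?_) (fun t ht => ?_) (fun t ht => ?_)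
  · have := gpdf_pos t
    exact mul_nonneg (by nlinarith [hθ.1, sq_nonneg (psol θ (t - kap * θ))]) this.le
  · have h := mul_le_mul_of_nonneg_right (psol_riccati (θ := θ) (hy t ht)) (gpdf_pos t).le
    rw [sub_add_cancel] at h
    linarith
  · exact mul_nonneg (psol_nonneg hθ (hy t ht)) (gpdf_pos t).le

lemma measure_preimage_le_of_forall_Iic {Ω : Type*} [MeasurableSpace Ω] {ρ : Measure Ω}
    {F : Ω → ℝ} {A : Set ℝ} (hA : BddAbove A) {c : ENNReal}
    (h : ∀ τ ∈ A, ρ {x | F x ≤ τ} ≤ c) : ρ {x | F x ∈ A} ≤ c := by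
  rcases A.eq_empty_or_nonempty with rfl | hne
  · simp
  by_cases hs : sSup A ∈ A
  · exact le_trans (measure_mono fun x (hx : F x ∈ A) => le_csSup hA hx) (h _ hs)
  · obtain ⟨u, hu, hut, huA⟩ := exists_seq_tendsto_sSup hne hA
    have hmono : Monotone fun k => {x | F x ≤ u k} := fun i j hij x hx =>
      le_trans (show F x ≤ u i from hx) (hu hij)
    calc ρ {x | F x ∈ A} ≤ ρ (⋃ k, {x | F x ≤ u k}) := by
          refine measure_mono fun x hx => ?_
          have hlt : F x < sSup A := lt_of_le_of_ne (le_csSup hA hx) fun he => hs (he ▸ hx)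
          obtain ⟨k, hk⟩ := (hut.eventually_const_lt hlt).exists
          exact Set.mem_iUnion.2 ⟨k, hk.le⟩
      _ = ⨆ k, ρ {x | F x ≤ u k} := hmono.measure_iUnion
      _ ≤ c := iSup_le fun k => h _ (huA k)

/-- The one-dimensional standard Gaussian measure given by `gpdf`. -/
def gline : Measure ℝ := volume.withDensity fun t => ENNReal.ofReal (gpdf t)

lemma gline_Ioi (x : ℝ) : gline (Set.Ioi x) = ENNReal.ofReal (gcdf (-x)) := by
  rw [gline, withDensity_apply _ measurableSet_Ioi, gcdf_neg_eq,
    ofReal_integral_eq_lintegral_ofReal gpdf_integrable.integrableOn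
      (ae_of_all _ fun t => (gpdf_pos t).le)]

lemma gline_Ioc {x y : ℝ} (hxy : x ≤ y) :
    gline (Set.Ioc x y) = ENNReal.ofReal (gcdf (-x) - gcdf (-y)) := by
  have h : Set.Ioc x y = Set.Ioi x \ Set.Ioi y := by ext; simp
  rw [h, measure_sdiff (Set.Ioi_subset_Ioi hxy) measurableSet_Ioi.nullMeasurableSet
    (by rw [gline_Ioi]; exact ENNReal.ofReal_ne_top), gline_Ioi, gline_Ioi,
    ENNReal.ofReal_sub _ (gcdf_pos _).le]

/-- A profile on the line transported to mass coordinates. -/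
def massProf (q : ℝ → ℝ) (Q m : ℝ) : ℝ :=
  if m ≤ 0 then 0 else if m < 1 then q (-gquant m) else Q

lemma massProf_of_mem {q : ℝ → ℝ} {Q m : ℝ} (hm : m ∈ Set.Ioo 0 1) :
    massProf q Q m = q (-gquant m) := by
  simp [massProf, not_le.2 hm.1, hm.2]

lemma massProf_zero {q : ℝ → ℝ} {Q : ℝ} : massProf q Q 0 = 0 := by simp [massProf]

lemma massProf_nonneg {q : ℝ → ℝ} {Q : ℝ} (hq : ∀ x, 0 ≤ q x) (hQ : ∀ x, q x ≤ Q) (m : ℝ) :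
    0 ≤ massProf q Q m := by
  unfold massProf; split_ifs
  · exact le_rfl
  · exact hq _
  · exact (hq 0).trans (hQ 0)

lemma massProf_le {q : ℝ → ℝ} {Q : ℝ} (hq : ∀ x, 0 ≤ q x) (hQ : ∀ x, q x ≤ Q) (m : ℝ) :
    massProf q Q m ≤ Q := by
  unfold massProf; split_ifs
  · exact (hq 0).trans (hQ 0)
  · exact hQ _
  · exact le_rfl

lemma massProf_monotone {q : ℝ → ℝ} {Q : ℝ} (hq : ∀ x, 0 ≤ q x) (hQ : ∀ x, q x ≤ Q)
    (ha : Antitone q) : Monotone (massProf q Q) := by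
  intro s t hst
  by_cases hs : s ≤ 0
  · rw [show massProf q Q s = 0 by simp [massProf, hs]]
    exact massProf_nonneg hq hQ t
  by_cases ht : t < 1
  · have hs' : s ∈ Set.Ioo (0:ℝ) 1 := ⟨not_le.1 hs, hst.trans_lt ht⟩
    have ht' : t ∈ Set.Ioo (0:ℝ) 1 := ⟨(not_le.1 hs).trans_le hst, ht⟩
    rw [massProf_of_mem hs', massProf_of_mem ht']
    exact ha (neg_le_neg (gquant_mono hs' ht' hst))
  · have : massProf q Q t = Q := by
      simp [massProf, ht, not_le.2 ((not_le.1 hs).trans_le hst)]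
    rw [this]; exact massProf_le hq hQ s

lemma massProf_continuousAt {q : ℝ → ℝ} {Q m : ℝ} (hc : Continuous q) (hm : m ∈ Set.Ioo 0 1) :
    ContinuousAt (massProf q Q) m := by
  have : (fun m => q (-gquant m)) =ᶠ[nhds m] massProf q Q := by
    filter_upwards [Ioo_mem_nhds hm.1 hm.2] with s hs using (massProf_of_mem hs).symm
  refine ContinuousAt.congr ?_ this
  exact hc.continuousAt.comp (gquant_hasDerivAt hm).continuousAt.neg

section superlevel

variable {Ω : Type*} [MeasurableSpace Ω] {γ : Measure Ω} [IsProbabilityMeasure γ] {F : Ω → ℝ}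

lemma superlevel_antitone : Antitone fun t => γ.real {x | t < F x} := fun _ _ hst =>
  measureReal_mono fun _ hx => lt_of_le_of_lt hst hx

lemma superlevel_rightContinuous (hF : Measurable F) (t : ℝ) :
    ContinuousWithinAt (fun t => γ.real {x | t < F x}) (Set.Ici t) t := by
  have := Measure.isProbabilityMeasure_map (μ := γ) hF.aemeasurable
  have h : (fun t => γ.real {x | t < F x}) = fun t => 1 - ProbabilityTheory.cdf (γ.map F) t := by
    ext t
    rw [ProbabilityTheory.cdf_eq_real, map_measureReal_apply hF measurableSet_Iic,
      ← probReal_compl_eq_one_sub (hF measurableSet_Iic)]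
    congr 1; ext x; simp
  rw [h]
  exact continuousWithinAt_const.sub ((ProbabilityTheory.cdf (γ.map F)).right_continuous t)

lemma lintegral_superlevel_le (hF : Measurable F) {B : ℝ} (hB : ∀ x, F x ≤ B) {q : ℝ → ℝ} {Q : ℝ}
    (hq : ∀ x, 0 ≤ q x) (hQ : ∀ x, q x ≤ Q) (ha : Antitone q) {t : ℝ}
    (ht : γ.real {x | t < F x} ∈ Set.Ioo (0:ℝ) 1) :
    ∫⁻ x in {x | t < F x}, ENNReal.ofReal (massProf q Q (γ.real {y | F x < F y}) ^ 2) ∂γ ≤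
      ∫⁻ s in Set.Ioi (-gquant (γ.real {x | t < F x})), ENNReal.ofReal (q s ^ 2) ∂gline := by
  set m : ℝ → ℝ := fun t => γ.real {x | t < F x} with hm
  have hmanti : Antitone m := superlevel_antitone
  have hms : ∀ t, MeasurableSet {x | t < F x} := fun t => measurableSet_lt measurable_const hF
  have hPm : Measurable fun τ => massProf q Q (m τ) :=
    ((massProf_monotone hq hQ ha).comp_antitone hmanti).measurable
  rw [lintegral_eq_lintegral_meas_lt (f := fun x => massProf q Q (m (F x)) ^ 2) _
    (ae_of_all _ fun x => sq_nonneg _) ((hPm.comp hF).pow_const 2).aemeasurable,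
    lintegral_eq_lintegral_meas_lt (f := fun s => q s ^ 2) _ (ae_of_all _ fun x => sq_nonneg _)
      (ha.measurable.pow_const 2).aemeasurable]
  refine setLIntegral_mono' measurableSet_Ioi fun w hw => ?_
  have hw0 : (0:ℝ) < w := hw
  have hset : {x | w < massProf q Q (m (F x)) ^ 2} =
      {x | F x ∈ {τ | w < massProf q Q (m τ) ^ 2}} := rfl
  rw [hset]
  refine measure_preimage_le_of_forall_Iic ⟨B, fun τ hτ => ?_⟩ fun τ hτ => ?_
  · by_contra hlt
    have h0 : m τ = 0 := by
      have : {x | τ < F x} = ∅ := by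
        ext x; simpa using (hB x).trans (not_le.1 hlt).le
      simp [hm, this]
    have hτ' : w < massProf q Q (m τ) ^ 2 := hτ
    rw [h0, massProf_zero] at hτ'
    norm_num at hτ'; linarith
  · have hτ' : w < massProf q Q (m τ) ^ 2 := hτ
    have hmp : 0 < m τ := by
      by_contra hle
      simp only [massProf, not_lt.1 hle, if_true] at hτ'
      norm_num at hτ'; linarith
    rw [Measure.restrict_apply (measurableSet_le hF measurable_const)]
    by_cases htτ : τ ≤ t
    · have : {x | F x ≤ τ} ∩ {x | t < F x} = ∅ := by
        ext x; simp only [Set.mem_inter_iff, Set.mem_ofPred_eq, Set.mem_empty_iff_false, iff_false]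
        intro h; linarith [h.1, h.2]
      simp [this]
    have htτ' := (not_le.1 htτ).le
    have hτm : m τ ∈ Set.Ioo (0:ℝ) 1 := ⟨hmp, (hmanti htτ').trans_lt ht.2⟩
    have hle := gquant_mono hτm ht (hmanti htτ')
    have hdiff : {x | F x ≤ τ} ∩ {x | t < F x} = {x | t < F x} \ {x | τ < F x} := by
      ext x; simp only [Set.mem_inter_iff, Set.mem_ofPred_eq, Set.mem_sdiff, not_lt]; tauto
    calc γ ({x | F x ≤ τ} ∩ {x | t < F x}) = ENNReal.ofReal (m t - m τ) := by
          have hsub : {x | τ < F x} ⊆ {x | t < F x} := fun x hx => lt_of_le_of_lt htτ' hx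
          rw [hdiff, measure_sdiff hsub (hms τ).nullMeasurableSet
            (measure_ne_top _ _), ENNReal.ofReal_sub _ measureReal_nonneg]
          simp [hm, Measure.real]
      _ = gline (Set.Ioc (-gquant (m t)) (-gquant (m τ))) := by
          rw [gline_Ioc (neg_le_neg hle), neg_neg, neg_neg, gcdf_gquant ht, gcdf_gquant hτm]
      _ ≤ (gline.restrict (Set.Ioi (-gquant (m t)))) {s | w < q s ^ 2} := by
          rw [Measure.restrict_apply (measurableSet_lt measurable_const
            (ha.measurable.pow_const 2))]
          refine measure_mono fun s hs => ⟨?_, hs.1⟩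
          rw [massProf_of_mem hτm] at hτ'
          have h1 : q (-gquant (m τ)) ≤ q s := ha hs.2
          have h2 := hq (-gquant (m τ))
          simp only [Set.mem_ofPred_eq]
          nlinarith

end superlevel

lemma gaussian_faber_krahn_core {n : ℕ} {F : EuclideanSpace ℝ (Fin n) → ℝ} (hF : ContDiff ℝ 1 F)
    (hc : HasCompactSupport F) (hF0 : ∀ x, 0 ≤ F x) {l Q b : ℝ} {q : ℝ → ℝ}
    (hq : ∀ x, 0 ≤ q x) (hQ : ∀ x, q x ≤ Q) (ha : Antitone q) (hqc : Continuous q)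
    (htail : ∀ x, b ≤ x → ENNReal.ofReal l * gline (Set.Ioi x) +
      ∫⁻ s in Set.Ioi x, ENNReal.ofReal (q s ^ 2) ∂gline ≤ ENNReal.ofReal (q x * gpdf x))
    (hb : (gmeas n).real {x | 0 < F x} ≤ gcdf (-b)) :
    ENNReal.ofReal l * ∫⁻ x, ENNReal.ofReal (F x ^ 2) ∂(gmeas n) ≤
      ∫⁻ x, ENNReal.ofReal (‖gradient F x‖ ^ 2) ∂(gmeas n) := by
  obtain ⟨B, hB⟩ : ∃ B, ∀ x, F x ≤ B := by
    obtain ⟨B, hB⟩ := hc.exists_bound_of_continuous hF.continuous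
    exact ⟨B, fun x => (le_abs_self _).trans (hB x)⟩
  have hFm : Measurable F := hF.continuous.measurable
  have hQ0 : 0 ≤ Q := (hq 0).trans (hQ 0)
  set γ := gmeas n with hγ
  set m : ℝ → ℝ := fun t => γ.real {x | t < F x} with hm
  have hmanti : Antitone m := superlevel_antitone
  have hms : ∀ t, MeasurableSet {x | t < F x} := fun t => measurableSet_lt measurable_const hFm
  have hm1 : ∀ t, 0 ≤ t → m t < 1 := fun t ht =>
    ((hmanti ht).trans hb).trans_lt (gcdf_lt_one _)
  have hmB : ∀ t, B ≤ t → m t = 0 := fun t ht => by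
    have : {x | t < F x} = ∅ := by ext x; simpa using (hB x).trans ht
    simp [hm, this]
  set P : ℝ → ℝ := massProf q Q with hP
  have hPm : Measurable fun τ => P (m τ) :=
    ((massProf_monotone hq hQ ha).comp_antitone hmanti).measurable
  have hPnn : ∀ s, 0 ≤ P s := massProf_nonneg hq hQ
  have hPQ : ∀ s, P s ≤ Q := massProf_le hq hQ
  set κ : Measure (EuclideanSpace ℝ (Fin n)) :=
    γ.withDensity (fun x => ENNReal.ofReal l + ENNReal.ofReal (P (m (F x)) ^ 2)) with hκ
  have hPFm : Measurable fun x => ENNReal.ofReal (P (m (F x)) ^ 2) :=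
    ((hPm.comp hFm).pow_const 2).ennreal_ofReal
  have hkey : ∀ t, 0 ≤ t → κ {x | t < F x} ≤ ENNReal.ofReal (P (m t) * gprof (m t)) := by
    intro t ht
    rw [hκ, withDensity_apply _ (hms t)]
    rcases (measureReal_nonneg (μ := γ) (s := {x | t < F x})).eq_or_lt' with h0 | hpos
    · have : γ {x | t < F x} = 0 := by
        rwa [measureReal_eq_zero_iff] at h0
      rw [setLIntegral_measure_zero _ _ this]; exact zero_le
    · have hmt : m t ∈ Set.Ioo (0:ℝ) 1 := ⟨hpos, hm1 t ht⟩
      have hbx : b ≤ -gquant (m t) := by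
        have : m t ≤ gcdf (-b) := (hmanti ht).trans hb
        rw [← gcdf_gquant hmt, gcdf_strictMono.le_iff_le] at this
        linarith
      rw [lintegral_add_left measurable_const, setLIntegral_const, hP, massProf_of_mem hmt,
        gprof_of_mem hmt, ← gpdf_neg (gquant (m t))]
      refine le_trans (add_le_add (le_of_eq ?_) (lintegral_superlevel_le hFm hB hq hQ ha hmt))
        (htail _ hbx)
      rw [gline_Ioi, neg_neg, gcdf_gquant hmt]
      simp [hm, Measure.real]
  have hT2 : ∫⁻ x, ENNReal.ofReal (F x ^ 2) * ENNReal.ofReal (P (m (F x)) ^ 2) ∂γ ≠ ⊤ := by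
    have : ∫⁻ x, ENNReal.ofReal (F x ^ 2) * ENNReal.ofReal (P (m (F x)) ^ 2) ∂γ ≤
        ∫⁻ x, ENNReal.ofReal (B ^ 2) * ENNReal.ofReal (Q ^ 2) ∂γ := by
      refine lintegral_mono fun x => mul_le_mul' (ENNReal.ofReal_le_ofReal ?_)
        (ENNReal.ofReal_le_ofReal ?_)
      · nlinarith [hF0 x, hB x]
      · nlinarith [hPnn (m (F x)), hPQ (m (F x))]
    refine ne_top_of_le_ne_top ?_ this
    rw [lintegral_const]; simp [ENNReal.mul_eq_top]
  have hlevel : ∀ t₀ : ℝ, 0 < t₀ → ∫⁻ t in Set.Ici t₀, κ {x | t < F x} * ENNReal.ofReal (2 * t) ≤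
      ∫⁻ x, ENNReal.ofReal (‖gradient F x‖ ^ 2) ∂γ +
        ∫⁻ x, ENNReal.ofReal (F x ^ 2) * ENNReal.ofReal (P (m (F x)) ^ 2) ∂γ := by
    intro t₀ ht₀
    set S : ℝ → ENNReal := (Set.Ici t₀).indicator fun t => ENNReal.ofReal (t * P (m t)) with hS
    have hSm : Measurable S := (measurable_id.mul hPm).ennreal_ofReal.indicator measurableSet_Ici
    have hSB : ∀ t, S t ≤ ENNReal.ofReal (B * Q) := by
      intro t
      by_cases ht : t ∈ Set.Ici t₀
      · rw [hS, Set.indicator_of_mem ht]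
        refine ENNReal.ofReal_le_ofReal ?_
        by_cases htB : B ≤ t
        · have hB0 : 0 ≤ B := (hF0 0).trans (hB 0)
          rw [hmB t htB, hP, massProf_zero, mul_zero]; positivity
        · exact mul_le_mul (not_le.1 htB).le (hPQ _) (hPnn _) (ht₀.le.trans (ht.trans (not_le.1 htB).le))
      · rw [hS, Set.indicator_of_notMem ht]; exact zero_le
    have hmr : ∀ t, ContinuousWithinAt m (Set.Ici t) t := superlevel_rightContinuous hFm
    have hSr : ∀ t, ContinuousWithinAt S (Set.Ici t) t := by
      intro t
      by_cases ht : t < t₀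
      · refine (continuousAt_const (y := (0:ENNReal))).congr ?_ |>.continuousWithinAt
        filter_upwards [Iio_mem_nhds ht] with s hs
        rw [hS, Set.indicator_of_notMem (by simpa using hs)]
      have ht' : t₀ ≤ t := not_lt.1 ht
      have ht0 : 0 ≤ t := ht₀.le.trans ht'
      have hmain : ContinuousWithinAt (fun t => ENNReal.ofReal (t * P (m t))) (Set.Ici t) t := by
        refine ENNReal.continuous_ofReal.continuousAt.comp_continuousWithinAt
          (continuousWithinAt_id.mul ?_)
        rcases (measureReal_nonneg (μ := γ) (s := {x | t < F x})).eq_or_lt' with h0 | hpos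
        · refine (continuousWithinAt_const (b := (0:ℝ))).congr (fun s hs => ?_) ?_
          · have : m s = 0 := le_antisymm ((hmanti hs).trans h0.le) measureReal_nonneg
            simp [this, hP, massProf_zero]
          · have : m t = 0 := h0
            simp [this, hP, massProf_zero]
        · have hmt : m t ∈ Set.Ioo (0:ℝ) 1 := ⟨hpos, hm1 t ht0⟩
          exact ContinuousAt.comp_continuousWithinAt (f := m) (massProf_continuousAt hqc hmt) (hmr t)
      refine hmain.congr (fun s hs => ?_) ?_
      · rw [hS, Set.indicator_of_mem (Set.mem_Ici.2 (ht'.trans hs))]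
      · rw [hS, Set.indicator_of_mem (Set.mem_Ici.2 ht')]
    have hiso := gaussian_isoperimetric_levels hF hc hSm ENNReal.ofReal_ne_top hSB ht₀
      (fun t ht => by rw [hS, Set.indicator_of_notMem (by simpa using ht)]) hSr
    calc ∫⁻ t in Set.Ici t₀, κ {x | t < F x} * ENNReal.ofReal (2 * t)
        ≤ ∫⁻ t in Set.Ici t₀, 2 * (S t * ENNReal.ofReal (gprof (m t))) := by
          refine setLIntegral_mono' measurableSet_Ici fun t ht => ?_
          have ht0 : 0 ≤ t := ht₀.le.trans ht
          rw [hS, Set.indicator_of_mem ht]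
          refine (mul_le_mul' (hkey t ht0) le_rfl).trans (le_of_eq ?_)
          rw [ENNReal.ofReal_mul (hPnn _), ENNReal.ofReal_mul ht0, ENNReal.ofReal_mul zero_le_two]
          simp only [ENNReal.ofReal_ofNat]
          ring
      _ ≤ 2 * ∫⁻ t, S t * ENNReal.ofReal (gprof (m t)) := by
          rw [← lintegral_const_mul' _ _ (by simp)]
          exact setLIntegral_le_lintegral _ _
      _ ≤ 2 * ∫⁻ x, S (F x) * ENNReal.ofReal ‖gradient F x‖ ∂γ := mul_le_mul' le_rfl hiso
      _ = ∫⁻ x, 2 * (S (F x) * ENNReal.ofReal ‖gradient F x‖) ∂γ := by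
          rw [lintegral_const_mul' _ _ (by simp)]
      _ ≤ ∫⁻ x, (ENNReal.ofReal (‖gradient F x‖ ^ 2) +
            ENNReal.ofReal (F x ^ 2) * ENNReal.ofReal (P (m (F x)) ^ 2)) ∂γ := by
          refine lintegral_mono fun x => ?_
          have h1 : S (F x) ≤ ENNReal.ofReal (F x * P (m (F x))) := Set.indicator_le_self _ _ _
          refine (mul_le_mul' (le_refl 2) (mul_le_mul' h1 le_rfl)).trans ?_
          have h2 : ∀ a : ℝ, 2 * ENNReal.ofReal a = ENNReal.ofReal (2 * a) := fun a => by
            rw [ENNReal.ofReal_mul zero_le_two, ENNReal.ofReal_ofNat]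
          rw [← ENNReal.ofReal_mul (mul_nonneg (hF0 x) (hPnn _)), h2,
            ← ENNReal.ofReal_mul (sq_nonneg _), ← ENNReal.ofReal_add (sq_nonneg _) (by positivity)]
          refine ENNReal.ofReal_le_ofReal ?_
          nlinarith [sq_nonneg (‖gradient F x‖ - F x * P (m (F x)))]
      _ = _ := by
          exact lintegral_add_right _ ((hFm.pow_const 2).ennreal_ofReal.mul hPFm)
  have hall : ∫⁻ t in Set.Ioi 0, κ {x | t < F x} * ENNReal.ofReal (2 * t) ≤
      ∫⁻ x, ENNReal.ofReal (‖gradient F x‖ ^ 2) ∂γ +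
        ∫⁻ x, ENNReal.ofReal (F x ^ 2) * ENNReal.ofReal (P (m (F x)) ^ 2) ∂γ := by
    have hU : Set.Ioi (0:ℝ) = ⋃ k : ℕ, Set.Ici (1 / ((k:ℝ) + 1)) := by
      ext t
      simp only [Set.mem_Ioi, Set.mem_iUnion, Set.mem_Ici]
      refine ⟨fun ht => ?_, fun ⟨k, hk⟩ => lt_of_lt_of_le (by positivity) hk⟩
      obtain ⟨k, hk⟩ := exists_nat_one_div_lt ht
      exact ⟨k, hk.le⟩
    rw [hU, setLIntegral_iUnion_of_directed]
    · exact iSup_le fun k => hlevel _ (by positivity)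
    · refine Monotone.directed_le fun i j hij => Set.Ici_subset_Ici.2 ?_
      exact one_div_le_one_div_of_le (by positivity) (by exact_mod_cast Nat.succ_le_succ hij)
  have hcake := lintegral_comp_eq_lintegral_meas_lt_mul κ (f := F) (g := fun t => 2 * t)
    (ae_of_all _ hF0) hFm.aemeasurable
    (fun t _ => (continuous_const.mul continuous_id).intervalIntegrable _ _)
    (by
      rw [ae_restrict_iff' measurableSet_Ioi]
      exact ae_of_all _ fun t ht => mul_nonneg zero_le_two (le_of_lt ht))
  rw [← hcake] at hall
  have hint : ∀ x, ∫ t in (0:ℝ)..F x, 2 * t = F x ^ 2 := fun x => by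
    rw [intervalIntegral.integral_const_mul, integral_id]; ring
  simp_rw [hint] at hall
  have hdm : Measurable fun x => ENNReal.ofReal l + ENNReal.ofReal (P (m (F x)) ^ 2) :=
    measurable_const.add hPFm
  rw [hκ, lintegral_withDensity_eq_lintegral_mul _ hdm
    (hFm.pow_const 2).ennreal_ofReal] at hall
  simp only [Pi.mul_apply, add_mul] at hall
  rw [lintegral_add_left ((hFm.pow_const 2).ennreal_ofReal.const_mul _),
    lintegral_const_mul _ (hFm.pow_const 2).ennreal_ofReal] at hall
  simp_rw [mul_comm (ENNReal.ofReal (P _ ^ 2))] at hall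
  exact (ENNReal.add_le_add_iff_right hT2).1 hall

/-- Gaussian Faber-Krahn inequality for functions supported in a set of small measure. -/
lemma gaussian_faber_krahn {n : ℕ} {F : EuclideanSpace ℝ (Fin n) → ℝ} (hF : ContDiff ℝ 1 F)
    (hc : HasCompactSupport F) (hF0 : ∀ x, 0 ≤ F x) {θ : ℝ} (hθ : θ ∈ Set.Icc (-1:ℝ) 1)
    (hb : (gmeas n).real {x | 0 < F x} ≤ gcdf (-(kap * θ))) :
    ENNReal.ofReal (1 + θ) * ∫⁻ x, ENNReal.ofReal (F x ^ 2) ∂(gmeas n) ≤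
      ∫⁻ x, ENNReal.ofReal (‖gradient F x‖ ^ 2) ∂(gmeas n) := by
  have hkap : 0 < kap := lt_of_lt_of_le one_pos one_le_kap
  rcases hθ.1.eq_or_lt with h1 | hθ1
  · rw [← h1]; simp
  have hlt : ∀ φ ∈ Set.Ioo (-1) θ, ENNReal.ofReal (1 + φ) * ∫⁻ x, ENNReal.ofReal (F x ^ 2) ∂(gmeas n) ≤
      ∫⁻ x, ENNReal.ofReal (‖gradient F x‖ ^ 2) ∂(gmeas n) := by
    intro φ hφ
    have hφ' : φ ∈ Set.Icc (-1:ℝ) 1 := ⟨hφ.1.le, hφ.2.le.trans hθ.2⟩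
    set y₀ : ℝ := kap * θ - kap * φ with hy₀
    have hy0 : 0 < y₀ := by nlinarith [hφ.2]
    have hmax : ∀ x, max (x - kap * φ) y₀ ∈ Set.Ioi (0:ℝ) := fun x => lt_max_of_lt_right hy0
    have hcont : ContinuousOn (psol φ) (Set.Ioi 0) := fun t ht =>
      (psol_hasDerivAt φ ht).continuousAt.continuousWithinAt
    set q : ℝ → ℝ := fun x => psol φ (max (x - kap * φ) y₀) with hq
    have hqc : Continuous q := hcont.comp_continuous (by fun_prop) hmax
    refine gaussian_faber_krahn_core hF hc hF0 (q := q)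
      (Q := psol φ y₀) (b := kap * θ) (fun x => psol_nonneg hφ' (hmax x))
      (fun x => psol_antitoneOn hφ' hy0 (hmax x) (le_max_right _ _))
      (fun s t hst => psol_antitoneOn hφ' (hmax s) (hmax t) (max_le_max (by linarith) le_rfl))
      hqc (fun x hx => ?_) hb
    have hqe : ∀ t, x ≤ t → q t = psol φ (t - kap * φ) := fun t ht => by
      rw [hq]; simp only; rw [max_eq_left (by linarith)]
    have htail := psol_tail hφ' (x := x) (by nlinarith [hφ.2])
    rw [hqe x le_rfl]
    refine le_trans (le_of_eq ?_) htail
    have hl : 0 ≤ 1 + φ := by linarith [hφ.1]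
    have hgm : Measurable fun t => ENNReal.ofReal (gpdf t) := gpdf_continuous.measurable.ennreal_ofReal
    rw [← setLIntegral_const, ← lintegral_add_left measurable_const, gline,
      setLIntegral_withDensity_eq_setLIntegral_mul _ hgm (by fun_prop) measurableSet_Ioi]
    refine setLIntegral_congr_fun measurableSet_Ioi fun t ht => ?_
    simp only [Pi.mul_apply]
    rw [hqe t (le_of_lt ht), ← ENNReal.ofReal_add hl (sq_nonneg _),
      ← ENNReal.ofReal_mul (gpdf_pos t).le, mul_comm]
  have htend : Filter.Tendsto (fun φ => ENNReal.ofReal (1 + φ) * ∫⁻ x, ENNReal.ofReal (F x ^ 2) ∂(gmeas n))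
      (nhdsWithin θ (Set.Iio θ))
      (nhds (ENNReal.ofReal (1 + θ) * ∫⁻ x, ENNReal.ofReal (F x ^ 2) ∂(gmeas n))) := by
    refine ENNReal.Tendsto.mul_const ?_ (Or.inl ?_)
    · exact ((ENNReal.continuous_ofReal.comp (continuous_const.add continuous_id)).tendsto θ).mono_left
        nhdsWithin_le_nhds
    · simp; linarith
  refine le_of_tendsto htend ?_
  filter_upwards [Ioo_mem_nhdsLT hθ1] with φ hφ using hlt φ hφ

/-- The surface measure of the unit sphere. -/
abbrev sphm (n : ℕ) : Measure (sphere (0 : EuclideanSpace ℝ (Fin n)) 1) :=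
  (volume : Measure (EuclideanSpace ℝ (Fin n))).toSphere

/-- The radial measure `ρ ^ (n - 1) dρ` on `(0, ∞)`. -/
def radm (n : ℕ) : Measure ℝ :=
  (volume.restrict (Set.Ioi (0:ℝ))).withDensity fun ρ => ENNReal.ofReal (ρ ^ (n - 1))

instance radm_sigmaFinite (n : ℕ) : SigmaFinite (radm n) :=
  SigmaFinite.withDensity_of_ne_top (ae_of_all _ fun _ => ENNReal.ofReal_ne_top)

lemma map_volumeIoiPow (n : ℕ) :
    Measure.map Subtype.val (Measure.volumeIoiPow (n - 1)) = radm n := by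
  have he : MeasurableEmbedding (Subtype.val : Set.Ioi (0:ℝ) → ℝ) :=
    MeasurableEmbedding.subtype_coe measurableSet_Ioi
  ext s hs
  rw [he.map_apply, Measure.volumeIoiPow, withDensity_apply _ (measurable_subtype_coe hs), radm,
    withDensity_apply _ hs]
  rw [← lintegral_indicator (measurable_subtype_coe hs), ← lintegral_indicator hs]
  rw [← lintegral_subtype_comap measurableSet_Ioi]
  rfl

/-- Polar coordinates. -/
lemma measurePreserving_polar {n : ℕ} (hn : 1 ≤ n) :
    MeasurePreserving (fun p : sphere (0 : EuclideanSpace ℝ (Fin n)) 1 × ℝ => p.2 • (p.1 : EuclideanSpace ℝ (Fin n)))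
      ((sphm n).prod (radm n)) volume := by
  have : Nonempty (Fin n) := ⟨⟨0, hn⟩⟩
  have hcont : Measurable (fun p : sphere (0 : EuclideanSpace ℝ (Fin n)) 1 × ℝ =>
      p.2 • (p.1 : EuclideanSpace ℝ (Fin n))) :=
    (continuous_snd.smul (continuous_subtype_val.comp continuous_fst)).measurable
  refine ⟨hcont, ?_⟩
  have h0 := (Measure.measurePreserving_homeomorphUnitSphereProd
    (volume : Measure (EuclideanSpace ℝ (Fin n))))
  have h1 := h0.symm (homeomorphUnitSphereProd (EuclideanSpace ℝ (Fin n))).toMeasurableEquiv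
  have hval : Measure.map (Subtype.val : ({0}ᶜ : Set (EuclideanSpace ℝ (Fin n))) → _)
      (Measure.comap Subtype.val volume) = volume := by
    rw [map_comap_subtype_coe (measurableSet_singleton _).compl, restrict_compl_singleton]
  rw [finrank_euclideanSpace_fin] at h1
  rw [← map_volumeIoiPow n, ← Measure.map_id (μ := sphm n),
    Measure.map_prod_map _ _ measurable_id measurable_subtype_coe,
    Measure.map_map hcont (measurable_id.prodMap measurable_subtype_coe)]
  conv_rhs => rw [← hval, ← h1.map_eq, Measure.map_map measurable_subtype_coe h1.measurable]
  rfl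

lemma integral_radm (n : ℕ) (g : ℝ → ℝ) :
    ∫ ρ, g ρ ∂(radm n) = ∫ ρ in Set.Ioi (0:ℝ), ρ ^ (n - 1) * g ρ := by
  have hm : Measurable fun ρ : ℝ => ENNReal.ofReal (ρ ^ (n - 1)) := by fun_prop
  rw [radm, integral_withDensity_eq_integral_toReal_smul hm (ae_of_all _ fun _ => ENNReal.ofReal_lt_top)]
  refine setIntegral_congr_fun measurableSet_Ioi fun ρ hρ => ?_
  rw [ENNReal.toReal_ofReal (pow_nonneg (le_of_lt hρ) _), smul_eq_mul]

lemma ae_radm_pos (n : ℕ) : ∀ᵐ ρ ∂(radm n), 0 < ρ :=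
  (withDensity_absolutelyContinuous _ _).ae_le (ae_restrict_mem measurableSet_Ioi)

lemma integral_polar {n : ℕ} (hn : 1 ≤ n) {f : EuclideanSpace ℝ (Fin n) → ℝ}
    (hf : AEStronglyMeasurable f) :
    ∫ x, f x = ∫ p : sphere (0 : EuclideanSpace ℝ (Fin n)) 1 × ℝ,
      f (p.2 • (p.1 : EuclideanSpace ℝ (Fin n))) ∂((sphm n).prod (radm n)) := by
  have h := measurePreserving_polar hn
  conv_lhs => rw [← h.map_eq]
  rw [integral_map h.measurable.aemeasurable (by rw [h.map_eq]; exact hf)]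

lemma integral_polar_mul {n : ℕ} (hn : 1 ≤ n) {f : EuclideanSpace ℝ (Fin n) → ℝ}
    (hf : AEStronglyMeasurable f) {a : sphere (0 : EuclideanSpace ℝ (Fin n)) 1 → ℝ} {b : ℝ → ℝ}
    (h : ∀ θ : sphere (0 : EuclideanSpace ℝ (Fin n)) 1, ∀ ρ : ℝ, 0 < ρ →
      f (ρ • (θ : EuclideanSpace ℝ (Fin n))) = a θ * b ρ) :
    ∫ x, f x = (∫ θ, a θ ∂(sphm n)) * ∫ ρ, b ρ ∂(radm n) := by
  rw [integral_polar hn hf, ← integral_prod_mul]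
  refine integral_congr_ae ?_
  have : ∀ᵐ p ∂((sphm n).prod (radm n)), 0 < p.2 :=
    Measure.quasiMeasurePreserving_snd.ae (ae_radm_pos n)
  filter_upwards [this] with p hp using h p.1 p.2 hp

lemma norm_smul_sphere {n : ℕ} (θ : sphere (0 : EuclideanSpace ℝ (Fin n)) 1) {ρ : ℝ} (hρ : 0 < ρ) :
    ‖ρ • (θ : EuclideanSpace ℝ (Fin n))‖ = ρ := by
  rw [norm_smul, norm_eq_of_mem_sphere, mul_one, Real.norm_of_nonneg hρ.le]

lemma integral_gmeas_mul {n : ℕ} (hn : 1 ≤ n) {f : EuclideanSpace ℝ (Fin n) → ℝ}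
    (hf : AEStronglyMeasurable f) {a : sphere (0 : EuclideanSpace ℝ (Fin n)) 1 → ℝ} {b : ℝ → ℝ}
    (h : ∀ θ : sphere (0 : EuclideanSpace ℝ (Fin n)) 1, ∀ ρ : ℝ, 0 < ρ →
      f (ρ • (θ : EuclideanSpace ℝ (Fin n))) = a θ * b ρ) :
    ∫ x, f x ∂(gmeas n) = (2 * Real.pi) ^ (-(n:ℝ) / 2) *
      ((∫ θ, a θ ∂(sphm n)) * ∫ ρ, Real.exp (-(1/2) * ρ ^ 2) * b ρ ∂(radm n)) := by
  rw [integral_gmeas, smul_eq_mul]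
  congr 1
  refine integral_polar_mul hn (AEStronglyMeasurable.mul ?_ hf) fun θ ρ hρ => ?_
  · exact (by fun_prop : Continuous fun x : EuclideanSpace ℝ (Fin n) =>
      Real.exp (-(1/2) * ‖x‖ ^ 2)).aestronglyMeasurable
  · rw [Pi.mul_apply, h θ ρ hρ, norm_smul_sphere θ hρ]; ring

/-- The Gaussian measure of a cone is the normalized surface measure of its base. -/
lemma gmeas_cone {n : ℕ} (hn : 1 ≤ n) {C : Set (EuclideanSpace ℝ (Fin n))} (hC : MeasurableSet C)
    {A : Set (sphere (0 : EuclideanSpace ℝ (Fin n)) 1)} (hA : MeasurableSet A)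
    (h : ∀ θ : sphere (0 : EuclideanSpace ℝ (Fin n)) 1, ∀ ρ : ℝ, 0 < ρ →
      (ρ • (θ : EuclideanSpace ℝ (Fin n)) ∈ C ↔ θ ∈ A)) :
    (gmeas n).real C = (sphm n).real A / (sphm n).real Set.univ := by
  have key : ∀ (C : Set (EuclideanSpace ℝ (Fin n))) (A : Set (sphere (0 : EuclideanSpace ℝ (Fin n)) 1)),
      MeasurableSet C → MeasurableSet A → (∀ θ : sphere (0 : EuclideanSpace ℝ (Fin n)) 1, ∀ ρ : ℝ, 0 < ρ →
      (ρ • (θ : EuclideanSpace ℝ (Fin n)) ∈ C ↔ θ ∈ A)) →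
      (gmeas n).real C = (2 * Real.pi) ^ (-(n:ℝ) / 2) *
      ((sphm n).real A * ∫ ρ, Real.exp (-(1/2) * ρ ^ 2) ∂(radm n)) := by
    intro C A hC hA h
    have := integral_gmeas_mul hn (f := C.indicator (fun _ => (1:ℝ))) (a := A.indicator (fun _ => (1:ℝ))) (b := fun _ => (1:ℝ))
      ((stronglyMeasurable_const.indicator hC).aestronglyMeasurable) (fun θ ρ hρ => by
        by_cases hθ : θ ∈ A
        · rw [Set.indicator_of_mem hθ, Set.indicator_of_mem ((h θ ρ hρ).2 hθ)]; simp
        · rw [Set.indicator_of_notMem hθ, Set.indicator_of_notMem (fun hh => hθ ((h θ ρ hρ).1 hh))]; simp)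
    simpa [integral_indicator hC, integral_indicator hA] using this
  have h1 := key Set.univ Set.univ MeasurableSet.univ MeasurableSet.univ (by simp)
  rw [probReal_univ] at h1
  have hne : (sphm n).real Set.univ ≠ 0 := by
    intro h0; rw [h0] at h1; simp at h1
  rw [key C A hC hA h, eq_div_iff hne]
  linear_combination -(sphm n).real A * h1

section polar_gradient

variable {E : Type*} [NormedAddCommGroup E] [InnerProductSpace ℝ E]

lemma hasFDerivAt_norm_polar {θ : E} (hθ : ‖θ‖ = 1) {ρ : ℝ} (hρ : 0 < ρ) :
    HasFDerivAt (fun x : E => ‖x‖) (innerSL ℝ θ) (ρ • θ) := by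
  have hnorm : ‖ρ • θ‖ = ρ := by rw [norm_smul, hθ, mul_one, Real.norm_of_nonneg hρ.le]
  have h1 : HasFDerivAt (fun x : E => ‖x‖ ^ 2) (2 • innerSL ℝ (ρ • θ)) (ρ • θ) :=
    (hasStrictFDerivAt_norm_sq _).hasFDerivAt
  have h2 := h1.sqrt (by rw [hnorm]; positivity)
  have h3 : (fun x : E => √(‖x‖ ^ 2)) = fun x => ‖x‖ := by
    ext x; exact Real.sqrt_sq (norm_nonneg x)
  rw [h3] at h2
  refine h2.congr_fderiv ?_
  ext h
  simp only [hnorm, Real.sqrt_sq hρ.le, inner_smul_left, smul_apply, innerSL_apply_apply,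
    nsmul_eq_mul, smul_eq_mul, conj_trivial]
  push_cast
  field_simp

variable [CompleteSpace E]

/-- Squared gradient of a product of a radial function and a `0`-homogeneous function. -/
lemma norm_gradient_polar_sq {θ : E} (hθ : ‖θ‖ = 1) {ρ : ℝ} (hρ : 0 < ρ)
    {g : ℝ → ℝ} {g' : ℝ} (hg : HasDerivAt g g' ρ) {w : E → ℝ} {r : ℝ}
    (hw : DifferentiableAt ℝ w (r • θ)) :
    ‖gradient (fun x => g ‖x‖ * w ((r / ‖x‖) • x)) (ρ • θ)‖ ^ 2 =
      w (r • θ) ^ 2 * g' ^ 2 + r ^ 2 * (‖gradient w (r • θ)‖ ^ 2 - ⟪gradient w (r • θ), θ⟫ ^ 2) *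
        (g ρ ^ 2 / ρ ^ 2) := by
  set p := gradient w (r • θ) with hp
  have hnorm : ‖ρ • θ‖ = ρ := by rw [norm_smul, hθ, mul_one, Real.norm_of_nonneg hρ.le]
  have hN := hasFDerivAt_norm_polar hθ hρ
  have hy0 : (r / ‖ρ • θ‖) • (ρ • θ) = r • θ := by
    rw [hnorm, smul_smul, div_mul_cancel₀ _ hρ.ne']
  have hy1 : (r / ρ) • (ρ • θ) = r • θ := by rw [smul_smul, div_mul_cancel₀ _ hρ.ne']
  have hw1 : HasFDerivAt w (innerSL ℝ p) ((r / ‖ρ • θ‖) • (ρ • θ)) := by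
    rw [hy0]
    exact hw.hasGradientAt.hasFDerivAt
  have hg1 : HasFDerivAt (fun x : E => g ‖x‖) (g' • innerSL ℝ θ) (ρ • θ) := by
    refine HasDerivAt.comp_hasFDerivAt (ρ • θ) ?_ hN
    rwa [hnorm]
  have hi : HasFDerivAt (fun x : E => r / ‖x‖) ((-(r / ρ ^ 2)) • innerSL ℝ θ) (ρ • θ) := by
    have : HasDerivAt (fun t : ℝ => r / t) (-(r / ρ ^ 2)) ‖ρ • θ‖ := by
      rw [hnorm]
      simpa [div_eq_mul_inv] using (hasDerivAt_inv hρ.ne').const_mul r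
    exact this.comp_hasFDerivAt (ρ • θ) hN
  have hy := hi.fun_smul (hasFDerivAt_id (𝕜 := ℝ) (ρ • θ))
  have hwy := HasFDerivAt.comp (f := fun x : E => (r / ‖x‖) • id x) (ρ • θ) hw1 hy
  have hF := hg1.mul hwy
  set G : E := (g' * w (r • θ)) • θ + (g ρ * r / ρ) • (p - ⟪p, θ⟫ • θ) with hG
  have hgr : gradient (fun x => g ‖x‖ * w ((r / ‖x‖) • x)) (ρ • θ) = G := by
    refine HasGradientAt.gradient ?_
    rw [hasGradientAt_iff_hasFDerivAt]
    refine hF.congr_fderiv ?_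
    ext h
    simp only [hG, InnerProductSpace.toDual_apply_apply, inner_add_left, inner_smul_left, inner_sub_left,
      add_apply, smul_apply, ContinuousLinearMap.comp_apply,
      innerSL_apply_apply, Function.comp_def, id, hnorm, hy1, ContinuousLinearMap.smulRight_apply,
      ContinuousLinearMap.id_apply, inner_add_right, inner_smul_right, smul_eq_mul, conj_trivial]
    field_simp
    ring
  have hθ2 : ⟪θ, θ⟫ = 1 := by rw [real_inner_self_eq_norm_sq, hθ, one_pow]
  rw [hgr, ← real_inner_self_eq_norm_sq, ← real_inner_self_eq_norm_sq]
  simp only [hG, inner_add_left, inner_add_right, inner_smul_left, inner_smul_right, inner_sub_left,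
    inner_sub_right, conj_trivial, hθ2, real_inner_comm θ p]
  field_simp
  ring

end polar_gradient

lemma integral_gmeas_mul_add {n : ℕ} (hn : 1 ≤ n) {f : EuclideanSpace ℝ (Fin n) → ℝ}
    (hf : AEStronglyMeasurable f) {a₁ a₂ : sphere (0 : EuclideanSpace ℝ (Fin n)) 1 → ℝ} {b₁ b₂ : ℝ → ℝ}
    (ha₁ : Integrable a₁ (sphm n)) (ha₂ : Integrable a₂ (sphm n))
    (hb₁ : Integrable (fun ρ => Real.exp (-(1/2) * ρ ^ 2) * b₁ ρ) (radm n))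
    (hb₂ : Integrable (fun ρ => Real.exp (-(1/2) * ρ ^ 2) * b₂ ρ) (radm n))
    (h : ∀ θ : sphere (0 : EuclideanSpace ℝ (Fin n)) 1, ∀ ρ : ℝ, 0 < ρ →
      f (ρ • (θ : EuclideanSpace ℝ (Fin n))) = a₁ θ * b₁ ρ + a₂ θ * b₂ ρ) :
    ∫ x, f x ∂(gmeas n) = (2 * Real.pi) ^ (-(n:ℝ) / 2) *
      ((∫ θ, a₁ θ ∂(sphm n)) * (∫ ρ, Real.exp (-(1/2) * ρ ^ 2) * b₁ ρ ∂(radm n)) +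
        (∫ θ, a₂ θ ∂(sphm n)) * ∫ ρ, Real.exp (-(1/2) * ρ ^ 2) * b₂ ρ ∂(radm n)) := by
  rw [integral_gmeas, smul_eq_mul]
  congr 1
  have hm : AEStronglyMeasurable (fun x => Real.exp (-(1/2) * ‖x‖ ^ 2) • f x) volume :=
    AEStronglyMeasurable.smul (by fun_prop : Continuous fun x : EuclideanSpace ℝ (Fin n) =>
      Real.exp (-(1/2) * ‖x‖ ^ 2)).aestronglyMeasurable hf
  rw [integral_polar hn hm, ← integral_prod_mul, ← integral_prod_mul,
    ← integral_add (ha₁.mul_prod hb₁) (ha₂.mul_prod hb₂)]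
  refine integral_congr_ae ?_
  have : ∀ᵐ p ∂((sphm n).prod (radm n)), 0 < p.2 :=
    Measure.quasiMeasurePreserving_snd.ae (ae_radm_pos n)
  filter_upwards [this] with p hp
  rw [h p.1 p.2 hp, norm_smul_sphere p.1 hp, smul_eq_mul]; ring

lemma contDiff_polar {n : ℕ} {g : ℝ → ℝ} (hg : ContDiffOn ℝ 1 g (Set.Ioi 0)) {ε : ℝ} (hε : 0 < ε)
    (hg0 : ∀ ρ, 0 ≤ ρ → ρ < ε → g ρ = 0) {w : EuclideanSpace ℝ (Fin n) → ℝ} (hw : ContDiff ℝ 1 w)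
    (r : ℝ) : ContDiff ℝ 1 (fun x => g ‖x‖ * w ((r / ‖x‖) • x)) := by
  rw [contDiff_iff_contDiffAt]
  intro x
  by_cases hx : x = 0
  · subst hx
    refine (contDiffAt_const (c := (0:ℝ))).congr_of_eventuallyEq ?_
    filter_upwards [ball_mem_nhds (0 : EuclideanSpace ℝ (Fin n)) hε] with y hy
    rw [hg0 _ (norm_nonneg _) (by simpa using hy), zero_mul]
  · have hn : 0 < ‖x‖ := norm_pos_iff.2 hx
    have h1 : ContDiffAt ℝ 1 (fun y : EuclideanSpace ℝ (Fin n) => ‖y‖) x := contDiffAt_norm ℝ hx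
    have h2 : ContDiffAt ℝ 1 g ‖x‖ := hg.contDiffAt (Ioi_mem_nhds hn)
    refine (h2.comp x h1).mul ?_
    refine ContDiffAt.comp x (g := w) hw.contDiffAt ?_
    exact (contDiffAt_const.div h1 hn.ne').smul contDiffAt_id

lemma hasCompactSupport_polar {n : ℕ} {g : ℝ → ℝ} {R : ℝ} (hgR : ∀ ρ, R < ρ → g ρ = 0)
    {W : EuclideanSpace ℝ (Fin n) → ℝ} :
    HasCompactSupport (fun x : EuclideanSpace ℝ (Fin n) => g ‖x‖ * W x) := by
  refine HasCompactSupport.of_support_subset_isCompact (isCompact_closedBall 0 R) ?_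
  intro x hx
  rw [mem_closedBall_zero_iff]
  by_contra! h
  exact hx (by simp [hgR _ h])

/-- The squared length of the gradient on the unit sphere of `θ ↦ w (r • θ)`. -/
def tanSq {n : ℕ} (w : EuclideanSpace ℝ (Fin n) → ℝ) (r : ℝ) (θ : EuclideanSpace ℝ (Fin n)) : ℝ :=
  r ^ 2 * (‖gradient w (r • θ)‖ ^ 2 - ⟪gradient w (r • θ), θ⟫ ^ 2)

lemma tanSq_nonneg {n : ℕ} (w : EuclideanSpace ℝ (Fin n) → ℝ) (r : ℝ)
    (θ : sphere (0 : EuclideanSpace ℝ (Fin n)) 1) : 0 ≤ tanSq w r θ := by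
  refine mul_nonneg (sq_nonneg _) (sub_nonneg.2 ?_)
  have := abs_real_inner_le_norm (gradient w (r • (θ : EuclideanSpace ℝ (Fin n)))) θ
  rw [norm_eq_of_mem_sphere, mul_one] at this
  exact sq_le_sq' (by linarith [neg_abs_le (⟪gradient w (r • (θ : EuclideanSpace ℝ (Fin n))), (θ : EuclideanSpace ℝ (Fin n))⟫)]) (le_of_abs_le this)

lemma continuous_tanSq {n : ℕ} {w : EuclideanSpace ℝ (Fin n) → ℝ} (hw : ContDiff ℝ 1 w) (r : ℝ) :
    Continuous fun θ => tanSq w r θ := by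
  unfold tanSq
  have := continuous_gradient hw
  fun_prop

lemma integrable_sphm {n : ℕ} {a : EuclideanSpace ℝ (Fin n) → ℝ} (ha : Continuous a) :
    Integrable (fun θ : sphere (0 : EuclideanSpace ℝ (Fin n)) 1 => a θ) (sphm n) :=
  (ha.comp continuous_subtype_val).integrable_of_hasCompactSupport
    (HasCompactSupport.of_compactSpace _)

lemma sphere_faber_krahn_test {n : ℕ} (hn : 1 ≤ n) {w : EuclideanSpace ℝ (Fin n) → ℝ}
    (hw : ContDiff ℝ 1 w) (hw0 : ∀ x, 0 ≤ w x) {r : ℝ} {θ₀ : ℝ} (hθ₀ : θ₀ ∈ Set.Icc (-1:ℝ) 1)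
    (hb : (sphm n).real {θ | 0 < w (r • (θ : EuclideanSpace ℝ (Fin n)))} / (sphm n).real Set.univ
      ≤ gcdf (-(kap * θ₀)))
    {g g' : ℝ → ℝ} (hg : ContDiffOn ℝ 1 g (Set.Ioi 0)) (hg' : ∀ ρ, 0 < ρ → HasDerivAt g (g' ρ) ρ)
    (hgn : ∀ ρ, 0 ≤ ρ → 0 ≤ g ρ) {ε R : ℝ} (hε : 0 < ε) (hg0 : ∀ ρ, 0 ≤ ρ → ρ < ε → g ρ = 0)
    (hgR : ∀ ρ, R < ρ → g ρ = 0)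
    (hb₁ : Integrable (fun ρ => Real.exp (-(1/2) * ρ ^ 2) * g' ρ ^ 2) (radm n))
    (hb₂ : Integrable (fun ρ => Real.exp (-(1/2) * ρ ^ 2) * (g ρ ^ 2 / ρ ^ 2)) (radm n)) :
    (1 + θ₀) * ((∫ θ : sphere (0 : EuclideanSpace ℝ (Fin n)) 1, w (r • (θ : EuclideanSpace ℝ (Fin n))) ^ 2 ∂(sphm n)) *
        ∫ ρ, Real.exp (-(1/2) * ρ ^ 2) * g ρ ^ 2 ∂(radm n)) ≤
      (∫ θ : sphere (0 : EuclideanSpace ℝ (Fin n)) 1, w (r • (θ : EuclideanSpace ℝ (Fin n))) ^ 2 ∂(sphm n)) *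
        (∫ ρ, Real.exp (-(1/2) * ρ ^ 2) * g' ρ ^ 2 ∂(radm n)) +
      (∫ θ : sphere (0 : EuclideanSpace ℝ (Fin n)) 1, tanSq w r θ ∂(sphm n)) *
        ∫ ρ, Real.exp (-(1/2) * ρ ^ 2) * (g ρ ^ 2 / ρ ^ 2) ∂(radm n) := by
  have := gmeas_isProb n
  set F : EuclideanSpace ℝ (Fin n) → ℝ := fun x => g ‖x‖ * w ((r / ‖x‖) • x) with hFdef
  have hF : ContDiff ℝ 1 F := contDiff_polar hg hε hg0 hw r
  have hFc : HasCompactSupport F := hasCompactSupport_polar hgR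
  have hF0 : ∀ x, 0 ≤ F x := fun x => mul_nonneg (hgn _ (norm_nonneg _)) (hw0 _)
  have hcw : Continuous fun θ : EuclideanSpace ℝ (Fin n) => w (r • θ) := hw.continuous.comp (by fun_prop)
  have hpt : ∀ θ : sphere (0 : EuclideanSpace ℝ (Fin n)) 1, ∀ ρ : ℝ, 0 < ρ →
      (r / ‖ρ • (θ : EuclideanSpace ℝ (Fin n))‖) • (ρ • (θ : EuclideanSpace ℝ (Fin n))) = r • (θ : EuclideanSpace ℝ (Fin n)) := by
    intro θ ρ hρ
    rw [norm_smul_sphere θ hρ, smul_smul, div_mul_cancel₀ _ hρ.ne']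
  set A : Set (sphere (0 : EuclideanSpace ℝ (Fin n)) 1) := {θ | 0 < w (r • (θ : EuclideanSpace ℝ (Fin n)))} with hA
  have hAm : MeasurableSet A :=
    (isOpen_lt continuous_const (hcw.comp continuous_subtype_val)).measurableSet
  have hCm : MeasurableSet {x : EuclideanSpace ℝ (Fin n) | 0 < w ((r / ‖x‖) • x)} := by
    refine measurableSet_lt measurable_const (hw.continuous.measurable.comp ?_)
    exact (measurable_const.div measurable_norm).smul measurable_id
  have hcone := gmeas_cone hn hCm hAm (fun θ ρ hρ => by
    rw [Set.mem_ofPred_eq, hpt θ ρ hρ]; rfl)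
  have hbF : (gmeas n).real {x | 0 < F x} ≤ gcdf (-(kap * θ₀)) := by
    refine le_trans ?_ (hcone.le.trans hb)
    refine measureReal_mono ?_
    intro x hx
    have hx' : 0 < g ‖x‖ * w ((r / ‖x‖) • x) := hx
    rw [Set.mem_ofPred_eq]
    exact lt_of_le_of_ne (hw0 _) (fun h => by rw [← h, mul_zero] at hx'; exact lt_irrefl _ hx')
  have hgm : IsFiniteMeasure (gmeas n) := inferInstance
  have hmain := gaussian_faber_krahn hF hFc hF0 hθ₀ hbF
  have hgc := continuous_gradient hF
  have hgcs := hasCompactSupport_gradient hFc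
  have i1 : Integrable (fun x => F x ^ 2) (gmeas n) :=
    (hF.continuous.pow 2).integrable_of_hasCompactSupport (by
      have := hFc.comp_left (g := fun t : ℝ => t ^ 2) (by simp)
      exact this)
  have i2 : Integrable (fun x => ‖gradient F x‖ ^ 2) (gmeas n) :=
    (hgc.norm.pow 2).integrable_of_hasCompactSupport (by
      have := hgcs.comp_left (g := fun t : EuclideanSpace ℝ (Fin n) => ‖t‖ ^ 2) (by simp)
      exact this)
  rw [← ofReal_integral_eq_lintegral_ofReal i1 (ae_of_all _ fun x => sq_nonneg _),
    ← ofReal_integral_eq_lintegral_ofReal i2 (ae_of_all _ fun x => sq_nonneg _),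
    ← ENNReal.ofReal_mul (by linarith [hθ₀.1]),
    ENNReal.ofReal_le_ofReal_iff (integral_nonneg fun x => sq_nonneg _)] at hmain
  rw [integral_gmeas_mul hn (f := fun x => F x ^ 2) (hF.continuous.pow 2).aestronglyMeasurable
      (a := fun θ => w (r • (θ : EuclideanSpace ℝ (Fin n))) ^ 2) (b := fun ρ => g ρ ^ 2)
      (fun θ ρ hρ => by
        simp only [hFdef]
        rw [hpt θ ρ hρ, norm_smul_sphere θ hρ]; ring),
    integral_gmeas_mul_add hn (f := fun x => ‖gradient F x‖ ^ 2) (hgc.norm.pow 2).aestronglyMeasurable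
      (a₁ := fun θ => w (r • (θ : EuclideanSpace ℝ (Fin n))) ^ 2) (b₁ := fun ρ => g' ρ ^ 2)
      (a₂ := fun θ => tanSq w r θ) (b₂ := fun ρ => g ρ ^ 2 / ρ ^ 2)
      (integrable_sphm (hcw.pow 2)) (integrable_sphm (continuous_tanSq hw r)) hb₁ hb₂
      (fun θ ρ hρ => by
        simp only [hFdef, tanSq]
        exact norm_gradient_polar_sq (norm_eq_of_mem_sphere θ) hρ (hg' ρ hρ)
          (hw.differentiable one_ne_zero _))] at hmain
  have hc : 0 < (2 * Real.pi) ^ (-(n:ℝ) / 2) := by positivity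
  rw [mul_left_comm] at hmain
  exact le_of_mul_le_mul_left hmain hc

lemma integrable_radm_iff (n : ℕ) (g : ℝ → ℝ) :
    Integrable g (radm n) ↔ IntegrableOn (fun ρ => ρ ^ (n - 1) * g ρ) (Set.Ioi (0:ℝ)) := by
  have hm : Measurable fun ρ : ℝ => ENNReal.ofReal (ρ ^ (n - 1)) := by fun_prop
  rw [radm, integrable_withDensity_iff_integrable_smul' hm (ae_of_all _ fun _ => ENNReal.ofReal_lt_top)]
  refine integrableOn_congr_fun (fun ρ hρ => ?_) measurableSet_Ioi
  rw [ENNReal.toReal_ofReal (pow_nonneg (le_of_lt hρ) _), smul_eq_mul]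

/-- Gaussian radial moments. -/
def gmom (n : ℕ) (q : ℝ) : ℝ := ∫ ρ, Real.exp (-(1/2) * ρ ^ 2) * ρ ^ q ∂(radm n)

lemma gmom_congr {n : ℕ} (hn : 1 ≤ n) (q : ℝ) {ρ : ℝ} (hρ : 0 < ρ) :
    ρ ^ (n - 1) * (Real.exp (-(1/2) * ρ ^ 2) * ρ ^ q) =
      ρ ^ ((n:ℝ) - 1 + q) * Real.exp (-(1/2) * ρ ^ (2:ℝ)) := by
  rw [Real.rpow_add hρ, ← Real.rpow_natCast ρ (n - 1), Nat.cast_sub hn, Real.rpow_two]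
  push_cast; ring

lemma integrable_gmom {n : ℕ} (hn : 1 ≤ n) {q : ℝ} (hq : 0 < n + q) :
    Integrable (fun ρ => Real.exp (-(1/2) * ρ ^ 2) * ρ ^ q) (radm n) := by
  rw [integrable_radm_iff]
  have := integrableOn_rpow_mul_exp_neg_mul_rpow (p := 2) (s := (n:ℝ) - 1 + q) (b := 1/2) (by linarith) (by norm_num) (by norm_num)
  refine this.congr_fun (fun ρ hρ => ?_) measurableSet_Ioi
  exact (gmom_congr hn q hρ).symm

lemma gmom_eq {n : ℕ} (hn : 1 ≤ n) {q : ℝ} (hq : 0 < n + q) :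
    gmom n q = (1/2:ℝ) ^ (-(n + q) / 2) * (1 / 2) * Real.Gamma ((n + q) / 2) := by
  rw [gmom, integral_radm]
  rw [setIntegral_congr_fun measurableSet_Ioi (fun ρ hρ => gmom_congr hn q hρ),
    integral_rpow_mul_exp_neg_mul_rpow (by norm_num) (by linarith) (by norm_num)]
  ring_nf

lemma gmom_pos {n : ℕ} (hn : 1 ≤ n) {q : ℝ} (hq : 0 < n + q) : 0 < gmom n q := by
  rw [gmom_eq hn hq]
  have := Real.Gamma_pos_of_pos (half_pos hq)
  positivity

lemma gmom_add_two {n : ℕ} (hn : 1 ≤ n) {q : ℝ} (hq : 0 < n + q) :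
    gmom n (q + 2) = (n + q) * gmom n q := by
  rw [gmom_eq hn hq, gmom_eq hn (by linarith)]
  have h1 : ((n:ℝ) + (q + 2)) / 2 = (n + q) / 2 + 1 := by ring
  have h2 : -((n:ℝ) + (q + 2)) / 2 = -(n + q) / 2 + (-1) := by ring
  rw [h1, h2, Real.Gamma_add_one (by positivity), Real.rpow_add (by norm_num), Real.rpow_neg_one]
  ring

/-- A plateau function on `ℝ`. -/
lemma exists_plateau : ∃ ψ : ℝ → ℝ, ContDiff ℝ 1 ψ ∧ (∀ x, 0 ≤ ψ x) ∧ (∀ x, ψ x ≤ 1) ∧ ψ 0 = 1 ∧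
    (∀ x, 2 ≤ |x| → ψ x = 0) ∧ ∃ M, ∀ x, |deriv ψ x| ≤ M := by
  let ψ : ContDiffBump (0:ℝ) := ⟨1, 2, one_pos, by norm_num⟩
  have hψ : ContDiff ℝ 1 ψ := ψ.contDiff
  refine ⟨ψ, hψ, fun x => ψ.nonneg, fun x => ψ.le_one, ψ.one_of_mem_closedBall (by simp [ψ]),
    fun x hx => ψ.zero_of_le_dist (by simpa [ψ, Real.dist_eq] using hx), ?_⟩
  obtain ⟨M, hM⟩ := (ψ.hasCompactSupport.deriv).exists_bound_of_continuous (hψ.continuous_deriv le_rfl)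
  exact ⟨M, hM⟩

open Filter Topology in
/-- The Faber–Krahn inequality on the sphere. -/
lemma sphere_faber_krahn {n : ℕ} (hn : 2 ≤ n) {w : EuclideanSpace ℝ (Fin n) → ℝ}
    (hw : ContDiff ℝ 1 w) (hw0 : ∀ x, 0 ≤ w x) {r : ℝ} {θ₀ : ℝ} (hθ₀ : θ₀ ∈ Set.Icc (-1:ℝ) 1)
    (hb : (sphm n).real {θ | 0 < w (r • (θ : EuclideanSpace ℝ (Fin n)))} / (sphm n).real Set.univ
      ≤ gcdf (-(kap * θ₀))) :
    (1 + θ₀) * (1 + θ₀ + n - 2) *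
        ∫ θ : sphere (0 : EuclideanSpace ℝ (Fin n)) 1, w (r • (θ : EuclideanSpace ℝ (Fin n))) ^ 2 ∂(sphm n) ≤
      ∫ θ : sphere (0 : EuclideanSpace ℝ (Fin n)) 1, tanSq w r θ ∂(sphm n) := by
  have hn1 : 1 ≤ n := by omega
  have hn2 : (2:ℝ) ≤ n := by exact_mod_cast hn
  have hD : 0 ≤ ∫ θ : sphere (0 : EuclideanSpace ℝ (Fin n)) 1, tanSq w r θ ∂(sphm n) :=
    integral_nonneg fun θ => tanSq_nonneg w r θ
  set A := ∫ θ : sphere (0 : EuclideanSpace ℝ (Fin n)) 1, w (r • (θ : EuclideanSpace ℝ (Fin n))) ^ 2 ∂(sphm n) with hA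
  set D := ∫ θ : sphere (0 : EuclideanSpace ℝ (Fin n)) 1, tanSq w r θ ∂(sphm n) with hDdef
  set τ := 1 + θ₀ with hτ
  rcases (show 0 ≤ τ by linarith [hθ₀.1]).eq_or_lt with h0 | hτ0
  · rw [← h0]; simpa using hD
  obtain ⟨ψ, hψ, hψ0, hψ1, hψz, hψs, M, hM⟩ := exists_plateau
  have hM0 : 0 ≤ M := (abs_nonneg _).trans (hM 0)
  have hcψ := hψ.continuous
  have hcψ' : Continuous (deriv ψ) := hψ.continuous_deriv le_rfl
  let g : ℕ → ℝ → ℝ := fun k ρ => ρ ^ τ * ψ (Real.log ρ / (k + 1))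
  let g' : ℕ → ℝ → ℝ := fun k ρ => ρ ^ (τ - 1) * (τ * ψ (Real.log ρ / (k + 1)) + deriv ψ (Real.log ρ / (k + 1)) / (k + 1))
  have hk0 : ∀ k : ℕ, (0:ℝ) < k + 1 := fun k => by positivity
  have hgm : ∀ k, Measurable (g k) := fun k => by
    have h1 : Measurable fun ρ : ℝ => ψ (Real.log ρ / (k + 1)) :=
      hcψ.measurable.comp (Real.measurable_log.div_const _)
    exact (measurable_id.pow_const τ).mul h1
  have hgm' : ∀ k, Measurable (g' k) := fun k => by
    have h1 : Measurable fun ρ : ℝ => ψ (Real.log ρ / (k + 1)) :=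
      hcψ.measurable.comp (Real.measurable_log.div_const _)
    have h2 : Measurable fun ρ : ℝ => deriv ψ (Real.log ρ / (k + 1)) :=
      hcψ'.measurable.comp (Real.measurable_log.div_const _)
    exact (measurable_id.pow_const (τ - 1)).mul ((h1.const_mul τ).add (h2.div_const _))
  have hexp : Measurable fun ρ : ℝ => Real.exp (-(1/2) * ρ ^ 2) := by fun_prop
  -- pointwise bounds
  have hsq : ∀ (p : ℝ) {ρ : ℝ}, 0 < ρ → (ρ ^ p) ^ 2 = ρ ^ (2 * p) := fun p ρ hρ => by
    rw [← Real.rpow_two, ← Real.rpow_mul hρ.le, mul_comm]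
  have hsq1 : ∀ {ρ : ℝ}, 0 < ρ → (ρ ^ τ) ^ 2 / ρ ^ 2 = ρ ^ (2 * τ - 2) := fun {ρ} hρ => by
    rw [hsq _ hρ, Real.rpow_sub hρ, Real.rpow_two]
  have hsq2 : ∀ {ρ : ℝ}, 0 < ρ → (ρ ^ (τ - 1)) ^ 2 = ρ ^ (2 * τ - 2) := fun {ρ} hρ => by
    rw [hsq _ hρ]; congr 1; ring
  have hψsq : ∀ x, ψ x ^ 2 ≤ 1 := fun x => by
    rw [sq_le_one_iff₀ (hψ0 x)]; exact hψ1 x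
  have bd0 : ∀ k, ∀ ρ : ℝ, 0 < ρ → ‖Real.exp (-(1/2) * ρ ^ 2) * g k ρ ^ 2‖ ≤ Real.exp (-(1/2) * ρ ^ 2) * ρ ^ (2 * τ) := by
    intro k ρ hρ
    rw [Real.norm_of_nonneg (by positivity)]
    refine mul_le_mul_of_nonneg_left ?_ (Real.exp_pos _).le
    simp only [g]
    rw [mul_pow, hsq _ hρ]
    exact mul_le_of_le_one_right (by positivity) (hψsq _)
  have bd2 : ∀ k, ∀ ρ : ℝ, 0 < ρ → ‖Real.exp (-(1/2) * ρ ^ 2) * (g k ρ ^ 2 / ρ ^ 2)‖ ≤ Real.exp (-(1/2) * ρ ^ 2) * ρ ^ (2 * τ - 2) := by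
    intro k ρ hρ
    rw [Real.norm_of_nonneg (by positivity)]
    refine mul_le_mul_of_nonneg_left ?_ (Real.exp_pos _).le
    simp only [g]
    rw [mul_pow, mul_div_right_comm, hsq1 hρ]
    exact mul_le_of_le_one_right (by positivity) (hψsq _)
  have bd1 : ∀ k, ∀ ρ : ℝ, 0 < ρ → ‖Real.exp (-(1/2) * ρ ^ 2) * g' k ρ ^ 2‖ ≤ (τ + M) ^ 2 * (Real.exp (-(1/2) * ρ ^ 2) * ρ ^ (2 * τ - 2)) := by
    intro k ρ hρ
    rw [Real.norm_of_nonneg (by positivity), mul_left_comm]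
    refine mul_le_mul_of_nonneg_left ?_ (Real.exp_pos _).le
    simp only [g']
    rw [mul_pow, hsq2 hρ, mul_comm]
    refine mul_le_mul_of_nonneg_right ?_ (by positivity)
    rw [sq_le_sq, abs_of_nonneg (by positivity : 0 ≤ τ + M)]
    refine (abs_add_le _ _).trans (add_le_add ?_ ?_)
    · rw [abs_mul, abs_of_pos hτ0, abs_of_nonneg (hψ0 _)]
      exact mul_le_of_le_one_right hτ0.le (hψ1 _)
    · rw [abs_div, abs_of_pos (hk0 k)]
      exact (div_le_self (abs_nonneg _) (by linarith [(Nat.cast_nonneg k : (0:ℝ) ≤ k)])).trans (hM _)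
  have I0 : Integrable (fun ρ => Real.exp (-(1/2) * ρ ^ 2) * ρ ^ (2 * τ)) (radm n) := integrable_gmom hn1 (by positivity)
  have I2 : Integrable (fun ρ => Real.exp (-(1/2) * ρ ^ 2) * ρ ^ (2 * τ - 2)) (radm n) := integrable_gmom hn1 (by linarith)
  have ae := ae_radm_pos n
  have m0 : ∀ k, AEStronglyMeasurable (fun ρ => Real.exp (-(1/2) * ρ ^ 2) * g k ρ ^ 2) (radm n) := fun k =>
    (hexp.mul ((hgm k).pow_const 2)).aestronglyMeasurable
  have m1 : ∀ k, AEStronglyMeasurable (fun ρ => Real.exp (-(1/2) * ρ ^ 2) * g' k ρ ^ 2) (radm n) := fun k =>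
    (hexp.mul ((hgm' k).pow_const 2)).aestronglyMeasurable
  have m2 : ∀ k, AEStronglyMeasurable (fun ρ => Real.exp (-(1/2) * ρ ^ 2) * (g k ρ ^ 2 / ρ ^ 2)) (radm n) := fun k =>
    (hexp.mul (((hgm k).pow_const 2).div (measurable_id.pow_const 2))).aestronglyMeasurable
  have hlim : ∀ ρ : ℝ, Tendsto (fun k : ℕ => Real.log ρ / ((k:ℝ) + 1)) atTop (𝓝 0) := fun ρ => by
    have := (tendsto_one_div_add_atTop_nhds_zero_nat (𝕜 := ℝ)).const_mul (Real.log ρ)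
    simpa only [mul_one_div, mul_zero] using this
  have l1 : ∀ ρ, Tendsto (fun k : ℕ => ψ (Real.log ρ / ((k:ℝ) + 1))) atTop (𝓝 1) := fun ρ => by
    have := (hcψ.tendsto 0).comp (hlim ρ)
    rwa [hψz] at this
  have l2 : ∀ ρ, Tendsto (fun k : ℕ => deriv ψ (Real.log ρ / ((k:ℝ) + 1)) / ((k:ℝ) + 1)) atTop (𝓝 0) := fun ρ => by
    have := ((hcψ'.tendsto 0).comp (hlim ρ)).mul (tendsto_one_div_add_atTop_nhds_zero_nat (𝕜 := ℝ))
    simpa only [mul_one_div, mul_zero, Function.comp_def] using this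
  have T0 := tendsto_integral_of_dominated_convergence (F := fun k ρ => Real.exp (-(1/2) * ρ ^ 2) * g k ρ ^ 2)
    (f := fun ρ => Real.exp (-(1/2) * ρ ^ 2) * ρ ^ (2 * τ)) _ m0 I0
    (fun k => by filter_upwards [ae] with ρ hρ using bd0 k ρ hρ)
    (by filter_upwards [ae] with ρ hρ
        have := (((l1 ρ).const_mul (ρ ^ τ)).pow 2).const_mul (Real.exp (-(1/2) * ρ ^ 2))
        rwa [mul_one, hsq _ hρ] at this)
  have T2 := tendsto_integral_of_dominated_convergence (F := fun k ρ => Real.exp (-(1/2) * ρ ^ 2) * (g k ρ ^ 2 / ρ ^ 2))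
    (f := fun ρ => Real.exp (-(1/2) * ρ ^ 2) * ρ ^ (2 * τ - 2)) _ m2 I2
    (fun k => by filter_upwards [ae] with ρ hρ using bd2 k ρ hρ)
    (by filter_upwards [ae] with ρ hρ
        have := ((((l1 ρ).const_mul (ρ ^ τ)).pow 2).div_const (ρ ^ 2)).const_mul (Real.exp (-(1/2) * ρ ^ 2))
        rwa [mul_one, hsq1 hρ] at this)
  have T1 := tendsto_integral_of_dominated_convergence (F := fun k ρ => Real.exp (-(1/2) * ρ ^ 2) * g' k ρ ^ 2)
    (f := fun ρ => τ ^ 2 * (Real.exp (-(1/2) * ρ ^ 2) * ρ ^ (2 * τ - 2))) _ m1 (I2.const_mul _)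
    (fun k => by filter_upwards [ae] with ρ hρ using bd1 k ρ hρ)
    (by filter_upwards [ae] with ρ hρ
        have := (((((l1 ρ).const_mul τ).add (l2 ρ)).const_mul (ρ ^ (τ - 1))).pow 2).const_mul (Real.exp (-(1/2) * ρ ^ 2))
        rw [mul_one, add_zero, mul_pow, hsq2 hρ] at this
        convert this using 2; ring)
  rw [integral_const_mul] at T1
  have key : ∀ k, τ * (A * ∫ ρ, Real.exp (-(1/2) * ρ ^ 2) * g k ρ ^ 2 ∂(radm n)) ≤
      A * (∫ ρ, Real.exp (-(1/2) * ρ ^ 2) * g' k ρ ^ 2 ∂(radm n)) +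
      D * ∫ ρ, Real.exp (-(1/2) * ρ ^ 2) * (g k ρ ^ 2 / ρ ^ 2) ∂(radm n) := by
    intro k
    have hlogsmall : ∀ ρ : ℝ, 0 < ρ → ρ < Real.exp (-(2 * (k + 1))) → ψ (Real.log ρ / (k + 1)) = 0 := by
      intro ρ hρ h
      refine hψs _ ?_
      have := (Real.log_lt_iff_lt_exp hρ).2 h
      rw [abs_div, abs_of_pos (hk0 k), le_div_iff₀ (hk0 k), le_abs]
      right; linarith
    refine sphere_faber_krahn_test hn1 hw hw0 hθ₀ hb (g := g k) (g' := g' k) ?_ ?_ ?_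
      (ε := Real.exp (-(2 * (k + 1)))) (R := Real.exp (2 * (k + 1))) (Real.exp_pos _) ?_ ?_ ?_ ?_
    · refine ContDiffOn.mul (fun ρ hρ => ?_) (hψ.comp_contDiffOn ?_)
      · exact (Real.contDiffAt_rpow_const_of_ne (ne_of_gt hρ)).contDiffWithinAt
      · exact (ContDiffOn.log contDiffOn_id fun ρ hρ => ne_of_gt hρ).div_const _
    · intro ρ hρ
      have h1 := Real.hasDerivAt_rpow_const (x := ρ) (p := τ) (Or.inl hρ.ne')
      have h2 : HasDerivAt (fun ρ => ψ (Real.log ρ / (k + 1))) (deriv ψ (Real.log ρ / (k + 1)) * (ρ⁻¹ / (k + 1))) ρ :=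
        HasDerivAt.comp (h₂ := ψ) ρ (hψ.differentiable one_ne_zero _).hasDerivAt ((Real.hasDerivAt_log hρ.ne').div_const _)
      refine (h1.mul h2).congr_deriv ?_
      simp only [g']
      rw [Real.rpow_sub_one hρ.ne']
      field_simp
    · intro ρ hρ
      exact mul_nonneg (Real.rpow_nonneg hρ _) (hψ0 _)
    · intro ρ hρ h
      simp only [g]
      rcases hρ.eq_or_lt with h0 | h0
      · rw [← h0, Real.zero_rpow hτ0.ne', zero_mul]
      · rw [hlogsmall ρ h0 h, mul_zero]
    · intro ρ h
      have hρ : 0 < ρ := (Real.exp_pos _).trans h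
      simp only [g]
      rw [hψs, mul_zero]
      have := (Real.lt_log_iff_exp_lt hρ).2 h
      rw [abs_div, abs_of_pos (hk0 k), le_div_iff₀ (hk0 k), le_abs]
      left; exact this.le
    · exact (I2.const_mul _).mono' (m1 k) (by filter_upwards [ae] with ρ hρ using bd1 k ρ hρ)
    · exact I2.mono' (m2 k) (by filter_upwards [ae] with ρ hρ using bd2 k ρ hρ)
  have hl := le_of_tendsto_of_tendsto' ((T0.const_mul A).const_mul τ) ((T1.const_mul A).add (T2.const_mul D)) key
  have e2 := gmom_add_two hn1 (q := 2 * τ - 2) (by linarith)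
  rw [sub_add_cancel] at e2
  have hp := gmom_pos hn1 (q := 2 * τ - 2) (by linarith)
  change τ * (A * gmom n (2 * τ)) ≤ A * (τ ^ 2 * gmom n (2 * τ - 2)) + D * gmom n (2 * τ - 2) at hl
  rw [e2] at hl
  refine le_of_mul_le_mul_right ?_ hp
  linarith [hl, show τ * (τ + n - 2) * A * gmom n (2 * τ - 2) = τ * (A * ((n + (2 * τ - 2)) * gmom n (2 * τ - 2))) - A * (τ ^ 2 * gmom n (2 * τ - 2)) by ring]

/-- The root of `t * (t + n - 2) = Λ`. -/
def gam (n : ℕ) (Λ : ℝ) : ℝ := √(((n:ℝ) - 2) ^ 2 / 4 + Λ) - ((n:ℝ) - 2) / 2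

lemma gam_mul {n : ℕ} {Λ : ℝ} (hΛ : 0 ≤ Λ) : gam n Λ * (gam n Λ + n - 2) = Λ := by
  have h := Real.sq_sqrt (show 0 ≤ ((n:ℝ) - 2) ^ 2 / 4 + Λ by positivity)
  unfold gam
  linear_combination h

lemma le_gam {n : ℕ} (hn : 2 ≤ n) {Λ t : ℝ} (h : t * (t + n - 2) ≤ Λ) : t ≤ gam n Λ := by
  have hn2 : (2:ℝ) ≤ n := by exact_mod_cast hn
  unfold gam
  rw [le_sub_iff_add_le]
  refine Real.le_sqrt_of_sq_le ?_
  nlinarith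

lemma gam_nonneg {n : ℕ} (hn : 2 ≤ n) {Λ : ℝ} (hΛ : 0 ≤ Λ) : 0 ≤ gam n Λ :=
  le_gam hn (by simpa using hΛ)

/-- A `C¹` truncation below the level `ε`. -/
lemma exists_trunc {ε : ℝ} (hε : 0 < ε) : ∃ χ : ℝ → ℝ, ContDiff ℝ 1 χ ∧ (∀ t, 0 ≤ χ t) ∧
    (∀ t, t ≤ ε → χ t = 0) ∧ (∀ t, t - 2 * ε ≤ χ t) ∧ ∀ t, |deriv χ t| ≤ 1 := by
  let k : ℝ → ℝ := fun x => min (max ((x - ε) / ε) 0) 1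
  have hk : Continuous k := by fun_prop
  have hk0 : ∀ x, 0 ≤ k x := fun x => le_min (le_max_right _ _) zero_le_one
  have hkz : ∀ x, x ≤ ε → k x = 0 := fun x hx => by
    simp only [k]
    rw [max_eq_right (div_nonpos_of_nonpos_of_nonneg (by linarith) hε.le)]; simp
  have hk1 : ∀ x, 2 * ε ≤ x → k x = 1 := fun x hx => by
    simp only [k]
    have : 1 ≤ (x - ε) / ε := by rw [le_div_iff₀ hε]; linarith
    rw [max_eq_left (by linarith), min_eq_right this]
  let χ : ℝ → ℝ := fun t => ∫ x in ε..t, k x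
  have hd : ∀ t, HasDerivAt χ (k t) t := fun t => hk.integral_hasStrictDerivAt ε t |>.hasDerivAt
  have hderiv : deriv χ = k := funext fun t => (hd t).deriv
  have h0 : ∀ t, t ≤ ε → χ t = 0 := fun t ht => by
    simp only [χ]
    rw [intervalIntegral.integral_symm, intervalIntegral.integral_congr (g := fun _ => (0:ℝ))]
    · simp
    · intro x hx
      rw [Set.uIcc_of_le ht] at hx
      exact hkz x hx.2
  have hnn : ∀ t, 0 ≤ χ t := fun t => by
    rcases le_total t ε with h | h
    · rw [h0 t h]
    · exact intervalIntegral.integral_nonneg h fun x _ => hk0 x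
  refine ⟨χ, ?_, hnn, h0, fun t => ?_, fun t => ?_⟩
  · rw [contDiff_one_iff_deriv]
    exact ⟨fun t => (hd t).differentiableAt, hderiv ▸ hk⟩
  · rcases le_total t (2 * ε) with h | h
    · exact (by linarith : t - 2 * ε ≤ 0).trans (hnn t)
    · have : χ t = χ (2 * ε) + ∫ x in (2 * ε)..t, k x :=
        (intervalIntegral.integral_add_adjacent_intervals (hk.intervalIntegrable _ _) (hk.intervalIntegrable _ _)).symm
      rw [this, intervalIntegral.integral_congr (g := fun _ => (1:ℝ))]
      · simpa using hnn (2 * ε)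
      · intro x hx
        rw [Set.uIcc_of_le h] at hx
        exact hk1 x hx.1
  · rw [hderiv, abs_of_nonneg (hk0 t)]
    exact min_le_right _ _

lemma tanSq_comp {n : ℕ} {w : EuclideanSpace ℝ (Fin n) → ℝ} (hw : ContDiff ℝ 1 w) {χ : ℝ → ℝ}
    (hχ : ContDiff ℝ 1 χ) (r : ℝ) (θ : EuclideanSpace ℝ (Fin n)) :
    tanSq (fun x => χ (w x)) r θ = deriv χ (w (r • θ)) ^ 2 * tanSq w r θ := by
  have h : gradient (fun x => χ (w x)) (r • θ) = deriv χ (w (r • θ)) • gradient w (r • θ) := by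
    refine HasGradientAt.gradient ?_
    rw [hasGradientAt_iff_hasFDerivAt, map_smul]
    exact (hχ.differentiable one_ne_zero _).hasDerivAt.comp_hasFDerivAt (r • θ)
      (hw.differentiable one_ne_zero (r • θ)).hasGradientAt.hasFDerivAt
  rw [tanSq, h, norm_smul, inner_smul_left, tanSq, mul_pow, Real.norm_eq_abs, sq_abs]
  simp only [conj_trivial]
  ring

lemma sphere_truncated_lower {n : ℕ} (hn : 2 ≤ n) {u : EuclideanSpace ℝ (Fin n) → ℝ}
    (hu : ContDiff ℝ 1 u) (hu0 : ∀ x, 0 < u x) {r ε θ₀ a : ℝ} (hε : 0 < ε) (ha : 0 < a)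
    (hau : ∫ θ : sphere (0 : EuclideanSpace ℝ (Fin n)) 1, u (r • (θ : EuclideanSpace ℝ (Fin n))) ^ 2 ∂(sphm n) = a)
    (hθ₀ : θ₀ ∈ Set.Icc (-1:ℝ) 1)
    (hb : θ₀ = -1 ∨ (sphm n).real {θ | ε * √a < u (r • (θ : EuclideanSpace ℝ (Fin n)))} / (sphm n).real Set.univ
      ≤ gcdf (-(kap * θ₀))) :
    (1 + θ₀) * (1 + θ₀ + n - 2) * (1 - 2 * (1 + (sphm n).real Set.univ) * ε) * a ≤
      ∫ θ : sphere (0 : EuclideanSpace ℝ (Fin n)) 1, tanSq u r θ ∂(sphm n) := by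
  have hn2 : (2:ℝ) ≤ n := by exact_mod_cast hn
  rcases hb with rfl | hb
  · simpa using integral_nonneg (μ := sphm n) (fun θ : sphere (0 : EuclideanSpace ℝ (Fin n)) 1 => tanSq_nonneg u r θ)
  have hsa : 0 < √a := Real.sqrt_pos.2 ha
  have hsa2 : √a ^ 2 = a := Real.sq_sqrt ha.le
  obtain ⟨χ, hχ, hχ0, hχz, hχl, hχd⟩ := exists_trunc (mul_pos hε hsa)
  set w : EuclideanSpace ℝ (Fin n) → ℝ := fun x => χ (u x) with hw
  have hwC : ContDiff ℝ 1 w := hχ.comp hu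
  have hcu : Continuous fun θ : EuclideanSpace ℝ (Fin n) => u (r • θ) := hu.continuous.comp (by fun_prop)
  have hcw : Continuous fun θ : EuclideanSpace ℝ (Fin n) => w (r • θ) := hwC.continuous.comp (by fun_prop)
  have hfk := sphere_faber_krahn hn hwC (fun x => hχ0 _) (r := r) hθ₀ (by
    refine le_trans (div_le_div_of_nonneg_right (measureReal_mono ?_) measureReal_nonneg) hb
    intro θ hθ
    rw [Set.mem_ofPred_eq] at hθ ⊢
    by_contra! h
    exact hθ.ne' (hχz _ h))
  have h1 : ∫ θ : sphere (0 : EuclideanSpace ℝ (Fin n)) 1, tanSq w r θ ∂(sphm n) ≤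
      ∫ θ : sphere (0 : EuclideanSpace ℝ (Fin n)) 1, tanSq u r θ ∂(sphm n) := by
    refine integral_mono (integrable_sphm (continuous_tanSq hwC r)) (integrable_sphm (continuous_tanSq hu r)) fun θ => ?_
    simp only [hw]
    rw [tanSq_comp hu hχ]
    refine mul_le_of_le_one_left (tanSq_nonneg u r θ) ?_
    rw [sq_le_one_iff_abs_le_one]; exact hχd _
  have h2 : (1 - 2 * (1 + (sphm n).real Set.univ) * ε) * a ≤
      ∫ θ : sphere (0 : EuclideanSpace ℝ (Fin n)) 1, w (r • (θ : EuclideanSpace ℝ (Fin n))) ^ 2 ∂(sphm n) := by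
    have hpt : ∀ θ : sphere (0 : EuclideanSpace ℝ (Fin n)) 1,
        u (r • (θ : EuclideanSpace ℝ (Fin n))) ^ 2 - 2 * ε * (u (r • (θ : EuclideanSpace ℝ (Fin n))) ^ 2 + a) ≤ w (r • (θ : EuclideanSpace ℝ (Fin n))) ^ 2 := by
      intro θ
      set t := u (r • (θ : EuclideanSpace ℝ (Fin n)))
      have ht : 0 < t := hu0 _
      have hq : 2 * (t * √a) ≤ t ^ 2 + a := by nlinarith [sq_nonneg (t - √a)]
      have hl : t ^ 2 - 4 * (ε * √a) * t ≤ χ t ^ 2 := by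
        rcases le_total t (2 * (ε * √a)) with h | h
        · nlinarith [sq_nonneg (χ t), mul_pos hε hsa]
        · nlinarith [hχl t, mul_pos hε hsa]
      have : χ t ^ 2 = w (r • (θ : EuclideanSpace ℝ (Fin n))) ^ 2 := rfl
      nlinarith
    have hi := integrable_sphm (hcu.pow 2)
    have := integral_mono (μ := sphm n) (hi.sub ((hi.add (integrable_const a)).const_mul (2 * ε)))
      (integrable_sphm (hcw.pow 2)) hpt
    rw [integral_sub' hi ((hi.add (integrable_const a)).const_mul (2 * ε)), integral_const_mul,
      integral_add' hi (integrable_const a), integral_const, smul_eq_mul] at this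
    simp only [Pi.pow_apply] at this
    rw [hau] at this
    linarith
  refine le_trans ?_ (hfk.trans h1)
  rw [mul_assoc]
  refine mul_le_mul_of_nonneg_left h2 ?_
  have := hθ₀.1
  exact mul_nonneg (by linarith) (by linarith)

lemma gcdf_sub_ge {x y R : ℝ} (hxy : y ≤ x) (hy : -R ≤ y) (hx : x ≤ R) :
    gpdf R * (x - y) ≤ gcdf x - gcdf y := by
  have := (convex_Icc (-R) R).mul_sub_le_image_sub_of_le_deriv (f := gcdf) gcdf_continuous.continuousOn
    (fun z _ => (gcdf_hasDerivAt z).differentiableAt.differentiableWithinAt) (C := gpdf R) (fun z hz => by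
      rw [(gcdf_hasDerivAt z).deriv]
      refine gpdf_le_of_abs_le ?_
      have hz' := interior_subset hz
      rw [abs_le]
      have := le_abs_self R
      exact ⟨by linarith [hz'.1], by linarith [hz'.2]⟩) y ⟨hy, by linarith⟩ x ⟨by linarith, hx⟩ hxy
  exact this

/-- Choice of the two levels for almost complementary proportions. -/
lemma exists_levels {p₁ p₂ δ : ℝ} (hδ : 0 ≤ δ) (hp : p₁ + p₂ ≤ 1 + δ) :
    ∃ θ₁ ∈ Set.Icc (-1:ℝ) 1, ∃ θ₂ ∈ Set.Icc (-1:ℝ) 1,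
      (θ₁ = -1 ∨ p₁ ≤ gcdf (-(kap * θ₁))) ∧ (θ₂ = -1 ∨ p₂ ≤ gcdf (-(kap * θ₂))) ∧
      -(δ / gpdf kap) ≤ θ₁ + θ₂ := by
  have hk1 := one_le_kap
  have hk0 : 0 < kap := by linarith
  have hgn := gcdf_neg kap
  have hmono : gcdf (-kap) ≤ gcdf kap := gcdf_strictMono.monotone (by linarith)
  have one : ∀ p : ℝ, ∃ x ∈ Set.Icc (-kap) kap, gcdf x = max (gcdf (-kap)) (min p (gcdf kap)) := by
    intro p
    have := intermediate_value_Icc (show -kap ≤ kap by linarith) gcdf_continuous.continuousOn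
    exact this ⟨le_max_left _ _, max_le hmono (min_le_right _ _)⟩
  obtain ⟨x₁, hx₁, e₁⟩ := one p₁
  obtain ⟨x₂, hx₂, e₂⟩ := one p₂
  have hsum : gcdf x₁ + gcdf x₂ ≤ 1 + δ := by
    rw [e₁, e₂]
    rcases le_total (gcdf (-kap)) (min p₁ (gcdf kap)) with h1 | h1
    · rcases le_total (gcdf (-kap)) (min p₂ (gcdf kap)) with h2 | h2
      · rw [max_eq_right h1, max_eq_right h2]
        linarith [min_le_left p₁ (gcdf kap), min_le_left p₂ (gcdf kap)]
      · rw [max_eq_right h1, max_eq_left h2]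
        linarith [min_le_right p₁ (gcdf kap)]
    · rw [max_eq_left h1]
      have : max (gcdf (-kap)) (min p₂ (gcdf kap)) ≤ gcdf kap := max_le hmono (min_le_right _ _)
      linarith
  have key : x₁ + x₂ ≤ δ / gpdf kap := by
    have hg := gpdf_pos kap
    rcases le_total x₁ (-x₂) with h | h
    · have : 0 ≤ δ / gpdf kap := by positivity
      linarith
    · have := gcdf_sub_ge h (R := kap) (by linarith [hx₂.2]) hx₁.2
      rw [gcdf_neg] at this
      rw [le_div_iff₀ hg]
      linarith
  have hmem : ∀ x ∈ Set.Icc (-kap) kap, -(x / kap) ∈ Set.Icc (-1:ℝ) 1 := fun x hx => by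
    have h1 : x / kap ≤ 1 := (div_le_one hk0).2 hx.2
    have h2 : -1 ≤ x / kap := by rw [le_div_iff₀ hk0]; linarith [hx.1]
    exact ⟨by linarith, by linarith⟩
  have hback : ∀ x : ℝ, -(kap * -(x / kap)) = x := fun x => by field_simp
  have valid : ∀ p x : ℝ, gcdf x = max (gcdf (-kap)) (min p (gcdf kap)) →
      (-(x / kap) = -1 ∨ p ≤ gcdf (-(kap * -(x / kap)))) := by
    intro p x e
    rw [hback]
    rcases le_total p (gcdf kap) with h | h
    · right; rw [e, min_eq_left h]; exact le_max_right _ _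
    · left
      rw [min_eq_right h, max_eq_right hmono] at e
      rw [gcdf_strictMono.injective e, div_self hk0.ne']
  refine ⟨_, hmem x₁ hx₁, _, hmem x₂ hx₂, valid _ _ e₁, valid _ _ e₂, ?_⟩
  have h0 : 0 ≤ δ / gpdf kap := div_nonneg hδ (gpdf_pos kap).le
  have : (x₁ + x₂) / kap ≤ δ / gpdf kap := by
    rw [div_le_iff₀ hk0]
    nlinarith
  have e : -(x₁ / kap) + -(x₂ / kap) = -((x₁ + x₂) / kap) := by ring
  rw [e]; linarith

/-- The spherical average of `a` at radius `r`, without normalization. -/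
def sint {n : ℕ} (a : EuclideanSpace ℝ (Fin n) → ℝ) (r : ℝ) : ℝ :=
  ∫ θ : sphere (0 : EuclideanSpace ℝ (Fin n)) 1, a (r • (θ : EuclideanSpace ℝ (Fin n))) ∂(sphm n)

/-- The spherical Rayleigh quotient of `u` with potential `v ^ 2`. -/
def rayl {n : ℕ} (u v : EuclideanSpace ℝ (Fin n) → ℝ) (r : ℝ) : ℝ :=
  ((∫ θ : sphere (0 : EuclideanSpace ℝ (Fin n)) 1, tanSq u r θ ∂(sphm n)) +
    r ^ 2 * sint (fun x => u x ^ 2 * v x ^ 2) r) / sint (fun x => u x ^ 2) r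

lemma sphm_univ_pos {n : ℕ} (hn : 1 ≤ n) : 0 < (sphm n).real Set.univ := by
  have := gmeas_isProb n
  refine lt_of_le_of_ne measureReal_nonneg fun h => ?_
  have := gmeas_cone hn MeasurableSet.univ MeasurableSet.univ (by simp)
  rw [← h, probReal_univ] at this
  simp at this

lemma sint_pos {n : ℕ} (hn : 1 ≤ n) {a : EuclideanSpace ℝ (Fin n) → ℝ} (ha : Continuous a)
    (ha0 : ∀ x, 0 < a x) (r : ℝ) : 0 < sint a r := by
  have hc : Continuous fun θ : EuclideanSpace ℝ (Fin n) => a (r • θ) := ha.comp (by fun_prop)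
  refine (integral_pos_iff_support_of_nonneg (fun θ => (ha0 _).le) (integrable_sphm (a := fun θ => a (r • θ)) hc)).2 ?_
  have : Function.support (fun θ : sphere (0 : EuclideanSpace ℝ (Fin n)) 1 => a (r • (θ : EuclideanSpace ℝ (Fin n)))) = Set.univ :=
    Set.eq_univ_of_forall fun θ => (ha0 _).ne'
  rw [this]
  have h := sphm_univ_pos hn
  exact (ENNReal.toReal_pos_iff.1 h).1

lemma le_gam_of_mul {n : ℕ} (hn : 2 ≤ n) {t η a D P : ℝ} (ht : 0 ≤ t) (hη0 : 0 ≤ η) (hη1 : η ≤ 1)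
    (ha : 0 < a) (hP : 0 ≤ P) (h : t * (t + n - 2) * η * a ≤ D) : t * η ≤ gam n ((D + P) / a) := by
  have hn2 : (2:ℝ) ≤ n := by exact_mod_cast hn
  refine le_gam hn ?_
  rw [le_div_iff₀ ha]
  have : t * η ≤ t := mul_le_of_le_one_right ht hη1
  calc t * η * (t * η + n - 2) * a ≤ t * η * (t + n - 2) * a := by gcongr
    _ = t * (t + n - 2) * η * a := by ring
    _ ≤ D + P := by linarith

set_option maxHeartbeats 1000000 in
/-- Lower bound for the sum of the characteristic exponents of two coexisting components. -/
lemma exists_gam_add_gam_ge {n : ℕ} (hn : 2 ≤ n) : ∃ C, 0 < C ∧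
    ∀ u v : EuclideanSpace ℝ (Fin n) → ℝ, ContDiff ℝ 1 u → ContDiff ℝ 1 v → (∀ x, 0 < u x) →
      (∀ x, 0 < v x) → ∀ r, 0 < r →
      2 - C * (r ^ 2 * sint (fun x => v x ^ 2) r) ^ (-(1:ℝ) / 5) ≤
        gam n (rayl u v r) + gam n (rayl v u r) := by
  have hn1 : 1 ≤ n := by omega
  have hn2 : (2:ℝ) ≤ n := by exact_mod_cast hn
  set m := (sphm n).real Set.univ with hm
  have hm0 : 0 < m := sphm_univ_pos hn1
  have hg := gpdf_pos kap
  set s := 2 * n / m / gpdf kap with hs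
  have hs0 : 0 < s := by positivity
  refine ⟨s + 2 * (2 * (1 + m)), by positivity, ?_⟩
  intro u v hu hv hu0 hv0 r hr
  have hcu : Continuous fun θ : EuclideanSpace ℝ (Fin n) => u (r • θ) := hu.continuous.comp (by fun_prop)
  have hcv : Continuous fun θ : EuclideanSpace ℝ (Fin n) => v (r • θ) := hv.continuous.comp (by fun_prop)
  set a := sint (fun x => u x ^ 2) r with ha
  set b := sint (fun x => v x ^ 2) r with hb
  set Q := sint (fun x => u x ^ 2 * v x ^ 2) r with hQ
  have hQ' : sint (fun x => v x ^ 2 * u x ^ 2) r = Q := by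
    rw [hQ]; congr 1; ext x; ring
  have ha0 : 0 < a := sint_pos hn1 (hu.continuous.pow 2) (fun x => pow_pos (hu0 x) 2) r
  have hb0 : 0 < b := sint_pos hn1 (hv.continuous.pow 2) (fun x => pow_pos (hv0 x) 2) r
  have hQ0 : 0 < Q := sint_pos hn1 ((hu.continuous.pow 2).mul (hv.continuous.pow 2))
    (fun x => mul_pos (pow_pos (hu0 x) 2) (pow_pos (hv0 x) 2)) r
  set Du := ∫ θ : sphere (0 : EuclideanSpace ℝ (Fin n)) 1, tanSq u r θ ∂(sphm n) with hDu
  set Dv := ∫ θ : sphere (0 : EuclideanSpace ℝ (Fin n)) 1, tanSq v r θ ∂(sphm n) with hDv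
  have hDu0 : 0 ≤ Du := integral_nonneg fun θ => tanSq_nonneg u r θ
  have hDv0 : 0 ≤ Dv := integral_nonneg fun θ => tanSq_nonneg v r θ
  have e1 : rayl u v r = (Du + r ^ 2 * Q) / a := rfl
  have e2 : rayl v u r = (Dv + r ^ 2 * Q) / b := by rw [rayl, hQ']
  rw [e1, e2]
  set K := r ^ 2 * b with hK
  have hK0 : 0 < K := by positivity
  set ε := K ^ (-(1:ℝ) / 5) with hε
  have hε0 : 0 < ε := by positivity
  have hε5 : K * ε ^ 5 = 1 := by
    rw [hε, ← Real.rpow_natCast, ← Real.rpow_mul hK0.le]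
    norm_num
    rw [Real.rpow_neg_one]; field_simp
  have g1 : 0 ≤ gam n ((Du + r ^ 2 * Q) / a) := gam_nonneg hn (by positivity)
  have g2 : 0 ≤ gam n ((Dv + r ^ 2 * Q) / b) := gam_nonneg hn (by positivity)
  have hsε : 0 < s * ε := by positivity
  have hmε : 0 < 2 * (1 + m) * ε := by positivity
  by_cases hbig : 2 * n ≤ (Du + r ^ 2 * Q) / a
  · have : 2 ≤ gam n ((Du + r ^ 2 * Q) / a) := le_gam hn (by linarith)
    nlinarith
  push Not at hbig
  rw [div_lt_iff₀ ha0] at hbig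
  rcases lt_or_ge 1 (2 * (1 + m) * ε) with hη | hη
  · nlinarith
  set A₁ : Set (sphere (0 : EuclideanSpace ℝ (Fin n)) 1) := {θ | ε * √a < u (r • (θ : EuclideanSpace ℝ (Fin n)))} with hA₁
  set A₂ : Set (sphere (0 : EuclideanSpace ℝ (Fin n)) 1) := {θ | ε * √b < v (r • (θ : EuclideanSpace ℝ (Fin n)))} with hA₂
  have hA₂m : MeasurableSet A₂ :=
    (isOpen_lt continuous_const (hcv.comp continuous_subtype_val)).measurableSet
  have hover : ε ^ 4 * a * b * (sphm n).real (A₁ ∩ A₂) ≤ Q := by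
    have hi : Integrable (fun θ : sphere (0 : EuclideanSpace ℝ (Fin n)) 1 => u (r • (θ : EuclideanSpace ℝ (Fin n))) ^ 2 * v (r • (θ : EuclideanSpace ℝ (Fin n))) ^ 2) (sphm n) :=
      integrable_sphm ((hcu.pow 2).mul (hcv.pow 2))
    have := mul_meas_ge_le_integral_of_nonneg (μ := sphm n) (ae_of_all _ fun θ => by positivity) hi (ε ^ 4 * a * b)
    refine le_trans (mul_le_mul_of_nonneg_left (measureReal_mono ?_) (by positivity)) this
    rintro θ ⟨h1, h2⟩
    rw [Set.mem_ofPred_eq] at h1 h2 ⊢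
    have q1 : (ε * √a) ^ 2 ≤ u (r • (θ : EuclideanSpace ℝ (Fin n))) ^ 2 := pow_le_pow_left₀ (by positivity) h1.le 2
    have q2 : (ε * √b) ^ 2 ≤ v (r • (θ : EuclideanSpace ℝ (Fin n))) ^ 2 := pow_le_pow_left₀ (by positivity) h2.le 2
    rw [mul_pow, Real.sq_sqrt ha0.le] at q1
    rw [mul_pow, Real.sq_sqrt hb0.le] at q2
    calc ε ^ 4 * a * b = (ε ^ 2 * a) * (ε ^ 2 * b) := by ring
      _ ≤ _ := mul_le_mul q1 q2 (by positivity) (by positivity)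
  have hδ : (sphm n).real (A₁ ∩ A₂) ≤ 2 * n * ε := by
    have h1 : r ^ 2 * (ε ^ 4 * a * b * (sphm n).real (A₁ ∩ A₂)) ≤ 2 * n * a := by
      nlinarith [mul_le_mul_of_nonneg_left hover (sq_nonneg r)]
    have h2 : (K * ε ^ 4) * (sphm n).real (A₁ ∩ A₂) ≤ 2 * n := by
      refine le_of_mul_le_mul_right ?_ ha0
      calc _ = r ^ 2 * (ε ^ 4 * a * b * (sphm n).real (A₁ ∩ A₂)) := by rw [hK]; ring
        _ ≤ _ := h1
    calc (sphm n).real (A₁ ∩ A₂) = (K * ε ^ 5) * (sphm n).real (A₁ ∩ A₂) := by rw [hε5, one_mul]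
      _ = ((K * ε ^ 4) * (sphm n).real (A₁ ∩ A₂)) * ε := by ring
      _ ≤ _ := mul_le_mul_of_nonneg_right h2 hε0.le
  have hp : (sphm n).real A₁ / m + (sphm n).real A₂ / m ≤ 1 + 2 * n * ε / m := by
    rw [← add_div, ← measureReal_union_add_inter hA₂m, add_div]
    refine add_le_add ((div_le_one hm0).2 (measureReal_mono (Set.subset_univ _))) ?_
    exact div_le_div_of_nonneg_right hδ hm0.le
  obtain ⟨θ₁, hθ₁, θ₂, hθ₂, v1, v2, hsum⟩ := exists_levels (by positivity) hp
  have f1 := sphere_truncated_lower hn hu hu0 hε0 ha0 rfl hθ₁ v1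
  have f2 := sphere_truncated_lower hn hv hv0 hε0 hb0 rfl hθ₂ v2
  rw [← hm, ← hDu] at f1
  rw [← hm, ← hDv] at f2
  have k1 := le_gam_of_mul hn (by linarith [hθ₁.1]) (by linarith) (by linarith) ha0 (by positivity : 0 ≤ r ^ 2 * Q) f1
  have k2 := le_gam_of_mul hn (by linarith [hθ₂.1]) (by linarith) (by linarith) hb0 (by positivity : 0 ≤ r ^ 2 * Q) f2
  have hsum' : 2 - s * ε ≤ (1 + θ₁) + (1 + θ₂) := by
    have : 2 * n * ε / m / gpdf kap = s * ε := by rw [hs]; ring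
    linarith
  have h3 := mul_le_mul_of_nonneg_right hsum' (show 0 ≤ 1 - 2 * (1 + m) * ε by linarith)
  nlinarith [mul_pos hsε hmε]

lemma continuous_integral_sphm {n : ℕ} {F : ℝ → EuclideanSpace ℝ (Fin n) → ℝ}
    (hF : Continuous (Function.uncurry F)) :
    Continuous fun ρ => ∫ θ : sphere (0 : EuclideanSpace ℝ (Fin n)) 1, F ρ θ ∂(sphm n) := by
  have h : Continuous (Function.uncurry fun (ρ : ℝ) (θ : sphere (0 : EuclideanSpace ℝ (Fin n)) 1) => F ρ θ) :=
    hF.comp (continuous_fst.prodMk (continuous_subtype_val.comp continuous_snd))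
  simpa using continuous_parametric_integral_of_continuous (μ := sphm n) h isCompact_univ

lemma continuous_sint {n : ℕ} {a : EuclideanSpace ℝ (Fin n) → ℝ} (ha : Continuous a) :
    Continuous (sint a) :=
  continuous_integral_sphm (F := fun ρ θ => a (ρ • θ)) (ha.comp (by fun_prop))

/-- The derivative of `sint a`. -/
def dsint {n : ℕ} (a : EuclideanSpace ℝ (Fin n) → ℝ) (r : ℝ) : ℝ :=
  ∫ θ : sphere (0 : EuclideanSpace ℝ (Fin n)) 1,
    fderiv ℝ a (r • (θ : EuclideanSpace ℝ (Fin n))) θ ∂(sphm n)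

lemma continuous_dsint {n : ℕ} {a : EuclideanSpace ℝ (Fin n) → ℝ} (ha : ContDiff ℝ 1 a) :
    Continuous (dsint a) := by
  refine continuous_integral_sphm (F := fun ρ θ => fderiv ℝ a (ρ • θ) θ) ?_
  have := ha.continuous_fderiv one_ne_zero
  exact (this.comp (by fun_prop : Continuous fun p : ℝ × EuclideanSpace ℝ (Fin n) => p.1 • p.2)).clm_apply
    continuous_snd

lemma hasDerivAt_sint {n : ℕ} {a : EuclideanSpace ℝ (Fin n) → ℝ} (ha : ContDiff ℝ 1 a) (r : ℝ) :
    HasDerivAt (sint a) (dsint a r) r := by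
  have hd := ha.continuous_fderiv one_ne_zero
  have hc : Continuous fun p : ℝ × EuclideanSpace ℝ (Fin n) => fderiv ℝ a (p.1 • p.2) p.2 :=
    (hd.comp (by fun_prop : Continuous fun p : ℝ × EuclideanSpace ℝ (Fin n) => p.1 • p.2)).clm_apply continuous_snd
  obtain ⟨M, hM⟩ := ((isCompact_closedBall r 1).prod (isCompact_sphere (0 : EuclideanSpace ℝ (Fin n)) 1)).exists_bound_of_continuousOn hc.continuousOn
  refine (hasDerivAt_integral_of_dominated_loc_of_deriv_le (μ := sphm n) (bound := fun _ => M)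
    (F := fun ρ (θ : sphere (0 : EuclideanSpace ℝ (Fin n)) 1) => a (ρ • (θ : EuclideanSpace ℝ (Fin n))))
    (F' := fun ρ (θ : sphere (0 : EuclideanSpace ℝ (Fin n)) 1) => fderiv ℝ a (ρ • (θ : EuclideanSpace ℝ (Fin n))) θ)
    (closedBall_mem_nhds r one_pos) ?_ ?_ ?_ ?_ (integrable_const M) ?_).2
  · exact Filter.Eventually.of_forall fun ρ =>
      (integrable_sphm (a := fun θ => a (ρ • θ)) (ha.continuous.comp (by fun_prop))).aestronglyMeasurable
  · exact integrable_sphm (a := fun θ => a (r • θ)) (ha.continuous.comp (by fun_prop))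
  · exact (integrable_sphm (a := fun θ => fderiv ℝ a (r • θ) θ) (hc.comp (by fun_prop : Continuous fun θ : EuclideanSpace ℝ (Fin n) => (r, θ)))).aestronglyMeasurable
  · exact ae_of_all _ fun θ ρ hρ => hM (ρ, θ) ⟨hρ, θ.2⟩
  · refine ae_of_all _ fun θ ρ _ => ?_
    have h1 := (ha.differentiable one_ne_zero (ρ • (θ : EuclideanSpace ℝ (Fin n)))).hasFDerivAt
    have h2 : HasDerivAt (fun ρ : ℝ => ρ • (θ : EuclideanSpace ℝ (Fin n))) (θ : EuclideanSpace ℝ (Fin n)) ρ := by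
      simpa using (hasDerivAt_id ρ).smul_const (θ : EuclideanSpace ℝ (Fin n))
    exact h1.comp_hasDerivAt ρ h2

lemma integral_polar_iter {n : ℕ} (hn : 1 ≤ n) {f : EuclideanSpace ℝ (Fin n) → ℝ}
    (hf : Integrable f) : ∫ x, f x = ∫ ρ in Set.Ioi (0:ℝ), ρ ^ (n - 1) * sint f ρ := by
  rw [integral_polar hn hf.aestronglyMeasurable, integral_prod_symm, integral_radm]
  · rfl
  · exact ((measurePreserving_polar hn).integrable_comp hf.aestronglyMeasurable).2 hf

lemma lap_eq_sum {n : ℕ} {f : EuclideanSpace ℝ (Fin n) → ℝ} (hf : ContDiff ℝ 2 f)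
    (x : EuclideanSpace ℝ (Fin n)) :
    lap f x = ∑ i : Fin n, fderiv ℝ (fun y => fderiv ℝ f y (EuclideanSpace.single i 1)) x (EuclideanSpace.single i 1) := by
  unfold lap
  refine Finset.sum_congr rfl fun i _ => ?_
  rw [iteratedFDeriv_two_apply]
  have h : DifferentiableAt ℝ (fderiv ℝ f) x :=
    (hf.fderiv_right (m := 1) (by norm_num)).differentiable one_ne_zero x
  rw [fderiv_clm_apply h (differentiableAt_const _)]
  simp

lemma continuous_lap {n : ℕ} {f : EuclideanSpace ℝ (Fin n) → ℝ} (hf : ContDiff ℝ 2 f) :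
    Continuous (lap f) := by
  have : lap f = fun x => ∑ i : Fin n, fderiv ℝ (fun y => fderiv ℝ f y (EuclideanSpace.single i 1)) x (EuclideanSpace.single i 1) :=
    funext fun x => lap_eq_sum hf x
  rw [this]
  refine continuous_finsetSum _ fun i _ => ?_
  have h : ContDiff ℝ 1 (fun y => fderiv ℝ f y (EuclideanSpace.single i 1)) :=
    (hf.fderiv_right (m := 1) (by norm_num)).clm_apply contDiff_const
  exact (h.continuous_fderiv one_ne_zero).clm_apply continuous_const

/-- Green's identity against a compactly supported function. -/
lemma integral_mul_lap {n : ℕ} {f Φ : EuclideanSpace ℝ (Fin n) → ℝ} (hf : ContDiff ℝ 2 f)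
    (hΦ : ContDiff ℝ 1 Φ) (hc : HasCompactSupport Φ) :
    ∫ x, Φ x * lap f x = -∫ x, ∑ i : Fin n, fderiv ℝ Φ x (EuclideanSpace.single i 1) *
      fderiv ℝ f x (EuclideanSpace.single i 1) := by
  have hg : ∀ i : Fin n, ContDiff ℝ 1 (fun y => fderiv ℝ f y (EuclideanSpace.single i 1)) := fun i =>
    (hf.fderiv_right (m := 1) (by norm_num)).clm_apply contDiff_const
  have cg : ∀ i : Fin n, Continuous fun x => fderiv ℝ (fun y => fderiv ℝ f y (EuclideanSpace.single i 1)) x (EuclideanSpace.single i 1) := fun i =>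
    ((hg i).continuous_fderiv one_ne_zero).clm_apply continuous_const
  have cΦ : ∀ i : Fin n, Continuous fun x => fderiv ℝ Φ x (EuclideanSpace.single i 1) := fun i =>
    (hΦ.continuous_fderiv one_ne_zero).clm_apply continuous_const
  have sΦ : ∀ i : Fin n, HasCompactSupport fun x => fderiv ℝ Φ x (EuclideanSpace.single i 1) := fun i =>
    hc.fderiv_apply ℝ _
  have i1 : ∀ i : Fin n, Integrable fun x => Φ x * fderiv ℝ (fun y => fderiv ℝ f y (EuclideanSpace.single i 1)) x (EuclideanSpace.single i 1) := fun i =>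
    (hΦ.continuous.mul (cg i)).integrable_of_hasCompactSupport hc.mul_right
  have i2 : ∀ i : Fin n, Integrable fun x => fderiv ℝ Φ x (EuclideanSpace.single i 1) * fderiv ℝ f x (EuclideanSpace.single i 1) := fun i =>
    ((cΦ i).mul (hg i).continuous).integrable_of_hasCompactSupport (sΦ i).mul_right
  have i3 : ∀ i : Fin n, Integrable fun x => Φ x * fderiv ℝ f x (EuclideanSpace.single i 1) := fun i =>
    (hΦ.continuous.mul (hg i).continuous).integrable_of_hasCompactSupport hc.mul_right
  rw [integral_finsetSum _ fun i _ => i2 i, ← Finset.sum_neg_distrib]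
  simp_rw [lap_eq_sum hf, Finset.mul_sum]
  rw [integral_finsetSum _ fun i _ => i1 i]
  refine Finset.sum_congr rfl fun i _ => ?_
  exact integral_mul_fderiv_eq_neg_fderiv_mul_of_integrable (i2 i) (i1 i) (i3 i)
    (fun x _ => hΦ.differentiable one_ne_zero x) (fun x _ => (hg i).differentiable one_ne_zero x)

lemma sum_single_mul {n : ℕ} (θ : EuclideanSpace ℝ (Fin n)) (L : EuclideanSpace ℝ (Fin n) →L[ℝ] ℝ) :
    ∑ i : Fin n, ⟪θ, EuclideanSpace.single i 1⟫ * L (EuclideanSpace.single i 1) = L θ := by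
  have h := (EuclideanSpace.basisFun (Fin n) ℝ).sum_repr' θ
  conv_rhs => rw [← h, map_sum]
  refine Finset.sum_congr rfl fun i _ => ?_
  rw [map_smul, smul_eq_mul, EuclideanSpace.basisFun_apply, real_inner_comm]

lemma exists_bounds_of_tsupport {φ : ℝ → ℝ} (hc : HasCompactSupport φ) (hs : tsupport φ ⊆ Set.Ioi 0) :
    ∃ ε > 0, ∃ R, (∀ ρ, 0 ≤ ρ → ρ < ε → φ ρ = 0) ∧ ∀ ρ, R < ρ → φ ρ = 0 := by
  have h0 : (0:ℝ) ∈ (tsupport φ)ᶜ := fun h => absurd (Set.mem_Ioi.1 (hs h)) (lt_irrefl 0)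
  obtain ⟨ε, hε, hb⟩ := Metric.isOpen_iff.1 (isClosed_tsupport φ).isOpen_compl 0 h0
  obtain ⟨R, hR⟩ := hc.isCompact.isBounded.subset_closedBall 0
  refine ⟨ε, hε, R, fun ρ h1 h2 => ?_, fun ρ h => ?_⟩
  · exact image_eq_zero_of_notMem_tsupport (hb (by rw [mem_ball_zero_iff, Real.norm_of_nonneg h1]; exact h2))
  · refine image_eq_zero_of_notMem_tsupport fun hm => ?_
    have := hR hm
    rw [mem_closedBall_zero_iff, Real.norm_eq_abs] at this
    linarith [le_abs_self ρ]

/-- The spherical means of a function and of its Laplacian, in weak form. -/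
lemma integral_sint_lap {n : ℕ} (hn : 2 ≤ n) {f : EuclideanSpace ℝ (Fin n) → ℝ} (hf : ContDiff ℝ 2 f)
    {φ : ℝ → ℝ} (hφ : ContDiff ℝ 1 φ) (hc : HasCompactSupport φ) (hs : tsupport φ ⊆ Set.Ioi 0) :
    ∫ ρ in Set.Ioi (0:ℝ), φ ρ * (ρ ^ (n - 1) * sint (lap f) ρ) =
      -∫ ρ in Set.Ioi (0:ℝ), deriv φ ρ * (ρ ^ (n - 1) * dsint f ρ) := by
  have hn1 : 1 ≤ n := by omega
  obtain ⟨ε, hε, R, h0, hR⟩ := exists_bounds_of_tsupport hc hs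
  set Φ : EuclideanSpace ℝ (Fin n) → ℝ := fun x => φ ‖x‖ with hΦdef
  have hΦ : ContDiff ℝ 1 Φ := by
    simpa using contDiff_polar hφ.contDiffOn hε h0 (w := fun _ : EuclideanSpace ℝ (Fin n) => (1:ℝ)) contDiff_const 1
  have hΦc : HasCompactSupport Φ := by
    simpa using hasCompactSupport_polar hR (W := fun _ : EuclideanSpace ℝ (Fin n) => (1:ℝ))
  have h := integral_mul_lap hf hΦ hΦc
  have i1 : Integrable fun x => Φ x * lap f x :=
    (hΦ.continuous.mul (continuous_lap hf)).integrable_of_hasCompactSupport hΦc.mul_right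
  have hf1 : ContDiff ℝ 1 f := hf.of_le (by norm_num)
  have i2 : Integrable fun x => ∑ i : Fin n, fderiv ℝ Φ x (EuclideanSpace.single i 1) *
      fderiv ℝ f x (EuclideanSpace.single i 1) := by
    refine integrable_finsetSum _ fun i _ => ?_
    have c1 : Continuous fun x => fderiv ℝ Φ x (EuclideanSpace.single i 1) :=
      (hΦ.continuous_fderiv one_ne_zero).clm_apply continuous_const
    have c2 : Continuous fun x => fderiv ℝ f x (EuclideanSpace.single i 1) :=
      (hf1.continuous_fderiv one_ne_zero).clm_apply continuous_const
    exact (c1.mul c2).integrable_of_hasCompactSupport (hΦc.fderiv_apply ℝ _).mul_right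
  rw [integral_polar_iter hn1 i1, integral_polar_iter hn1 i2] at h
  convert h using 1
  · refine setIntegral_congr_fun measurableSet_Ioi fun ρ hρ => ?_
    have : sint (fun x => Φ x * lap f x) ρ = φ ρ * sint (lap f) ρ := by
      rw [sint, sint, ← integral_const_mul]
      refine integral_congr_ae (ae_of_all _ fun θ => ?_)
      simp only [hΦdef, norm_smul_sphere θ hρ]
    simp only [this]; ring
  · congr 1
    refine setIntegral_congr_fun measurableSet_Ioi fun ρ hρ => ?_
    have : sint (fun x => ∑ i : Fin n, fderiv ℝ Φ x (EuclideanSpace.single i 1) *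
      fderiv ℝ f x (EuclideanSpace.single i 1)) ρ = deriv φ ρ * dsint f ρ := by
      rw [sint, dsint, ← integral_const_mul]
      refine integral_congr_ae (ae_of_all _ fun θ => ?_)
      have hd : HasFDerivAt Φ (deriv φ ρ • innerSL ℝ (θ : EuclideanSpace ℝ (Fin n))) (ρ • (θ : EuclideanSpace ℝ (Fin n))) := by
        refine HasDerivAt.comp_hasFDerivAt (ρ • (θ : EuclideanSpace ℝ (Fin n))) ?_
          (hasFDerivAt_norm_polar (norm_eq_of_mem_sphere θ) hρ)
        rw [norm_smul_sphere θ hρ]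
        exact (hφ.differentiable one_ne_zero ρ).hasDerivAt
      simp only [hd.fderiv, smul_apply, innerSL_apply_apply, smul_eq_mul]
      simp_rw [mul_assoc]
      rw [← Finset.mul_sum, sum_single_mul]
    simp only [this]; ring

lemma sint_fderiv_self {n : ℕ} (f : EuclideanSpace ℝ (Fin n) → ℝ) (ρ : ℝ) :
    sint (fun x => fderiv ℝ f x x) ρ = ρ * dsint f ρ := by
  rw [sint, dsint, ← integral_const_mul]
  refine integral_congr_ae (ae_of_all _ fun θ => ?_)
  simp

/-- The radial Laplacian of the spherical means is the spherical mean of the Laplacian. -/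
lemma hasDerivAt_radial {n : ℕ} (hn : 2 ≤ n) {f : EuclideanSpace ℝ (Fin n) → ℝ} (hf : ContDiff ℝ 2 f)
    {r : ℝ} (hr : 0 < r) :
    HasDerivAt (fun ρ => sint (fun x => fderiv ℝ f x x) ρ + ((n:ℝ) - 2) * sint f ρ)
      (r * sint (lap f) r) r := by
  have hf1 : ContDiff ℝ 1 f := hf.of_le (by norm_num)
  set q : EuclideanSpace ℝ (Fin n) → ℝ := fun x => fderiv ℝ f x x with hq
  have hqC : ContDiff ℝ 1 q := (hf.fderiv_right (m := 1) (by norm_num)).clm_apply contDiff_id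
  obtain ⟨k, rfl⟩ : ∃ k, n = k + 2 := ⟨n - 2, by omega⟩
  set W : ℝ → ℝ := fun ρ => ρ ^ k * sint q ρ with hW
  set W' : ℝ → ℝ := fun ρ => k * ρ ^ (k - 1) * sint q ρ + ρ ^ k * dsint q ρ with hW'
  have hWd : ∀ ρ, HasDerivAt W (W' ρ) ρ := fun ρ => (hasDerivAt_pow k ρ).mul (hasDerivAt_sint hqC ρ)
  have hcq := continuous_sint hqC.continuous
  have hcdq := continuous_dsint hqC
  have hclf := continuous_sint (continuous_lap hf)
  have hcW : Continuous W := by fun_prop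
  have hcW' : Continuous W' := by fun_prop
  have hcz : Continuous fun ρ => W' ρ - ρ ^ (k + 1) * sint (lap f) ρ := by fun_prop
  have hz := IsOpen.ae_eq_zero_of_integral_contDiff_smul_eq_zero (μ := (volume : Measure ℝ)) (U := Set.Ioi 0) isOpen_Ioi
    (f := fun ρ => W' ρ - ρ ^ (k + 1) * sint (lap f) ρ) (hcz.locallyIntegrable.locallyIntegrableOn _) (by
    intro φ hφ hc hs
    have hφ1 : ContDiff ℝ 1 φ := hφ.of_le (by exact_mod_cast le_top)
    have h1 := integral_sint_lap hn hf hφ1 hc hs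
    have cφ' := hφ1.continuous_deriv le_rfl
    have ext : ∀ g : ℝ → ℝ, ∫ ρ in Set.Ioi (0:ℝ), φ ρ * g ρ = ∫ ρ, φ ρ * g ρ := fun g => by
      refine setIntegral_eq_integral_of_forall_compl_eq_zero fun ρ hρ => ?_
      rw [image_eq_zero_of_notMem_tsupport (fun h => hρ (hs h)), zero_mul]
    have ext' : ∀ g : ℝ → ℝ, ∫ ρ in Set.Ioi (0:ℝ), deriv φ ρ * g ρ = ∫ ρ, deriv φ ρ * g ρ := fun g => by
      refine setIntegral_eq_integral_of_forall_compl_eq_zero fun ρ hρ => ?_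
      rw [image_eq_zero_of_notMem_tsupport (fun h => hρ (hs ((tsupport_deriv_subset) h))), zero_mul]
    rw [ext, ext'] at h1
    have i1 : Integrable (fun ρ => φ ρ * W' ρ) := (hφ.continuous.mul hcW').integrable_of_hasCompactSupport hc.mul_right
    have i2 : Integrable (fun ρ => deriv φ ρ * W ρ) := (cφ'.mul hcW).integrable_of_hasCompactSupport hc.deriv.mul_right
    have i3 : Integrable (fun ρ => φ ρ * W ρ) := (hφ.continuous.mul hcW).integrable_of_hasCompactSupport hc.mul_right
    have i4 : Integrable (fun ρ => φ ρ * (ρ ^ (k + 1) * sint (lap f) ρ)) :=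
      (hφ.continuous.mul (by fun_prop)).integrable_of_hasCompactSupport hc.mul_right
    have h2 := integral_mul_deriv_eq_deriv_mul_of_integrable (u := φ) (v := W) (u' := deriv φ) (v' := W')
      (fun x _ => (hφ1.differentiable one_ne_zero x).hasDerivAt) (fun x _ => hWd x) i1 i2 i3
    simp only [smul_eq_mul, mul_sub]
    rw [integral_sub i1 i4, h2]
    have h3 : ∫ ρ, deriv φ ρ * (ρ ^ (k + 2 - 1) * dsint f ρ) = ∫ ρ, deriv φ ρ * W ρ := by
      refine integral_congr_ae (ae_of_all _ fun ρ => ?_)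
      simp only [hW, hq, sint_fderiv_self]
      rw [show k + 2 - 1 = k + 1 by omega, pow_succ]; ring
    rw [h3] at h1
    rw [show k + 2 - 1 = k + 1 by omega] at h1
    linarith)
  have hz' := Measure.eqOn_open_of_ae_eq (μ := (volume : Measure ℝ)) (U := Set.Ioi 0) (f := fun ρ => W' ρ - ρ ^ (k + 1) * sint (lap f) ρ)
    (g := fun _ => (0:ℝ)) ((ae_restrict_iff' measurableSet_Ioi).2 hz) isOpen_Ioi hcz.continuousOn continuousOn_const
  have e := hz' hr
  simp only [hW'] at e
  have hd := (hasDerivAt_sint hqC r).add ((hasDerivAt_sint hf1 r).const_mul (((k + 2 : ℕ):ℝ) - 2))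
  refine hd.congr_deriv ?_
  have hrk : (0:ℝ) < r ^ k := pow_pos hr k
  have e2 : (k:ℝ) * r ^ (k - 1) * sint q r = k * r ^ k * dsint f r := by
    rw [hq, sint_fderiv_self]
    rcases k with _ | k
    · simp
    · rw [Nat.add_sub_cancel, pow_succ]; ring
  rw [e2, pow_succ] at e
  push_cast
  refine mul_left_cancel₀ hrk.ne' ?_
  linarith

lemma inner_gradient_eq {n : ℕ} (f : EuclideanSpace ℝ (Fin n) → ℝ) (x y : EuclideanSpace ℝ (Fin n)) :
    ⟪gradient f x, y⟫ = fderiv ℝ f x y := by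
  rw [gradient, InnerProductSpace.toDual_symm_apply]

lemma lap_sq {n : ℕ} {u : EuclideanSpace ℝ (Fin n) → ℝ} (hu : ContDiff ℝ 2 u)
    (x : EuclideanSpace ℝ (Fin n)) :
    lap (fun y => u y ^ 2) x = 2 * (‖gradient u x‖ ^ 2 + u x * lap u x) := by
  have hu1 : ∀ y, DifferentiableAt ℝ u y := fun y => hu.differentiable two_ne_zero y
  rw [lap_eq_sum (hu.pow 2), lap_eq_sum hu]
  have hgr : ‖gradient u x‖ ^ 2 = ∑ i : Fin n, fderiv ℝ u x (EuclideanSpace.single i 1) * fderiv ℝ u x (EuclideanSpace.single i 1) := by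
    have := sum_single_mul (gradient u x) (fderiv ℝ u x)
    simp_rw [inner_gradient_eq] at this
    rw [this, ← inner_gradient_eq, real_inner_self_eq_norm_sq]
  rw [hgr, Finset.mul_sum, ← Finset.sum_add_distrib, Finset.mul_sum]
  refine Finset.sum_congr rfl fun i _ => ?_
  have h1 : (fun y => fderiv ℝ (fun y => u y ^ 2) y (EuclideanSpace.single i 1)) =
      fun y => (2 * u y) * fderiv ℝ u y (EuclideanSpace.single i 1) := by
    ext y
    have := ((hu1 y).hasFDerivAt.pow 2).fderiv
    rw [this]
    simp
  have hg : DifferentiableAt ℝ (fun y => fderiv ℝ u y (EuclideanSpace.single i 1)) x :=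
    (((hu.fderiv_right (m := 1) (by norm_num)).clm_apply contDiff_const).differentiable one_ne_zero) x
  have h2 := (((hu1 x).hasFDerivAt.const_mul 2).fun_mul hg.hasFDerivAt).fderiv
  rw [h1, h2]
  simp only [add_apply, smul_apply, smul_eq_mul]
  ring

/-- The energy density `|∇u|² + u² v²`. -/
def edens {n : ℕ} (u v : EuclideanSpace ℝ (Fin n) → ℝ) (x : EuclideanSpace ℝ (Fin n)) : ℝ :=
  ‖gradient u x‖ ^ 2 + u x ^ 2 * v x ^ 2

lemma continuous_edens {n : ℕ} {u v : EuclideanSpace ℝ (Fin n) → ℝ} (hu : ContDiff ℝ 1 u)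
    (hv : Continuous v) : Continuous (edens u v) := by
  have h1 := continuous_gradient hu
  have h2 := hu.continuous
  unfold edens
  fun_prop

lemma edens_nonneg {n : ℕ} (u v : EuclideanSpace ℝ (Fin n) → ℝ) (x : EuclideanSpace ℝ (Fin n)) :
    0 ≤ edens u v x := by
  unfold edens; positivity

/-- The weighted energy on the ball of radius `r`, in polar coordinates. -/
def acfI {n : ℕ} (u v : EuclideanSpace ℝ (Fin n) → ℝ) (r : ℝ) : ℝ :=
  ∫ s in (0:ℝ)..r, s * sint (edens u v) s

lemma setIntegral_ball_polar {n : ℕ} (hn : 2 ≤ n) {h : EuclideanSpace ℝ (Fin n) → ℝ} (hh : Continuous h)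
    {r : ℝ} (hr : 0 < r) :
    ∫ y in ball (0 : EuclideanSpace ℝ (Fin n)) r, h y * ‖(0 : EuclideanSpace ℝ (Fin n)) - y‖ ^ ((2:ℝ) - n) =
      ∫ s in (0:ℝ)..r, s * sint h s := by
  have hn1 : 1 ≤ n := by omega
  obtain ⟨k, rfl⟩ : ∃ k, n = k + 2 := ⟨n - 2, by omega⟩
  set F : EuclideanSpace ℝ (Fin (k + 2)) → ℝ :=
    (ball (0 : EuclideanSpace ℝ (Fin (k + 2))) r).indicator fun y => h y * ‖(0 : EuclideanSpace ℝ (Fin (k + 2))) - y‖ ^ ((2:ℝ) - (k + 2 : ℕ)) with hF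
  set b : ℝ → ℝ := (Set.Iio r).indicator fun s => s ^ ((2:ℝ) - (k + 2 : ℕ)) with hb
  have hpt : ∀ (θ : sphere (0 : EuclideanSpace ℝ (Fin (k + 2))) 1) (s : ℝ), 0 < s →
      F (s • (θ : EuclideanSpace ℝ (Fin (k + 2)))) = h (s • (θ : EuclideanSpace ℝ (Fin (k + 2)))) * b s := by
    intro θ s hs
    have hns := norm_smul_sphere θ hs
    by_cases h1 : s < r
    · rw [hF, hb, Set.indicator_of_mem (by rw [mem_ball_zero_iff, hns]; exact h1),
        Set.indicator_of_mem (Set.mem_Iio.2 h1), zero_sub, norm_neg, hns]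
    · rw [hF, hb, Set.indicator_of_notMem (by rw [mem_ball_zero_iff, hns]; exact h1),
        Set.indicator_of_notMem (by rw [Set.mem_Iio]; exact h1), mul_zero]
  have hpow : ∀ s : ℝ, 0 < s → s ^ (k + 2 - 1) * s ^ ((2:ℝ) - (k + 2 : ℕ)) = s := by
    intro s hs
    rw [← Real.rpow_natCast, ← Real.rpow_add hs]
    have : ((k + 2 - 1 : ℕ) : ℝ) + ((2:ℝ) - (k + 2 : ℕ)) = 1 := by
      rw [show k + 2 - 1 = k + 1 by omega]; push_cast; ring
    rw [this, Real.rpow_one]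
  have hFm : Measurable F := by
    refine Measurable.indicator (hh.measurable.mul ?_) measurableSet_ball
    exact ((measurable_const.sub measurable_id).norm).pow_const _
  have hbi : Integrable b (radm (k + 2)) := by
    rw [integrable_radm_iff]
    have h1 : IntegrableOn (fun s : ℝ => s) (Set.Ioo 0 r) :=
      (continuous_id.integrableOn_Icc (a := 0) (b := r)).mono_set Set.Ioo_subset_Icc_self
    rw [← integrable_indicator_iff measurableSet_Ioo] at h1
    refine (h1.integrableOn (s := Set.Ioi 0)).congr_fun (fun s hs => ?_) measurableSet_Ioi
    have hs' : 0 < s := hs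
    by_cases h2 : s < r
    · rw [hb, Set.indicator_of_mem (Set.mem_Ioo.2 ⟨hs', h2⟩)]
      rw [Set.indicator_of_mem (Set.mem_Iio.2 h2), hpow s hs']
    · rw [hb, Set.indicator_of_notMem (fun h3 => h2 h3.2)]
      rw [Set.indicator_of_notMem (by rw [Set.mem_Iio]; exact h2), mul_zero]
  have hFi : Integrable F := by
    rw [← (measurePreserving_polar hn1).integrable_comp hFm.aestronglyMeasurable]
    obtain ⟨M, hM⟩ := (isCompact_closedBall (0 : EuclideanSpace ℝ (Fin (k + 2))) r).exists_bound_of_continuousOn hh.continuousOn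
    have hM0 : 0 ≤ M := (norm_nonneg _).trans (hM 0 (by simp [hr.le]))
    have hg : Integrable (fun p : sphere (0 : EuclideanSpace ℝ (Fin (k + 2))) 1 × ℝ => (fun _ => M) p.1 * b p.2) ((sphm (k + 2)).prod (radm (k + 2))) :=
      (integrable_const M).mul_prod hbi
    refine hg.mono' (hFm.comp (measurePreserving_polar hn1).measurable).aestronglyMeasurable ?_
    have : ∀ᵐ p ∂((sphm (k + 2)).prod (radm (k + 2))), 0 < p.2 :=
      Measure.quasiMeasurePreserving_snd.ae (ae_radm_pos (k + 2))
    filter_upwards [this] with p hp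
    rw [Function.comp_apply, hpt _ _ hp, norm_mul]
    by_cases h2 : p.2 < r
    · have hbn : 0 ≤ b p.2 := by
        rw [hb]
        exact Set.indicator_apply_nonneg fun _ => by positivity
      rw [Real.norm_of_nonneg hbn]
      refine mul_le_mul_of_nonneg_right (hM _ ?_) hbn
      rw [mem_closedBall_zero_iff, norm_smul_sphere _ hp]; exact h2.le
    · rw [hb, Set.indicator_of_notMem (by rw [Set.mem_Iio]; exact h2)]
      simp
  rw [← integral_indicator measurableSet_ball, ← hF, integral_polar_iter hn1 hFi,
    intervalIntegral.integral_of_le hr.le, ← integral_indicator measurableSet_Ioi,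
    ← integral_indicator measurableSet_Ioc]
  refine integral_congr_ae ?_
  have hne : ∀ᵐ s : ℝ, s ≠ r := by
    rw [ae_iff]; simp
  filter_upwards [hne] with s hsr
  by_cases hs : 0 < s
  · rw [Set.indicator_of_mem (Set.mem_Ioi.2 hs)]
    have hsF : sint F s = sint h s * b s := by
      rw [sint, sint, ← integral_mul_const]
      exact integral_congr_ae (ae_of_all _ fun θ => hpt θ s hs)
    rw [hsF]
    by_cases h2 : s < r
    · rw [Set.indicator_of_mem (Set.mem_Ioc.2 ⟨hs, h2.le⟩), hb, Set.indicator_of_mem (Set.mem_Iio.2 h2),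
        mul_left_comm, hpow s hs, mul_comm]
    · rw [Set.indicator_of_notMem (fun h3 => h2 (lt_of_le_of_ne h3.2 hsr)), hb,
        Set.indicator_of_notMem (by rw [Set.mem_Iio]; exact h2)]
      simp
  · rw [Set.indicator_of_notMem (by rw [Set.mem_Ioi]; exact hs), Set.indicator_of_notMem (fun h3 => hs h3.1)]

lemma Jfun_eq {n : ℕ} (hn : 2 ≤ n) {u v : EuclideanSpace ℝ (Fin n) → ℝ} (hu : ContDiff ℝ 1 u)
    (hv : ContDiff ℝ 1 v) {r : ℝ} (hr : 0 < r) :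
    Jfun u v 0 r = r ^ (-4 : ℝ) * (acfI u v r * acfI v u r) := by
  have h1 := setIntegral_ball_polar hn (continuous_edens hu hv.continuous) hr
  have h2 := setIntegral_ball_polar hn (continuous_edens hv hu.continuous) hr
  rw [acfI, acfI, ← h1, ← h2]
  unfold Jfun edens
  simp_rw [mul_comm (v _ ^ 2) (u _ ^ 2)]

lemma hasDerivAt_acfI {n : ℕ} {u v : EuclideanSpace ℝ (Fin n) → ℝ} (hu : ContDiff ℝ 1 u)
    (hv : Continuous v) (r : ℝ) : HasDerivAt (acfI u v) (r * sint (edens u v) r) r := by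
  have := continuous_sint (continuous_edens hu hv)
  have hc : Continuous fun s => s * sint (edens u v) s := by fun_prop
  exact (hc.integral_hasStrictDerivAt 0 r).hasDerivAt

/-- The weighted energy is controlled by a boundary term. -/
lemma two_mul_acfI_le {n : ℕ} (hn : 2 ≤ n) {u v : EuclideanSpace ℝ (Fin n) → ℝ} (hu : ContDiff ℝ 2 u)
    (hv : Continuous v) (hlap : ∀ x, lap u x = u x * v x ^ 2) {r : ℝ} (hr : 0 ≤ r) :
    2 * acfI u v r ≤ r * dsint (fun x => u x ^ 2) r + ((n:ℝ) - 2) * sint (fun x => u x ^ 2) r := by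
  have hn2 : (2:ℝ) ≤ n := by exact_mod_cast hn
  have hu1 : ContDiff ℝ 1 u := hu.of_le (by norm_num)
  have hlap2 : lap (fun y => u y ^ 2) = fun x => 2 * edens u v x := by
    ext x
    rw [lap_sq hu, hlap, edens]; ring
  have hq : ContDiff ℝ 1 fun x => fderiv ℝ (fun y => u y ^ 2) x x :=
    ((hu.pow 2).fderiv_right (m := 1) (by norm_num)).clm_apply contDiff_id
  have c1 := continuous_sint hq.continuous
  have c2 := continuous_sint (hu.continuous.pow 2)
  have c3 := continuous_sint (continuous_edens hu1 hv)
  have := intervalIntegral.integral_eq_sub_of_hasDerivAt_of_le hr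
    (f := fun ρ => sint (fun x => fderiv ℝ (fun y => u y ^ 2) x x) ρ + ((n:ℝ) - 2) * sint (fun y => u y ^ 2) ρ)
    (f' := fun ρ => 2 * (ρ * sint (edens u v) ρ))
    (c1.add (continuous_const.mul c2)).continuousOn
    (fun ρ hρ => by
      refine (hasDerivAt_radial hn (hu.pow 2) hρ.1).congr_deriv ?_
      rw [hlap2]
      have : sint (fun x => 2 * edens u v x) ρ = 2 * sint (edens u v) ρ := by
        rw [sint, sint, integral_const_mul]
      rw [this]; ring)
    (Continuous.intervalIntegrable (by fun_prop) _ _)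
  rw [intervalIntegral.integral_const_mul] at this
  rw [acfI, this, sint_fderiv_self, sint_fderiv_self]
  have h0 : 0 ≤ ((n:ℝ) - 2) * sint (fun y => u y ^ 2) 0 :=
    mul_nonneg (by linarith) (integral_nonneg fun θ => sq_nonneg _)
  linarith

/-- The logarithmic derivative of the weighted energy is bounded below by the characteristic exponent. -/
lemma two_mul_gam_mul_acfI_le {n : ℕ} (hn : 2 ≤ n) {u v : EuclideanSpace ℝ (Fin n) → ℝ} (hu : ContDiff ℝ 2 u)
    (hv : Continuous v) (hu0 : ∀ x, 0 < u x) (hlap : ∀ x, lap u x = u x * v x ^ 2) {r : ℝ} (hr : 0 < r) :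
    2 * gam n (rayl u v r) * acfI u v r ≤ r * (r * sint (edens u v) r) := by
  have hn1 : 1 ≤ n := by omega
  have hu1 : ContDiff ℝ 1 u := hu.of_le (by norm_num)
  have hcu : Continuous fun θ : EuclideanSpace ℝ (Fin n) => u (r • θ) := hu.continuous.comp (by fun_prop)
  have hcv : Continuous fun θ : EuclideanSpace ℝ (Fin n) => v (r • θ) := hv.comp (by fun_prop)
  set a := sint (fun x => u x ^ 2) r with ha
  have ha0 : 0 < a := sint_pos hn1 (hu.continuous.pow 2) (fun x => pow_pos (hu0 x) 2) r
  set Q := sint (fun x => u x ^ 2 * v x ^ 2) r with hQ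
  set D := ∫ θ : sphere (0 : EuclideanSpace ℝ (Fin n)) 1, tanSq u r θ ∂(sphm n) with hD
  have hQ0 : 0 ≤ Q := integral_nonneg fun θ => by positivity
  have hD0 : 0 ≤ D := integral_nonneg fun θ => tanSq_nonneg u r θ
  have hΛ : rayl u v r = (D + r ^ 2 * Q) / a := rfl
  have hΛ0 : 0 ≤ rayl u v r := by rw [hΛ]; positivity
  set γ := gam n (rayl u v r) with hγ
  have hγ0 : 0 ≤ γ := gam_nonneg hn hΛ0
  have hγm : γ * (γ + n - 2) * a = D + r ^ 2 * Q := by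
    rw [hγ, gam_mul hΛ0, hΛ]; field_simp
  have hI := two_mul_acfI_le hn hu hv hlap hr.le
  set N : EuclideanSpace ℝ (Fin n) → ℝ := fun θ => r * ⟪gradient u (r • θ), θ⟫ with hN
  have hcg := continuous_gradient hu1
  have hcN : Continuous N := by
    have : Continuous fun θ : EuclideanSpace ℝ (Fin n) => gradient u (r • θ) := hcg.comp (by fun_prop)
    fun_prop
  set X := ∫ θ : sphere (0 : EuclideanSpace ℝ (Fin n)) 1, N θ ^ 2 ∂(sphm n) with hX
  set Y := ∫ θ : sphere (0 : EuclideanSpace ℝ (Fin n)) 1, u (r • (θ : EuclideanSpace ℝ (Fin n))) * N θ ∂(sphm n) with hY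
  have hdY : r * dsint (fun x => u x ^ 2) r = 2 * Y := by
    rw [dsint, hY, ← integral_const_mul, ← integral_const_mul]
    refine integral_congr_ae (ae_of_all _ fun θ => ?_)
    have := ((hu1.differentiable one_ne_zero (r • (θ : EuclideanSpace ℝ (Fin n)))).hasFDerivAt.pow 2).fderiv
    simp only
    rw [this]
    simp only [hN, inner_gradient_eq, smul_apply, smul_eq_mul]
    simp
    ring
  have iX : Integrable (fun θ : sphere (0 : EuclideanSpace ℝ (Fin n)) 1 => N θ ^ 2) (sphm n) := integrable_sphm (hcN.pow 2)
  have iY : Integrable (fun θ : sphere (0 : EuclideanSpace ℝ (Fin n)) 1 => u (r • (θ : EuclideanSpace ℝ (Fin n))) * N θ) (sphm n) := integrable_sphm (hcu.mul hcN)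
  have ia : Integrable (fun θ : sphere (0 : EuclideanSpace ℝ (Fin n)) 1 => u (r • (θ : EuclideanSpace ℝ (Fin n))) ^ 2) (sphm n) := integrable_sphm (hcu.pow 2)
  have iD := integrable_sphm (continuous_tanSq hu1 r)
  have iQ : Integrable (fun θ : sphere (0 : EuclideanSpace ℝ (Fin n)) 1 => u (r • (θ : EuclideanSpace ℝ (Fin n))) ^ 2 * v (r • (θ : EuclideanSpace ℝ (Fin n))) ^ 2) (sphm n) := integrable_sphm ((hcu.pow 2).mul (hcv.pow 2))
  have hE : r * (r * sint (edens u v) r) = X + D + r ^ 2 * Q := by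
    have : X + D + r ^ 2 * Q = ∫ θ : sphere (0 : EuclideanSpace ℝ (Fin n)) 1,
        ((N θ ^ 2 + tanSq u r θ) + r ^ 2 * (u (r • (θ : EuclideanSpace ℝ (Fin n))) ^ 2 * v (r • (θ : EuclideanSpace ℝ (Fin n))) ^ 2)) ∂(sphm n) := by
      rw [integral_add (f := fun θ : sphere (0 : EuclideanSpace ℝ (Fin n)) 1 => N θ ^ 2 + tanSq u r θ) (iX.add iD) (iQ.const_mul _), integral_add iX iD, integral_const_mul]
      rfl
    rw [this, sint, ← integral_const_mul, ← integral_const_mul]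
    refine integral_congr_ae (ae_of_all _ fun θ => ?_)
    simp only [edens, hN, tanSq]
    ring
  have hsq : 0 ≤ X - 2 * γ * Y + γ ^ 2 * a := by
    have : X - 2 * γ * Y + γ ^ 2 * a = ∫ θ : sphere (0 : EuclideanSpace ℝ (Fin n)) 1,
        ((N θ ^ 2 - 2 * γ * (u (r • (θ : EuclideanSpace ℝ (Fin n))) * N θ)) + γ ^ 2 * u (r • (θ : EuclideanSpace ℝ (Fin n))) ^ 2) ∂(sphm n) := by
      rw [integral_add (f := fun θ : sphere (0 : EuclideanSpace ℝ (Fin n)) 1 => N θ ^ 2 - 2 * γ * (u (r • (θ : EuclideanSpace ℝ (Fin n))) * N θ)) (iX.sub (iY.const_mul _)) (ia.const_mul _), integral_sub iX (iY.const_mul _), integral_const_mul, integral_const_mul]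
      rfl
    rw [this]
    refine integral_nonneg fun θ => ?_
    have : N θ ^ 2 - 2 * γ * (u (r • (θ : EuclideanSpace ℝ (Fin n))) * N θ) + γ ^ 2 * u (r • (θ : EuclideanSpace ℝ (Fin n))) ^ 2 =
      (N θ - γ * u (r • (θ : EuclideanSpace ℝ (Fin n)))) ^ 2 := by ring
    simp only [this, Pi.zero_apply]
    positivity
  rw [hdY] at hI
  rw [hE]
  have := mul_le_mul_of_nonneg_left hI hγ0
  nlinarith

/-- Integrating a differential inequality for a product of two positive functions. -/
lemma monotoneOn_exp_mul_of_le {I₁ I₂ D₁ D₂ γ₁ γ₂ : ℝ → ℝ} {B β : ℝ} (hβ : 0 < β)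
    (h₁ : ∀ r : ℝ, 0 < r → 0 < I₁ r) (h₂ : ∀ r : ℝ, 0 < r → 0 < I₂ r)
    (hd₁ : ∀ r, HasDerivAt I₁ (D₁ r) r) (hd₂ : ∀ r, HasDerivAt I₂ (D₂ r) r)
    (hg₁ : ∀ r : ℝ, 0 < r → 2 * γ₁ r * I₁ r ≤ r * D₁ r) (hg₂ : ∀ r : ℝ, 0 < r → 2 * γ₂ r * I₂ r ≤ r * D₂ r)
    (hγ : ∀ r : ℝ, 1 ≤ r → 2 - B * r ^ (-β) ≤ γ₁ r + γ₂ r) :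
    MonotoneOn (fun r : ℝ => Real.exp (-(2 * B / β * r ^ (-β))) * (r ^ (-4 : ℝ) * (I₁ r * I₂ r)))
      (Set.Ici 1) := by
  set g : ℝ → ℝ := fun r => -(2 * B / β * r ^ (-β)) + (-4 * Real.log r + (Real.log (I₁ r) + Real.log (I₂ r))) with hg
  have hd : ∀ r : ℝ, 0 < r → HasDerivAt g
      (-(2 * B / β * (-β * r ^ (-β - 1))) + (-4 * r⁻¹ + (D₁ r / I₁ r + D₂ r / I₂ r))) r := by
    intro r hr
    exact ((Real.hasDerivAt_rpow_const (Or.inl hr.ne')).const_mul _).neg.add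
      (((Real.hasDerivAt_log hr.ne').const_mul _).add
        (((hd₁ r).log (h₁ r hr).ne').add ((hd₂ r).log (h₂ r hr).ne')))
  have hmono : MonotoneOn g (Set.Ici 1) := by
    refine monotoneOn_of_deriv_nonneg (convex_Ici 1)
      (fun r hr => (hd r (zero_lt_one.trans_le hr)).continuousAt.continuousWithinAt)
      (fun r hr => ?_) (fun r hr => ?_)
    · rw [interior_Ici] at hr
      exact (hd r (zero_lt_one.trans hr)).differentiableAt.differentiableWithinAt
    · rw [interior_Ici] at hr
      have hr0 : 0 < r := zero_lt_one.trans hr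
      rw [(hd r hr0).deriv]
      have e1 : 2 * γ₁ r * r⁻¹ ≤ D₁ r / I₁ r := by
        rw [le_div_iff₀ (h₁ r hr0), ← div_eq_mul_inv, div_mul_eq_mul_div, div_le_iff₀ hr0]
        linarith [hg₁ r hr0]
      have e2 : 2 * γ₂ r * r⁻¹ ≤ D₂ r / I₂ r := by
        rw [le_div_iff₀ (h₂ r hr0), ← div_eq_mul_inv, div_mul_eq_mul_div, div_le_iff₀ hr0]
        linarith [hg₂ r hr0]
      have e3 := mul_le_mul_of_nonneg_right (hγ r (le_of_lt hr)) (inv_nonneg.2 hr0.le)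
      have e4 : r ^ (-β - 1) = r ^ (-β) * r⁻¹ := by
        rw [Real.rpow_sub_one hr0.ne', div_eq_mul_inv]
      have e5 : 2 * B / β * (-β * r ^ (-β - 1)) = -(2 * B * r ^ (-β) * r⁻¹) := by
        rw [e4]; field_simp
      rw [e5]
      nlinarith
  have hexp : ∀ r ∈ Set.Ici (1:ℝ), Real.exp (g r) =
      Real.exp (-(2 * B / β * r ^ (-β))) * (r ^ (-4 : ℝ) * (I₁ r * I₂ r)) := by
    intro r hr
    have hr0 : 0 < r := zero_lt_one.trans_le hr
    rw [hg, Real.exp_add, Real.exp_add, Real.exp_add, Real.exp_log (h₁ r hr0), Real.exp_log (h₂ r hr0),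
      Real.rpow_def_of_pos hr0 (-4), mul_comm (-4) (Real.log r)]
  intro a ha b hb hab
  simp only [← hexp a ha, ← hexp b hb]
  exact Real.exp_le_exp.2 (hmono ha hb hab)

lemma acfI_pos {n : ℕ} (hn : 2 ≤ n) {u v : EuclideanSpace ℝ (Fin n) → ℝ} (hu : ContDiff ℝ 1 u)
    (hv : Continuous v) (hu0 : ∀ x, 0 < u x) (hv0 : ∀ x, 0 < v x) {r : ℝ} (hr : 0 < r) :
    0 < acfI u v r := by
  have hc := continuous_sint (continuous_edens hu hv)
  refine intervalIntegral.intervalIntegral_pos_of_pos_on (Continuous.intervalIntegrable (by fun_prop) _ _)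
    (fun s hs => mul_pos hs.1 (sint_pos (by omega) (continuous_edens hu hv) (fun x => ?_) s)) hr
  have := hu0 x
  have := hv0 x
  unfold edens; positivity

lemma monotoneOn_acfI {n : ℕ} {u v : EuclideanSpace ℝ (Fin n) → ℝ} (hu : ContDiff ℝ 1 u)
    (hv : Continuous v) : MonotoneOn (acfI u v) (Set.Ici 0) := by
  refine monotoneOn_of_deriv_nonneg (convex_Ici 0)
    (fun r _ => (hasDerivAt_acfI hu hv r).continuousAt.continuousWithinAt)
    (fun r _ => (hasDerivAt_acfI hu hv r).differentiableAt.differentiableWithinAt) (fun r hr => ?_)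
  rw [interior_Ici] at hr
  rw [(hasDerivAt_acfI hu hv r).deriv]
  exact mul_nonneg (le_of_lt hr) (integral_nonneg fun θ => edens_nonneg u v _)

/-- The weighted energy in `B_r` is controlled by the spherical mean of `u²` at radius `2r`. -/
lemma acfI_le_sint {n : ℕ} (hn : 2 ≤ n) {u v : EuclideanSpace ℝ (Fin n) → ℝ} (hu : ContDiff ℝ 2 u)
    (hv : Continuous v) (hlap : ∀ x, lap u x = u x * v x ^ 2) {r : ℝ} (hr : 0 < r) :
    acfI u v r ≤ 2 ^ (n - 2) * sint (fun x => u x ^ 2) (2 * r) := by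
  have hu1 : ContDiff ℝ 1 u := hu.of_le (by norm_num)
  obtain ⟨k, rfl⟩ : ∃ k, n = k + 2 := ⟨n - 2, by omega⟩
  rw [Nat.add_sub_cancel]
  set M := sint (fun x => u x ^ 2) with hM
  set c := acfI u v r * r ^ k / r with hc
  have hM0 : 0 ≤ M r := integral_nonneg fun θ => sq_nonneg _
  have hI0 : 0 ≤ acfI u v r := by
    have := monotoneOn_acfI hu1 hv (Set.mem_Ici.2 le_rfl) (Set.mem_Ici.2 hr.le) hr.le
    simpa [acfI] using this
  have hd : ∀ s : ℝ, HasDerivAt (fun s => s ^ k * M s - c * s)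
      ((k * s ^ (k - 1)) * M s + s ^ k * dsint (fun x => u x ^ 2) s - c * 1) s := fun s =>
    ((hasDerivAt_pow k s).mul (hasDerivAt_sint (hu1.pow 2) s)).sub ((hasDerivAt_id s).const_mul c)
  have hmono : MonotoneOn (fun s => s ^ k * M s - c * s) (Set.Icc r (2 * r)) := by
    refine monotoneOn_of_deriv_nonneg (convex_Icc _ _)
      (fun s _ => (hd s).continuousAt.continuousWithinAt)
      (fun s _ => (hd s).differentiableAt.differentiableWithinAt) (fun s hs => ?_)
    rw [interior_Icc] at hs
    rw [(hd s).deriv]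
    have hs0 : 0 < s := hr.trans hs.1
    have h1 := two_mul_acfI_le hn hu hv hlap hs0.le
    have h2 := monotoneOn_acfI hu1 hv (Set.mem_Ici.2 hr.le) (Set.mem_Ici.2 hs0.le) hs.1.le
    have h3 : (k * s ^ (k - 1)) * M s * s = k * s ^ k * M s := by
      rcases k with _ | k
      · simp
      · rw [Nat.add_sub_cancel]; ring
    have h4 : r ^ k ≤ s ^ k := pow_le_pow_left₀ hr.le hs.1.le k
    have h5 : c * s ≤ 2 * acfI u v r * r ^ k := by
      have : c * (2 * r) = 2 * acfI u v r * r ^ k := by rw [hc]; field_simp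
      rw [← this]
      exact mul_le_mul_of_nonneg_left hs.2.le (by positivity)
    push_cast at h1
    have h6 : 2 * acfI u v r * r ^ k ≤ s ^ k * (s * dsint (fun x => u x ^ 2) s + k * M s) := by
      calc 2 * acfI u v r * r ^ k ≤ 2 * acfI u v r * s ^ k := mul_le_mul_of_nonneg_left h4 (by positivity)
        _ = s ^ k * (2 * acfI u v r) := by ring
        _ ≤ _ := mul_le_mul_of_nonneg_left (by linarith) (by positivity)
    refine nonneg_of_mul_nonneg_left (b := s) ?_ hs0
    nlinarith
  have := hmono (Set.left_mem_Icc.2 (by linarith)) (Set.right_mem_Icc.2 (by linarith)) (by linarith)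
  simp only at this
  have h7 : c * r = acfI u v r * r ^ k := by rw [hc]; field_simp
  have h8 : 0 ≤ r ^ k * M r := by positivity
  rw [mul_pow] at this
  have h9 : r ^ k * acfI u v r ≤ r ^ k * (2 ^ k * M (2 * r)) := by nlinarith
  exact le_of_mul_le_mul_left h9 (by positivity)

/-- A lower growth bound on `[2, ∞)` for a positive continuous function extends to `[1, ∞)`. -/
lemma exists_le_of_le_of_two_le {M : ℝ → ℝ} (hM : Continuous M) (h0 : ∀ r, 0 < M r) (p : ℕ) {c : ℝ}
    (hc : 0 < c) (h : ∀ r : ℝ, 2 ≤ r → c * r ^ p ≤ M r) : ∃ c', 0 < c' ∧ ∀ r : ℝ, 1 ≤ r → c' * r ^ p ≤ M r := by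
  obtain ⟨x, -, hmin⟩ := isCompact_Icc.exists_isMinOn (Set.nonempty_Icc.2 (one_le_two (α := ℝ))) hM.continuousOn
  refine ⟨min c (M x / 2 ^ p), lt_min hc (div_pos (h0 x) (by positivity)), fun r hr => ?_⟩
  rcases le_total 2 r with h2 | h2
  · exact (mul_le_mul_of_nonneg_right (min_le_left _ _) (by positivity)).trans (h r h2)
  · calc min c (M x / 2 ^ p) * r ^ p ≤ M x / 2 ^ p * 2 ^ p :=
        mul_le_mul (min_le_right _ _) (pow_le_pow_left₀ (by linarith) h2 p) (by positivity)
          (div_pos (h0 x) (by positivity)).le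
      _ = M x := by field_simp
      _ ≤ M r := hmin ⟨hr, h2⟩

/-- Growth of the spherical mean follows from growth of the weighted energy. -/
lemma exists_le_sint_of_le_acfI {n : ℕ} (hn : 2 ≤ n) {u v : EuclideanSpace ℝ (Fin n) → ℝ}
    (hu : ContDiff ℝ 2 u) (hv : Continuous v) (hu0 : ∀ x, 0 < u x)
    (hlap : ∀ x, lap u x = u x * v x ^ 2) (p : ℕ) {c : ℝ} (hc : 0 < c)
    (h : ∀ r : ℝ, 1 ≤ r → c * r ^ p ≤ acfI u v r) :
    ∃ c', 0 < c' ∧ ∀ r : ℝ, 1 ≤ r → c' * r ^ p ≤ sint (fun x => u x ^ 2) r := by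
  refine exists_le_of_le_of_two_le (M := sint fun x => u x ^ 2) (c := c / 2 ^ p / 2 ^ (n - 2)) (continuous_sint (hu.continuous.pow 2))
    (fun r => sint_pos (by omega) (hu.continuous.pow 2) (fun x => pow_pos (hu0 x) 2) r) p (by positivity)
    (fun r hr => ?_)
  have h1 := acfI_le_sint hn hu hv hlap (r := r / 2) (by linarith)
  have h2 := h (r / 2) (by linarith)
  rw [show 2 * (r / 2) = r by ring] at h1
  have h3 := h2.trans h1
  rw [div_pow] at h3
  calc c / 2 ^ p / 2 ^ (n - 2) * r ^ p = c * (r ^ p / 2 ^ p) / 2 ^ (n - 2) := by ring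
    _ ≤ _ := by rw [div_le_iff₀ (by positivity)]; linarith

/-- Quadratic growth of the weighted energy of a function of linear growth. -/
lemma exists_acfI_le {n : ℕ} (hn : 2 ≤ n) {u v : EuclideanSpace ℝ (Fin n) → ℝ}
    (hu : ContDiff ℝ 2 u) (hv : Continuous v) (hu0 : ∀ x, 0 < u x)
    (hlap : ∀ x, lap u x = u x * v x ^ 2) {C₀ : ℝ} (hC₀ : 0 < C₀) (hgrowth : ∀ x, u x ≤ C₀ * (1 + ‖x‖)) :
    ∃ C, 0 < C ∧ ∀ r : ℝ, 1 ≤ r → acfI u v r ≤ C * r ^ 2 := by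
  have hσ := sphm_univ_pos (n := n) (by omega)
  set σ := (sphm n).real Set.univ with hσd
  refine ⟨2 ^ (n - 2) * ((3 * C₀) ^ 2 * σ), by positivity, fun r hr => ?_⟩
  have hr0 : 0 < r := by linarith
  refine (acfI_le_sint hn hu hv hlap hr0).trans ?_
  rw [mul_assoc]
  refine mul_le_mul_of_nonneg_left ?_ (by positivity)
  have hcu : Continuous fun θ : EuclideanSpace ℝ (Fin n) => u ((2 * r) • θ) ^ 2 :=
    (hu.continuous.comp (by fun_prop)).pow 2
  calc sint (fun x => u x ^ 2) (2 * r) ≤ ∫ _ : sphere (0 : EuclideanSpace ℝ (Fin n)) 1, (3 * C₀ * r) ^ 2 ∂(sphm n) := by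
        refine integral_mono (integrable_sphm hcu) (integrable_const _) fun θ => ?_
        refine pow_le_pow_left₀ (hu0 _).le ((hgrowth _).trans ?_) 2
        rw [norm_smul_sphere θ (by positivity : 0 < 2 * r)]
        nlinarith
    _ = (3 * C₀) ^ 2 * σ * r ^ 2 := by
        rw [integral_const, smul_eq_mul]; ring

/-- Alt–Caffarelli–Friedman type monotonicity formula: for an entire solution with linear
growth there is a constant C > 0 such that r ↦ e^{-C r^{-1/2}} J(r; 0) is nondecreasing
on (1, ∞). -/
theorem acf_monotonicity {n : ℕ} (hn : 2 ≤ n)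
    (u v : EuclideanSpace ℝ (Fin n) → ℝ) (hsol : IsSolution u v)
    (C₀ : ℝ) (hC₀ : 0 < C₀) (hgrowth : ∀ x, u x + v x ≤ C₀ * (1 + ‖x‖)) :
    ∃ C : ℝ, 0 < C ∧
      MonotoneOn (fun r : ℝ => Real.exp (-(C * r ^ (-(1 : ℝ) / 2))) * Jfun u v 0 r)
        (Set.Ioi 1) := by
  obtain ⟨hu', hv', hu0, hv0, hlu, hlv⟩ := hsol
  have hu : ContDiff ℝ 2 u := contDiff_infty.1 hu' 2
  have hv : ContDiff ℝ 2 v := contDiff_infty.1 hv' 2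
  have hu1 : ContDiff ℝ 1 u := hu.of_le (by norm_num)
  have hv1 : ContDiff ℝ 1 v := hv.of_le (by norm_num)
  obtain ⟨B, hB, hgam⟩ := exists_gam_add_gam_ge hn
  obtain ⟨Cu, hCu, hIu⟩ := exists_acfI_le hn hu hv.continuous hu0 hlu hC₀
    (fun x => by linarith [hgrowth x, hv0 x])
  have hpu : ∀ r : ℝ, 0 < r → 0 < acfI u v r := fun r hr => acfI_pos hn hu1 hv.continuous hu0 hv0 hr
  have hpv : ∀ r : ℝ, 0 < r → 0 < acfI v u r := fun r hr => acfI_pos hn hv1 hu.continuous hv0 hu0 hr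
  have key : ∀ (p : ℕ) (c : ℝ), 0 < c → (∀ r : ℝ, 1 ≤ r → c * r ^ p ≤ acfI v u r) →
      ∀ β : ℝ, 0 < β → β ≤ (2 + p) / 5 → ∃ C : ℝ, 0 < C ∧
        MonotoneOn (fun r : ℝ => Real.exp (-(C * r ^ (-β))) * (r ^ (-4 : ℝ) * (acfI u v r * acfI v u r)))
          (Set.Ici 1) := by
    intro p c hc hIv β hβ hβp
    obtain ⟨d, hd, hM⟩ := exists_le_sint_of_le_acfI hn hv hu.continuous hv0 hlv p hc hIv
    refine ⟨2 * (B * d ^ (-(1:ℝ) / 5)) / β, by positivity, ?_⟩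
    refine monotoneOn_exp_mul_of_le (γ₁ := fun r => gam n (rayl u v r)) (γ₂ := fun r => gam n (rayl v u r))
      hβ hpu hpv (hasDerivAt_acfI hu1 hv.continuous) (hasDerivAt_acfI hv1 hu.continuous)
      (fun r hr => two_mul_gam_mul_acfI_le hn hu hv.continuous hu0 hlu hr)
      (fun r hr => two_mul_gam_mul_acfI_le hn hv hu.continuous hv0 hlv hr) (fun r hr => ?_)
    have hr0 : 0 < r := by linarith
    refine le_trans ?_ (hgam u v hu1 hv1 hu0 hv0 r hr0)
    have h1 : d * r ^ ((2:ℝ) + p) ≤ r ^ 2 * sint (fun x => v x ^ 2) r := by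
      rw [Real.rpow_add hr0, Real.rpow_natCast, Real.rpow_ofNat]
      have := mul_le_mul_of_nonneg_left (hM r hr) (sq_nonneg r)
      linarith
    have h2 : (r ^ 2 * sint (fun x => v x ^ 2) r) ^ (-(1:ℝ) / 5) ≤ d ^ (-(1:ℝ) / 5) * r ^ (-β) := by
      calc (r ^ 2 * sint (fun x => v x ^ 2) r) ^ (-(1:ℝ) / 5) ≤ (d * r ^ ((2:ℝ) + p)) ^ (-(1:ℝ) / 5) :=
            Real.rpow_le_rpow_of_nonpos (by positivity) h1 (by norm_num)
        _ = d ^ (-(1:ℝ) / 5) * r ^ (((2:ℝ) + p) * (-(1:ℝ) / 5)) := by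
            rw [Real.mul_rpow hd.le (by positivity), ← Real.rpow_mul hr0.le]
        _ ≤ _ := by
            refine mul_le_mul_of_nonneg_left ?_ (by positivity)
            exact Real.rpow_le_rpow_of_exponent_le hr (by linarith)
    have := mul_le_mul_of_nonneg_left h2 hB.le
    linarith
  have hv_low : ∀ r : ℝ, 1 ≤ r → acfI v u 1 * r ^ 0 ≤ acfI v u r := fun r hr => by
    rw [pow_zero, mul_one]
    exact monotoneOn_acfI hv1 hu.continuous (Set.mem_Ici.2 zero_le_one) (Set.mem_Ici.2 (by linarith)) hr
  obtain ⟨C₁, hC₁, hmono₁⟩ := key 0 _ (hpv 1 one_pos) hv_low (2 / 5) (by norm_num) (by norm_num)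
  set c₁ := Real.exp (-(C₁ * 1 ^ (-(2 / 5 : ℝ)))) * (1 ^ (-4 : ℝ) * (acfI u v 1 * acfI v u 1)) with hc₁
  have hc₁0 : 0 < c₁ := by
    have := hpu 1 one_pos
    have := hpv 1 one_pos
    positivity
  have hv_quad : ∀ r : ℝ, 1 ≤ r → c₁ / Cu * r ^ 2 ≤ acfI v u r := fun r hr => by
    have hr0 : 0 < r := by linarith
    have h1 := hmono₁ (Set.mem_Ici.2 le_rfl) (Set.mem_Ici.2 hr) hr
    simp only at h1
    rw [← hc₁] at h1
    have h2 : Real.exp (-(C₁ * r ^ (-(2 / 5 : ℝ)))) ≤ 1 := Real.exp_le_one_iff.2 (by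
      have : 0 ≤ C₁ * r ^ (-(2 / 5 : ℝ)) := by positivity
      linarith)
    have hu_r := hpu r hr0
    have hv_r := hpv r hr0
    have h3 : c₁ ≤ r ^ (-4 : ℝ) * (Cu * r ^ 2 * acfI v u r) := by
      refine h1.trans ((mul_le_of_le_one_left (by positivity) h2).trans ?_)
      have := hIu r hr
      gcongr
    have h4 : r ^ (-4 : ℝ) * (Cu * r ^ 2 * acfI v u r) = Cu * acfI v u r / r ^ 2 := by
      rw [Real.rpow_neg hr0.le, Real.rpow_ofNat]
      field_simp
    rw [h4, le_div_iff₀ (by positivity)] at h3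
    rw [div_mul_eq_mul_div, div_le_iff₀ hCu]
    linarith
  obtain ⟨C, hC, hmono⟩ := key 2 _ (by positivity) hv_quad (1 / 2) (by norm_num) (by norm_num)
  refine ⟨C, hC, fun a ha b hb hab => ?_⟩
  have := hmono (Set.mem_Ici.2 (le_of_lt ha)) (Set.mem_Ici.2 (le_of_lt hb)) hab
  simp only at this ⊢
  rw [Jfun_eq hn hu1 hv1 (zero_lt_one.trans ha), Jfun_eq hn hu1 hv1 (zero_lt_one.trans hb), neg_div]
  exact this
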